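/- arXiv:1708.00615 — 2 statements merged into one kernel-verified Lean document; each statement's English description precedes it below -/
import Mathlib

section
/- If p is a prime and G is a Miller p-group, then |G| ≥ p^6. -/
/-- A Miller group: a finite non-abelian group whose full automorphism group is abelian. -/
def IsMiller (G : Type*) [Group G] : Prop :=
  Finite G ∧ (∃ a b : G, a * b ≠ b * a) ∧ ∀ φ ψ : MulAut G, φ * ψ = ψ * φ

open Subgroup
open scoped commutatorElement

/-- Every commutator of `G` is central, that is, `G` has nilpotency class at most two. -/
def CentralCommutators (G : Type*) [Group G] : Prop :=
  ∀ x y : G, ⁅x, y⁆ ∈ center G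

/-- Every automorphism of `G` induces the identity on `G ⧸ center G`. -/
def CentralAutomorphisms (G : Type*) [Group G] : Prop :=
  ∀ (φ : MulAut G) (g : G), φ g * g⁻¹ ∈ center G

section ClassTwo

variable {G : Type*} [Group G]

theorem IsMiller.centralAutomorphisms (hG : IsMiller G) : CentralAutomorphisms G := by
  intro φ g
  rw [mem_center_iff]
  intro x
  obtain ⟨y, hy⟩ := φ.surjective (g⁻¹ * x * g)
  have h : φ (g * y * g⁻¹) = g * φ y * g⁻¹ := DFunLike.congr_fun (hG.2.2 φ (MulAut.conj g)) y
  rw [map_mul, map_mul, map_inv, hy] at h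
  have h' : φ g * (g⁻¹ * x * g) * (φ g)⁻¹ = x := by
    rw [h]; group
  calc x * (φ g * g⁻¹) = φ g * (g⁻¹ * x * g) * (φ g)⁻¹ * (φ g * g⁻¹) := by rw [h']
    _ = φ g * g⁻¹ * x := by group

theorem CentralAutomorphisms.centralCommutators (hG : CentralAutomorphisms G) :
    CentralCommutators G := by
  intro x y
  simpa [commutatorElement_def] using hG (MulAut.conj x) y

theorem commutatorElement_eq_one_of_mem_center_left {z : G} (hz : z ∈ center G) (x : G) :
    ⁅z, x⁆ = 1 :=
  commutatorElement_eq_one_iff_mul_comm.2 (mem_center_iff.1 hz x).symm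

theorem commutatorElement_eq_one_of_mem_center_right {z : G} (hz : z ∈ center G) (x : G) :
    ⁅x, z⁆ = 1 :=
  commutatorElement_eq_one_iff_mul_comm.2 (mem_center_iff.1 hz x)

theorem mem_center_of_forall_commutatorElement {z : G} (h : ∀ x : G, ⁅x, z⁆ = 1) :
    z ∈ center G :=
  mem_center_iff.2 fun x => commutatorElement_eq_one_iff_mul_comm.1 (h x)

theorem mul_mul_inv_eq (x y : G) : x * y * x⁻¹ = ⁅x, y⁆ * y := by
  simp [commutatorElement_def]

namespace CentralCommutators

theorem comm (hG : CentralCommutators G) (x y z : G) : z * ⁅x, y⁆ = ⁅x, y⁆ * z :=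
  mem_center_iff.1 (hG x y) z

theorem mul_left (hG : CentralCommutators G) (x y a : G) : ⁅x * y, a⁆ = ⁅x, a⁆ * ⁅y, a⁆ := by
  rw [commutatorElement_mul_left_eq_conj_mul, hG.comm y a x, hG.comm x a]
  group

/-- Commutation with a fixed element, as an endomorphism of a group of class two. -/
def commHom (hG : CentralCommutators G) (a : G) : G →* G where
  toFun g := ⁅g, a⁆
  map_one' := commutatorElement_one_left a
  map_mul' x y := hG.mul_left x y a

@[simp]
theorem commHom_apply (hG : CentralCommutators G) (a g : G) : hG.commHom a g = ⁅g, a⁆ := rfl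

theorem mul_right (hG : CentralCommutators G) (a x y : G) : ⁅a, x * y⁆ = ⁅a, x⁆ * ⁅a, y⁆ := by
  rw [← commutatorElement_inv, hG.mul_left, mul_inv_rev, commutatorElement_inv,
    commutatorElement_inv, hG.comm a x]

theorem zpow_left (hG : CentralCommutators G) (x a : G) (i : ℤ) : ⁅x ^ i, a⁆ = ⁅x, a⁆ ^ i :=
  map_zpow (hG.commHom a) x i

theorem zpow_right (hG : CentralCommutators G) (a x : G) (i : ℤ) : ⁅a, x ^ i⁆ = ⁅a, x⁆ ^ i := by
  rw [← commutatorElement_inv, hG.zpow_left, ← inv_zpow, commutatorElement_inv]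

theorem pow_left (hG : CentralCommutators G) (x a : G) (i : ℕ) : ⁅x ^ i, a⁆ = ⁅x, a⁆ ^ i :=
  map_pow (hG.commHom a) x i

theorem pow_right (hG : CentralCommutators G) (a x : G) (i : ℕ) : ⁅a, x ^ i⁆ = ⁅a, x⁆ ^ i := by
  rw [← commutatorElement_inv, hG.pow_left, ← inv_pow, commutatorElement_inv]

theorem inv_left (hG : CentralCommutators G) (x a : G) : ⁅x⁻¹, a⁆ = ⁅x, a⁆⁻¹ :=
  map_inv (hG.commHom a) x

theorem mul_pow (hG : CentralCommutators G) (y x : G) (n : ℕ) :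
    (y * x) ^ n = y ^ n * x ^ n * ⁅x, y⁆ ^ n.choose 2 := by
  induction n with
  | zero => simp
  | succ n ih =>
    have h1 : x ^ n * y = ⁅x, y⁆ ^ n * y * x ^ n := by
      rw [← hG.pow_left]; simp [commutatorElement_def]
    have hc : ∀ (z : G) (k : ℕ), z * ⁅x, y⁆ ^ k = ⁅x, y⁆ ^ k * z := fun z k =>
      mem_center_iff.1 (pow_mem (hG x y) k) z
    have h2 : (n + 1).choose 2 = n + n.choose 2 := by
      rw [Nat.choose_succ_succ' n 1, Nat.choose_one_right]
    calc (y * x) ^ (n + 1) = y ^ n * x ^ n * ⁅x, y⁆ ^ n.choose 2 * (y * x) := by rw [pow_succ, ih]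
      _ = ⁅x, y⁆ ^ n.choose 2 * (y ^ n * (x ^ n * y) * x) := by
          rw [hc]; simp only [mul_assoc]
      _ = ⁅x, y⁆ ^ n.choose 2 * (y ^ n * ⁅x, y⁆ ^ n * (y * x ^ n * x)) := by
          rw [h1]; simp only [mul_assoc]
      _ = ⁅x, y⁆ ^ (n.choose 2 + n) * (y ^ (n + 1) * x ^ (n + 1)) := by
          rw [hc (y ^ n) n, pow_add, pow_succ y, pow_succ x]; simp only [mul_assoc]
      _ = _ := by rw [h2, ← hc, add_comm n (n.choose 2)]

end CentralCommutators

end ClassTwo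

section Extension

variable {G : Type*} [Group G]

/-- An automorphism of a cyclic extension `M ⟨g⟩` of a normal subgroup `M`, prescribed by an
injective endomorphism of `M` and the image `g * z` of `g`. -/
theorem exists_mulAut_of_cyclic_extension [Finite G] {M : Subgroup G} [M.Normal] {g z : G} {n : ℕ}
    (hgen : ∀ x : G, ∃ i : ℤ, x * g ^ i ∈ M) (hdvd : ∀ i : ℤ, g ^ i ∈ M → (n : ℤ) ∣ i)
    (hgn : g ^ n ∈ M) (hz : z ∈ M) (α : M →* G) (hαM : ∀ m, α m ∈ M)
    (hα : Function.Injective α)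
    (hconj : ∀ (m : G) (hm : m ∈ M) (hm' : g * m * g⁻¹ ∈ M),
      α ⟨g * m * g⁻¹, hm'⟩ = g * z * α ⟨m, hm⟩ * (g * z)⁻¹)
    (hpow : α ⟨g ^ n, hgn⟩ = (g * z) ^ n) :
    ∃ φ : MulAut G, (∀ m : M, φ m = α m) ∧ φ g = g * z := by
  set h := g * z with hh
  let c : Multiplicative ℤ →* MulAut M := zpowersHom _ (MulAut.conjNormal g)
  have hc : ∀ i : ℤ, α.comp (MulEquiv.toMonoidHom (c (Multiplicative.ofAdd i))) =
      (MulEquiv.toMonoidHom (MulAut.conj (zpowersHom G h (Multiplicative.ofAdd i)))).comp α := by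
    have key : ∀ m, α (MulAut.conjNormal g m) = h * α m * h⁻¹ := fun m => hconj m m.2 _
    have key' : ∀ m, α ((MulAut.conjNormal g)⁻¹ m) = h⁻¹ * α m * h := by
      intro m
      have := key ((MulAut.conjNormal g)⁻¹ m)
      rw [MulAut.apply_inv_self] at this
      rw [this]; group
    intro i
    ext m
    simp only [c, MonoidHom.comp_apply, MulEquiv.coe_toMonoidHom, zpowersHom_apply,
      toAdd_ofAdd, MulAut.conj_apply]
    induction i generalizing m with
    | zero => simp
    | succ i ih => rw [zpow_add_one, MulAut.mul_apply, ih, key, zpow_add_one]; group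
    | pred i ih => rw [zpow_sub_one, MulAut.mul_apply, ih, key', zpow_sub_one]; group
  let c' : M ⋊[c] Multiplicative ℤ →* G := SemidirectProduct.lift M.subtype (zpowersHom G g) (by
    intro i
    ext m
    obtain ⟨i, rfl⟩ := Multiplicative.ofAdd.surjective i
    simp only [c, MonoidHom.comp_apply, MulEquiv.coe_toMonoidHom, zpowersHom_apply,
      toAdd_ofAdd, MulAut.conj_apply]
    simp only [← map_zpow]
    exact MulAut.conjNormal_apply _ _)
  let f : M ⋊[c] Multiplicative ℤ →* G := SemidirectProduct.lift α (zpowersHom G h) (fun i => hc _)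
  have hc'_apply : ∀ (m : M) (i : ℤ), c' ⟨m, Multiplicative.ofAdd i⟩ = m * g ^ i := fun m i => rfl
  have hf_apply : ∀ (m : M) (i : ℤ), f ⟨m, Multiplicative.ofAdd i⟩ = α m * h ^ i := fun m i => rfl
  have hsurj : Function.Surjective c' := by
    intro x
    obtain ⟨i, hi⟩ := hgen x
    refine ⟨⟨⟨x * g ^ i, hi⟩, Multiplicative.ofAdd (-i)⟩, ?_⟩
    rw [hc'_apply]; simp
  have hmem : ∀ k : ℤ, g ^ (n * k) ∈ M := fun k => by
    rw [zpow_mul, zpow_natCast]; exact zpow_mem hgn k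
  have hpowk : ∀ k : ℤ, α ⟨g ^ (n * k), hmem k⟩ = h ^ (n * k) := by
    intro k
    have : (⟨g ^ (n * k), hmem k⟩ : M) = ⟨g ^ n, hgn⟩ ^ k := by
      ext; simp [zpow_mul]
    rw [this, map_zpow, hpow, zpow_mul, zpow_natCast]
  have hquot : ∀ i : ℤ, h ^ i ∈ M ↔ g ^ i ∈ M := by
    intro i
    rw [← QuotientGroup.eq_one_iff, ← QuotientGroup.eq_one_iff, QuotientGroup.mk_zpow,
      QuotientGroup.mk_zpow, hh, QuotientGroup.mk_mul, (QuotientGroup.eq_one_iff z).2 hz, mul_one]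
  have hker : ∀ x, c' x = 1 ↔ f x = 1 := by
    rintro ⟨m, i⟩
    obtain ⟨i, rfl⟩ := Multiplicative.ofAdd.surjective i
    rw [hc'_apply, hf_apply]
    have main : ∀ k : ℤ, α m * h ^ (n * k) = α (m * ⟨g ^ (n * k), hmem k⟩) := by
      intro k
      rw [map_mul, hpowk]
    constructor
    · intro hx
      have hi : g ^ i ∈ M := by
        rw [eq_inv_of_mul_eq_one_right hx]; exact inv_mem m.2
      obtain ⟨k, rfl⟩ := hdvd i hi
      rw [main, ← map_one α]
      congr 1
      ext
      exact hx
    · intro hx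
      have hi : h ^ i ∈ M := by
        rw [eq_inv_of_mul_eq_one_right hx]; exact inv_mem (hαM m)
      obtain ⟨k, rfl⟩ := hdvd i ((hquot i).1 hi)
      rw [main, ← map_one α] at hx
      exact congrArg Subtype.val (hα hx)
  let φ : G →* G := MonoidHom.liftOfSurjective c' hsurj ⟨f, fun x hx => (hker x).1 hx⟩
  have hφ : ∀ x, φ (c' x) = f x := fun x =>
    MonoidHom.liftOfRightInverse_comp_apply c' _ _ ⟨f, fun x hx => (hker x).1 hx⟩ x
  have hinj : Function.Injective φ := by
    rw [injective_iff_map_eq_one]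
    intro x hx
    obtain ⟨y, rfl⟩ := hsurj x
    rw [hφ] at hx
    exact (hker y).2 hx
  refine ⟨MulEquiv.ofBijective φ (Finite.injective_iff_bijective.1 hinj), fun m => ?_, ?_⟩
  · have := hφ ⟨m, Multiplicative.ofAdd 0⟩
    rw [hc'_apply, hf_apply] at this
    simpa using this
  · have := hφ ⟨1, Multiplicative.ofAdd 1⟩
    rw [hc'_apply, hf_apply] at this
    simpa using this

end Extension

section Functional

theorem exists_addMonoidHom_eq_one {K V : Type*} [Field K] [AddCommGroup V] [Module K V] {v : V}
    (hv : v ≠ 0) : ∃ f : V →+ K, f v = 1 := by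
  obtain ⟨f, hf, -⟩ := Submodule.exists_le_ker_of_notMem (mt (Submodule.mem_bot K).1 hv)
  exact ⟨((f v)⁻¹ • f : V →ₗ[K] K).toAddMonoidHom, inv_mul_cancel₀ hf⟩

theorem exists_hom_of_ne_one {Q H : Type*} [CommGroup Q] [Group H] {p : ℕ} [Fact p.Prime]
    (hpow : ∀ a : Q, a ^ p = 1) {x : Q} (hx : x ≠ 1) {t : H} (ht : t ^ p = 1) :
    ∃ θ : Q →* H, θ x = t ∧ ∀ a, θ a ∈ zpowers t := by
  let module : Module (ZMod p) (Additive Q) := AddCommGroup.zmodModule fun a => hpow a.toMul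
  obtain ⟨f, hf⟩ : ∃ f : Additive Q →+ ZMod p, f (Additive.ofMul x) = 1 :=
    exists_addMonoidHom_eq_one (show Additive.ofMul x ≠ 0 from hx)
  let c : ZMod p →+ Additive H := ZMod.lift p ⟨zmultiplesHom (Additive H) (Additive.ofMul t), by
    simp [← ofMul_pow, ht]⟩
  have hc : ∀ i : ℤ, c (i : ZMod p) = Additive.ofMul (t ^ i) := by
    intro i
    simp [c]
  let θ : Q →* H :=
    { toFun a := (c (f (Additive.ofMul a))).toMul
      map_one' := by simp
      map_mul' a b := by simp }
  have hθ : ∀ a, θ a = (c (f (Additive.ofMul a))).toMul := fun _ => rfl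
  refine ⟨θ, ?_, fun a => ?_⟩
  · rw [hθ, hf]
    simpa using congrArg Additive.toMul (hc 1)
  · obtain ⟨i, hi⟩ := ZMod.intCast_surjective (f (Additive.ofMul a))
    exact ⟨i, by rw [hθ, ← hi, hc]; rfl⟩

/-- A homomorphism to a cyclic group of order `p` killing a given subgroup `S` with elementary
abelian quotient, and prescribed at an element outside `S`. -/
theorem exists_hom_of_notMem {A H : Type*} [Group A] [Group H] {p : ℕ} [Fact p.Prime]
    {S : Subgroup A} (hcomm : ∀ a b : A, ⁅a, b⁆ ∈ S) (hpow : ∀ a : A, a ^ p ∈ S) {x : A}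
    (hx : x ∉ S) {t : H} (ht : t ^ p = 1) :
    ∃ θ : A →* H, (∀ s ∈ S, θ s = 1) ∧ θ x = t ∧ ∀ a, θ a ∈ zpowers t := by
  have hnormal : S.Normal := ⟨fun n hn g => by
    have h : g * n * g⁻¹ = ⁅g, n⁆ * n := by simp [commutatorElement_def]
    rw [h]; exact mul_mem (hcomm g n) hn⟩
  let commGroup : CommGroup (A ⧸ S) :=
    { (inferInstance : Group (A ⧸ S)) with
      mul_comm := by
        intro a b
        induction a using QuotientGroup.induction_on with | H a => ?_
        induction b using QuotientGroup.induction_on with | H b => ?_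
        rw [← commutatorElement_eq_one_iff_mul_comm]
        exact (QuotientGroup.eq_one_iff ⁅a, b⁆).2 (hcomm a b) }
  have hpow' : ∀ a : A ⧸ S, a ^ p = 1 := by
    intro a
    induction a using QuotientGroup.induction_on with | H a => ?_
    exact (QuotientGroup.eq_one_iff (a ^ p)).2 (hpow a)
  obtain ⟨θ, hθx, hθ⟩ :=
    exists_hom_of_ne_one (H := H) hpow' (mt (QuotientGroup.eq_one_iff x).1 hx) ht
  refine ⟨θ.comp (QuotientGroup.mk' S), fun s hs => ?_, hθx, fun a => hθ _⟩
  rw [MonoidHom.comp_apply, QuotientGroup.mk'_apply, (QuotientGroup.eq_one_iff s).2 hs, map_one]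

end Functional

section Elimination

variable {G : Type*} [Group G]

theorem mem_centralizer_singleton_iff_commutatorElement {g x : G} :
    g ∈ centralizer {x} ↔ ⁅g, x⁆ = 1 := by
  rw [mem_centralizer_singleton_iff, commutatorElement_eq_one_iff_mul_comm, eq_comm]

theorem CentralCommutators.centralizer_normal (hG : CentralCommutators G) (x : G) :
    (centralizer {x}).Normal :=
  ⟨fun n hn g => by
    rw [mul_mul_inv_eq]
    exact mul_mem (center_le_centralizer _ (hG g n)) hn⟩

theorem CentralAutomorphisms.false_of_hom [Finite G] (hG : CentralAutomorphisms G) {p : ℕ}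
    [Fact p.Prime] {x y : G} (hyx : ⁅y, x⁆ ≠ 1) (hyxp : ⁅y, x⁆ ^ p = 1)
    (hrange : ∀ g : G, ⁅g, x⁆ ∈ zpowers ⁅y, x⁆) (hy : y ^ p ∈ centralizer {x})
    (θ : centralizer {x} →* G)
    (hθc : ∀ m, θ m ∈ center G) (hθθ : ∀ m (hm : θ m ∈ centralizer {x}), θ ⟨θ m, hm⟩ = 1)
    (hθ : ∀ (g h : G) (hm : ⁅g, h⁆ ∈ centralizer {x}), θ ⟨⁅g, h⁆, hm⟩ = 1)
    (hpow : y ^ p * θ ⟨y ^ p, hy⟩ = (y * x) ^ p) : False := by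
  have hG' := hG.centralCommutators
  have := hG'.centralizer_normal x
  have hxM : x ∈ centralizer {x} := mem_centralizer_singleton_iff_commutatorElement.2 (by simp)
  have hord : orderOf ⁅y, x⁆ = p := orderOf_eq_prime hyxp hyx
  let α : centralizer {x} →* G :=
    { toFun m := m * θ m
      map_one' := by simp
      map_mul' m n := by
        have := mem_center_iff.1 (hθc m) n
        simp only [coe_mul, map_mul, mul_assoc]
        rw [← mul_assoc (n : G), this, mul_assoc] }
  have hα : ∀ m, α m = m * θ m := fun _ => rfl
  suffices h : ∃ φ : MulAut G, (∀ m : centralizer {x}, φ m = α m) ∧ φ y = y * x by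
    obtain ⟨φ, -, hφ⟩ := h
    have := hG φ y
    rw [hφ, mul_mul_inv_eq] at this
    refine hyx (commutatorElement_eq_one_of_mem_center_right ?_ y)
    simpa only [inv_mul_cancel_left] using mul_mem (inv_mem (hG' y x)) this
  refine exists_mulAut_of_cyclic_extension (n := p) (fun w => ?_) (fun i hi => ?_) hy hxM α
    (fun m => ?_) ?_ ?_ hpow
  · obtain ⟨i, hi⟩ := hrange w
    refine ⟨-i, ?_⟩
    rw [mem_centralizer_singleton_iff_commutatorElement, hG'.mul_left, hG'.zpow_left, ← hi]
    simp
  · rw [mem_centralizer_singleton_iff_commutatorElement, hG'.zpow_left] at hi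
    rw [← hord]; exact orderOf_dvd_iff_zpow_eq_one.2 hi
  · exact mul_mem m.2 (center_le_centralizer _ (hθc m))
  · rw [injective_iff_map_eq_one]
    intro m hm
    rw [hα] at hm
    have h1 : (m : G)⁻¹ = θ m := inv_eq_of_mul_eq_one_right hm
    have h2 : θ m⁻¹ = 1 := by
      rw [← hθθ m (center_le_centralizer _ (hθc m))]
      congr 1
      ext
      exact h1
    rw [map_inv, inv_eq_one] at h2
    rw [h2, mul_one] at hm
    exact Subtype.ext hm
  · intro m hm hm'
    have hmx : m * x = x * m := mem_centralizer_singleton_iff.1 hm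
    have hc : ⁅y, m⁆ ∈ centralizer {x} := center_le_centralizer _ (hG' y m)
    have h1 : (⟨y * m * y⁻¹, hm'⟩ : centralizer {x}) = ⟨⁅y, m⁆, hc⟩ * ⟨m, hm⟩ := by
      ext; simp [commutatorElement_def]
    rw [hα, hα, h1, map_mul, hθ, one_mul]
    have h2 := mem_center_iff.1 (hθc ⟨m, hm⟩)
    calc (⁅y, m⁆ * m) * θ ⟨m, hm⟩ = y * m * y⁻¹ * θ ⟨m, hm⟩ := by rw [mul_mul_inv_eq]
      _ = y * m * (x * x⁻¹) * (y⁻¹ * θ ⟨m, hm⟩) := by group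
      _ = y * (m * x) * x⁻¹ * (θ ⟨m, hm⟩ * y⁻¹) := by rw [h2]; group
      _ = y * x * m * (x⁻¹ * θ ⟨m, hm⟩) * y⁻¹ := by rw [hmx]; group
      _ = _ := by rw [h2]; group

/-- In a group with only central automorphisms, transvections do not exist. -/
theorem CentralAutomorphisms.mul_pow_ne [Finite G] (hG : CentralAutomorphisms G) {p : ℕ}
    [Fact p.Prime] {x y : G} (hyx : ⁅y, x⁆ ≠ 1) (hyxp : ⁅y, x⁆ ^ p = 1)
    (hrange : ∀ g : G, ⁅g, x⁆ ∈ zpowers ⁅y, x⁆) : (y * x) ^ p ≠ y ^ p := by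
  intro h
  refine hG.false_of_hom hyx hyxp hrange ?_ 1 ?_ ?_ ?_ ?_
  · rwa [mem_centralizer_singleton_iff_commutatorElement, hG.centralCommutators.pow_left]
  all_goals simp [h, one_mem]

end Elimination

section PrimeCommutator

variable {G : Type*} [Group G] {p : ℕ}

theorem mem_zpowers_of_mem_zpowers_of_ne_one [Fact p.Prime] {c w : G} (hcp : c ^ p = 1)
    (hw : w ∈ zpowers c) (hw1 : w ≠ 1) : c ∈ zpowers w := by
  have hc1 : c ≠ 1 := by
    rintro rfl
    exact hw1 (by simpa using hw)
  obtain ⟨i, rfl⟩ := hw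
  have hc : orderOf c = p := orderOf_eq_prime hcp hc1
  have hw : orderOf (c ^ i) = p := orderOf_eq_prime
    (by rw [← zpow_natCast, ← zpow_mul, mul_comm, zpow_mul, zpow_natCast, hcp, one_zpow]) hw1
  have : Finite (zpowers c) := Nat.finite_of_card_ne_zero (by
    rw [Nat.card_zpowers, hc]; exact (Fact.out : p.Prime).ne_zero)
  have h := Subgroup.eq_of_le_of_card_ge (H := zpowers (c ^ i)) (K := zpowers c)
    (zpowers_le.2 ⟨i, rfl⟩) (by rw [Nat.card_zpowers, Nat.card_zpowers, hc, hw])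
  rw [h]; exact mem_zpowers c

theorem pow_choose_two_eq [Fact p.Prime] {c w : G} (hcp : c ^ p = 1)
    (hw : w ∈ zpowers c) (hw1 : w ≠ 1) : w ^ p.choose 2 = c ^ p.choose 2 := by
  have hp : p.Prime := Fact.out
  obtain ⟨i, rfl⟩ := hw
  rcases hp.eq_two_or_odd' with rfl | hodd
  · rcases Int.even_or_odd' i with ⟨k, rfl | rfl⟩
    · refine absurd ?_ hw1
      change c ^ (2 * k) = 1
      rw [zpow_mul, zpow_ofNat, hcp, one_zpow]
    · rw [Nat.choose_self, pow_one, pow_one]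
      show c ^ (2 * k + 1) = c
      rw [zpow_add_one, zpow_mul, zpow_ofNat, hcp, one_zpow, one_mul]
  · have h2 : 2 < p := lt_of_le_of_ne hp.two_le (by rintro rfl; revert hodd; decide)
    obtain ⟨k, hk⟩ := hp.dvd_choose_self two_ne_zero h2
    rw [hk, pow_mul, pow_mul c, hcp, one_pow]
    rw [← zpow_natCast (c ^ i), ← zpow_mul, mul_comm, zpow_mul, zpow_natCast, hcp, one_zpow,
      one_pow]

/-- The subgroup of `p`-th powers of central elements. -/
def centerPow (G : Type*) [Group G] (p : ℕ) : Subgroup G where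
  carrier := {w | ∃ z ∈ center G, z ^ p = w}
  one_mem' := ⟨1, one_mem _, one_pow p⟩
  mul_mem' := by
    rintro _ _ ⟨z, hz, rfl⟩ ⟨w, hw, rfl⟩
    have h : Commute z w := mem_center_iff.1 hw z
    exact ⟨z * w, mul_mem hz hw, h.mul_pow p⟩
  inv_mem' := by
    rintro _ ⟨z, hz, rfl⟩
    exact ⟨z⁻¹, inv_mem hz, inv_pow z p⟩

theorem mem_centerPow {w : G} : w ∈ centerPow G p ↔ ∃ z ∈ center G, z ^ p = w := Iff.rfl

theorem centerPow_le_center : centerPow G p ≤ center G := by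
  intro w hw
  obtain ⟨z, hz, rfl⟩ := mem_centerPow.1 hw
  exact pow_mem hz p

theorem normal_of_le_center {F : Subgroup G} (hF : F ≤ center G) : F.Normal :=
  ⟨fun n hn g => by rwa [mem_center_iff.1 (hF hn) g, mul_inv_cancel_right]⟩

/-- The `p`-th power map, corrected for `p = 2` so as to become additive modulo the centre. -/
def twistedPow (p : ℕ) (c g : G) : G := g ^ p * c ^ p.choose 2

variable {c : G}

theorem twistedPow_mul_center (x : G) {z : G} (hz : z ∈ center G) :
    twistedPow p c (x * z) = twistedPow p c x * z ^ p := by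
  have h : Commute x z := mem_center_iff.1 hz x
  rw [twistedPow, h.mul_pow, twistedPow, mul_assoc, mul_assoc,
    mem_center_iff.1 (pow_mem hz p)]

/-- The commutator subgroup is contained in the group generated by the central
element `c` of order `p`. -/
structure HasPrimeCommutator (p : ℕ) (c : G) : Prop where
  commutator_mem : ∀ x y : G, ⁅x, y⁆ ∈ zpowers c
  ne_one : c ≠ 1
  pow_eq_one : c ^ p = 1
  mem_center : c ∈ center G

namespace HasPrimeCommutator

theorem centralCommutators (hc : HasPrimeCommutator p c) : CentralCommutators G := fun x y =>
  zpowers_le.2 hc.mem_center (hc.commutator_mem x y)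

theorem commutatorElement_pow (hc : HasPrimeCommutator p c) (x y : G) : ⁅x, y⁆ ^ p = 1 := by
  obtain ⟨i, hi⟩ := hc.commutator_mem x y
  rw [← hi, ← zpow_natCast, zpow_comm, zpow_natCast, hc.pow_eq_one, one_zpow]

theorem pow_mem_center (hc : HasPrimeCommutator p c) (x : G) : x ^ p ∈ center G :=
  mem_center_of_forall_commutatorElement fun y => by
    rw [hc.centralCommutators.pow_right, hc.commutatorElement_pow]

theorem zpow_eq_one_iff (hc : HasPrimeCommutator p c) [Fact p.Prime] {w : G}
    (hw : w ∈ zpowers c) (hw1 : w ≠ 1) {i : ℤ} : w ^ i = 1 ↔ (p : ℤ) ∣ i := by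
  obtain ⟨k, rfl⟩ := hw
  rw [← orderOf_eq_prime (x := c ^ k) (p := p) (by
    rw [← zpow_natCast, zpow_comm, zpow_natCast, hc.pow_eq_one, one_zpow]) hw1,
    orderOf_dvd_iff_zpow_eq_one]

theorem twistedPow_mem_center (hc : HasPrimeCommutator p c) (x : G) : twistedPow p c x ∈ center G :=
  mul_mem (hc.pow_mem_center x) (pow_mem hc.mem_center _)

variable [Fact p.Prime]

theorem twistedPow_zpow (hc : HasPrimeCommutator p c) (x : G) {k : ℤ} (hk : ¬ (p : ℤ) ∣ k) :
    twistedPow p c (x ^ k) = twistedPow p c x ^ k := by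
  have h : (c ^ k) ^ p.choose 2 = c ^ p.choose 2 :=
    pow_choose_two_eq hc.pow_eq_one ⟨k, rfl⟩ (by
      rwa [Ne, hc.zpow_eq_one_iff (mem_zpowers c) hc.ne_one])
  have hcomm : Commute (x ^ p) (c ^ p.choose 2) :=
    mem_center_iff.1 (pow_mem hc.mem_center _) _
  have e1 : (x ^ k) ^ p = (x ^ p) ^ k := by
    rw [← zpow_natCast, zpow_comm, zpow_natCast]
  have e2 : (c ^ p.choose 2) ^ k = c ^ p.choose 2 := by
    rw [← zpow_natCast, zpow_comm, zpow_natCast, h, zpow_natCast]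
  rw [twistedPow, twistedPow, hcomm.mul_zpow, e1, e2]

theorem twistedPow_mul (hc : HasPrimeCommutator p c) {x y : G} (h : ⁅y, x⁆ ≠ 1) :
    twistedPow p c (y * x) = twistedPow p c y * twistedPow p c x := by
  have h' : ⁅x, y⁆ ≠ 1 := by rwa [← commutatorElement_inv, Ne, inv_eq_one]
  rw [twistedPow, hc.centralCommutators.mul_pow,
    pow_choose_two_eq hc.pow_eq_one (hc.commutator_mem x y) h', twistedPow, twistedPow]
  have := mem_center_iff.1 (pow_mem hc.mem_center (p.choose 2)) (x ^ p)
  simp only [mul_assoc]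
  rw [← mul_assoc (c ^ _) (x ^ p), ← this, mul_assoc]

theorem twistedPow_notMem (hc : HasPrimeCommutator p c) [Finite G]
    (hG : CentralAutomorphisms G) {x : G} (hx : x ∉ center G) :
    twistedPow p c x ∉ centerPow G p := by
  intro h
  obtain ⟨z, hz, hzx⟩ := mem_centerPow.1 h
  have hx' : x * z⁻¹ ∉ center G := fun h => hx (by simpa using mul_mem h hz)
  obtain ⟨y, hy⟩ : ∃ y, ⁅y, x * z⁻¹⁆ ≠ 1 := by
    by_contra! hcon
    exact hx' (mem_center_of_forall_commutatorElement hcon)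
  have h1 : twistedPow p c (x * z⁻¹) = 1 := by
    rw [twistedPow_mul_center _ (inv_mem hz), ← hzx, inv_pow, mul_inv_cancel]
  refine hG.mul_pow_ne hy (hc.commutatorElement_pow _ _) (fun g => ?_) ?_
  · exact zpowers_le.2 (mem_zpowers_of_mem_zpowers_of_ne_one hc.pow_eq_one
      (hc.commutator_mem y _) hy) (hc.commutator_mem _ _)
  · have h2 := hc.twistedPow_mul hy
    rw [h1, mul_one] at h2
    exact mul_right_cancel h2

theorem twistedPow_notMem_sup (hc : HasPrimeCommutator p c) {F : Subgroup G} (hF : F ≤ center G)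
    (hpF : centerPow G p ≤ F)
    (h : ∀ x ∉ center G, twistedPow p c x ∉ F) {x y : G} (hyx : ⁅y, x⁆ ≠ 1) :
    twistedPow p c y ∉ F ⊔ zpowers (twistedPow p c x) := by
  intro hy
  have := normal_of_le_center hF
  have hyc : y ∉ center G := fun hy => hyx (commutatorElement_eq_one_of_mem_center_left hy x)
  obtain ⟨f, hf, w, ⟨k, rfl⟩, hk⟩ := mem_sup_of_normal_left.1 hy
  simp only at hk
  by_cases hpk : (p : ℤ) ∣ k
  · obtain ⟨j, rfl⟩ := hpk
    refine h y hyc (hk ▸ mul_mem hf (hpF ?_))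
    rw [zpow_mul, zpow_comm]
    exact mem_centerPow.2 ⟨_, zpow_mem (hc.twistedPow_mem_center x) j, (zpow_natCast _ _).symm⟩
  · have h1 : ⁅y * x ^ (-k), x⁆ ≠ 1 := by
      rw [hc.centralCommutators.mul_left, hc.centralCommutators.zpow_left]; simpa using hyx
    have h2 : ⁅y, x ^ (-k)⁆ ≠ 1 := by
      rw [hc.centralCommutators.zpow_right, Ne, hc.zpow_eq_one_iff (hc.commutator_mem y x) hyx]
      simpa using hpk
    refine h _ (fun hm => h1 (commutatorElement_eq_one_of_mem_center_left hm x)) ?_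
    rw [hc.twistedPow_mul h2, hc.twistedPow_zpow x (by simpa using hpk), ← hk, mul_assoc,
      ← zpow_add, add_neg_cancel, zpow_zero, mul_one]
    exact hf

theorem false_of_notMem_sup (hc : HasPrimeCommutator p c) [Finite G]
    (hG : CentralAutomorphisms G) {x y : G} (hyx : ⁅y, x⁆ ≠ 1)
    (hx : ∀ g, ⁅g, x⁆ = 1 → ∃ i : ℤ, ∃ z ∈ center G, g = x ^ i * z)
    (hxp : twistedPow p c x ^ p = 1)
    (hy : twistedPow p c y ∉ (centerPow G p ⊔ zpowers c) ⊔ zpowers (twistedPow p c x)) :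
    False := by
  have hG' := hc.centralCommutators
  set E := centerPow G p ⊔ zpowers c with hE
  have hEc : E ≤ center G := sup_le centerPow_le_center (zpowers_le.2 hc.mem_center)
  have := normal_of_le_center hEc
  have hcE : c ∈ E := mem_sup_right (mem_zpowers c)
  have hyM : y ^ p ∈ centralizer {x} := center_le_centralizer _ (hc.pow_mem_center y)
  have hxy' : ⁅x, y⁆ ≠ 1 := by rwa [← commutatorElement_inv, Ne, inv_eq_one]
  set S : Subgroup (centralizer {x}) := (E ⊔ zpowers x).subgroupOf (centralizer {x}) with hS
  have hNS : zpowers (twistedPow p c x) ≤ E ⊔ zpowers x := by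
    rw [zpowers_le]
    exact mul_mem (mem_sup_right (pow_mem (mem_zpowers x) p)) (mem_sup_left (pow_mem hcE _))
  have hcommS : ∀ a b : centralizer {x}, ⁅a, b⁆ ∈ S := by
    intro a b
    rw [hS, mem_subgroupOf]
    exact mem_sup_left (mem_sup_right (hc.commutator_mem (a : G) b))
  have hpowS : ∀ a : centralizer {x}, a ^ p ∈ S := by
    rintro ⟨a, ha⟩
    rw [hS, mem_subgroupOf]
    obtain ⟨i, z, hz, rfl⟩ := hx a (mem_centralizer_singleton_iff_commutatorElement.1 ha)
    have h : Commute (x ^ i) z := mem_center_iff.1 hz _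
    simp only [SubmonoidClass.mk_pow, h.mul_pow]
    exact mul_mem (mem_sup_right (pow_mem (zpow_mem (mem_zpowers x) i) p))
      (mem_sup_left (mem_sup_left (mem_centerPow.2 ⟨z, hz, rfl⟩)))
  have hyS : (⟨y ^ p, hyM⟩ : centralizer {x}) ∉ S := by
    rw [hS, mem_subgroupOf]
    intro h
    obtain ⟨e, he, w, ⟨i, rfl⟩, hi⟩ := mem_sup_of_normal_left.1 h
    simp only at hi
    have hxi : x ^ i ∈ center G := by
      rw [eq_inv_mul_of_mul_eq hi]
      exact mul_mem (inv_mem (hEc he)) (hc.pow_mem_center y)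
    have hpi : (p : ℤ) ∣ i := by
      rw [← hc.zpow_eq_one_iff (hc.commutator_mem y x) hyx, ← hG'.zpow_right]
      exact commutatorElement_eq_one_of_mem_center_right hxi y
    obtain ⟨k, rfl⟩ := hpi
    refine hy (mul_mem ?_ (mem_sup_left (pow_mem hcE _)))
    rw [← hi, zpow_mul, zpow_natCast]
    refine mul_mem (mem_sup_left he) (zpow_mem ?_ k)
    have : x ^ p = twistedPow p c x * (c ^ p.choose 2)⁻¹ := by simp [twistedPow]
    rw [this]
    exact mul_mem (mem_sup_right (mem_zpowers _)) (mem_sup_left (inv_mem (pow_mem hcE _)))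
  obtain ⟨θ, hθS, hθy, hθ⟩ := exists_hom_of_notMem hcommS hpowS hyS hxp
  refine hG.false_of_hom hyx (hc.commutatorElement_pow _ _) (fun g => ?_) hyM θ (fun m => ?_)
    (fun m hm => ?_) (fun g h hm => ?_) ?_
  · exact zpowers_le.2 (mem_zpowers_of_mem_zpowers_of_ne_one hc.pow_eq_one
      (hc.commutator_mem y _) hyx) (hc.commutator_mem _ _)
  · exact zpowers_le.2 (hc.twistedPow_mem_center x) (hθ m)
  · exact hθS _ (mem_subgroupOf.2 (hNS (hθ m)))
  · exact hθS _ (mem_subgroupOf.2 (mem_sup_left (mem_sup_right (hc.commutator_mem g h))))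
  · rw [hθy, hG'.mul_pow, pow_choose_two_eq hc.pow_eq_one (hc.commutator_mem x y) hxy', twistedPow,
      mul_assoc]

end HasPrimeCommutator

theorem exists_commutatorElement_ne_one {x : G} (hx : x ∉ center G) : ∃ y : G, ⁅y, x⁆ ≠ 1 := by
  by_contra! h
  exact hx (mem_center_of_forall_commutatorElement h)

theorem notMem_center_of_commutatorElement_ne_one {x y : G} (h : ⁅y, x⁆ ≠ 1) : x ∉ center G :=
  fun hx => h (commutatorElement_eq_one_of_mem_center_right hx y)

theorem commutatorElement_ne_one_symm {x y : G} (h : ⁅y, x⁆ ≠ 1) : ⁅x, y⁆ ≠ 1 := by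
  rwa [← commutatorElement_inv, Ne, inv_eq_one]

theorem IsPGroup.mul_card_le_of_lt [Finite G] [Fact p.Prime] (hG : IsPGroup p G)
    {K L : Subgroup G} (h : K < L) : p * Nat.card K ≤ Nat.card L := by
  have hp : p.Prime := Fact.out
  have hmul : Nat.card K * K.relIndex L = Nat.card L := by
    rw [← relIndex_bot_left, ← relIndex_bot_left, relIndex_mul_relIndex _ _ _ bot_le h.le]
  obtain ⟨n, hn⟩ := IsPGroup.iff_card.1 (hG.to_subgroup L)
  obtain ⟨m, -, hm⟩ := (Nat.dvd_prime_pow hp).1 (hn ▸ Dvd.intro_left _ hmul)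
  have hm0 : m ≠ 0 := by
    rintro rfl
    rw [pow_zero, relIndex_eq_one] at hm
    exact h.not_ge hm
  have : p ≤ K.relIndex L := by
    rw [hm]; exact Nat.le_self_pow hm0 p
  rw [← hmul, mul_comm]
  exact Nat.mul_le_mul_left _ this

theorem HasPrimeCommutator.card_zpowers [Fact p.Prime] (hc : HasPrimeCommutator p c) :
    Nat.card (zpowers c) = p := by
  rw [Nat.card_zpowers, orderOf_eq_prime hc.pow_eq_one hc.ne_one]

theorem HasPrimeCommutator.twistedPow_notMem_centerPow_sup [Finite G] [Fact p.Prime]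
    (hc : HasPrimeCommutator p c) (hG : CentralAutomorphisms G)
    (hC : ∀ x ∉ center G, ∀ g, ⁅g, x⁆ = 1 → ∃ i : ℤ, ∃ z ∈ center G, g = x ^ i * z)
    {x : G} (hx : x ∉ center G) : twistedPow p c x ∉ centerPow G p ⊔ zpowers c := by
  intro h
  have := normal_of_le_center (centerPow_le_center (G := G) (p := p))
  obtain ⟨_, ⟨z, hz, rfl⟩, w, hw, hzw⟩ := mem_sup_of_normal_left.1 h
  have hx' : x * z⁻¹ ∉ center G := fun h => hx (by simpa using mul_mem h hz)
  have hN : twistedPow p c (x * z⁻¹) = w := by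
    rw [twistedPow_mul_center _ (inv_mem hz), ← hzw, mem_center_iff.1 (pow_mem (inv_mem hz) p),
      inv_pow, inv_mul_cancel_left]
  have hw1 : w ≠ 1 := by
    rintro rfl
    exact hc.twistedPow_notMem hG hx' (hN ▸ one_mem _)
  obtain ⟨y, hy⟩ := exists_commutatorElement_ne_one hx'
  refine hc.false_of_notMem_sup hG hy (hC _ hx') ?_ fun hmem => ?_
  · obtain ⟨i, rfl⟩ := hw
    rw [hN, ← zpow_natCast, zpow_comm, zpow_natCast, hc.pow_eq_one, one_zpow]
  · refine hc.twistedPow_notMem_sup centerPow_le_center le_rfl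
      (fun x hx => hc.twistedPow_notMem hG hx) hy ?_
    have hle : centerPow G p ⊔ zpowers c ⊔ zpowers (twistedPow p c (x * z⁻¹)) ≤
        centerPow G p ⊔ zpowers (twistedPow p c (x * z⁻¹)) :=
      sup_le (sup_le le_sup_left (le_trans ?_ le_sup_right)) le_sup_right
    · exact hle hmem
    rw [hN, zpowers_le]
    exact mem_zpowers_of_mem_zpowers_of_ne_one hc.pow_eq_one hw hw1

/-- A `p`-group of class two whose commutator subgroup has order `p`, whose centralizers are as
small as possible and whose centre has order at most `p ^ 3` has a non-central automorphism. -/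
theorem HasPrimeCommutator.false_of_card_center_le [Finite G] [Fact p.Prime]
    (hc : HasPrimeCommutator p c) (hG : CentralAutomorphisms G) (hpG : IsPGroup p G)
    (hC : ∀ x ∉ center G, ∀ g, ⁅g, x⁆ = 1 → ∃ i : ℤ, ∃ z ∈ center G, g = x ^ i * z)
    {x y : G} (hyx : ⁅y, x⁆ ≠ 1) (hZ : Nat.card (center G) ≤ p ^ 3) : False := by
  have hG' := hc.centralCommutators
  have hp : 0 < p := (Fact.out : p.Prime).pos
  have hEc : centerPow G p ⊔ zpowers c ≤ center G :=
    sup_le centerPow_le_center (zpowers_le.2 hc.mem_center)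
  have hE : ∀ x ∉ center G, twistedPow p c x ∉ centerPow G p ⊔ zpowers c := fun x hx =>
    hc.twistedPow_notMem_centerPow_sup hG hC hx
  have hK : ∀ {x y : G}, ⁅y, x⁆ ≠ 1 →
      twistedPow p c y ∉ (centerPow G p ⊔ zpowers c) ⊔ zpowers (twistedPow p c x) :=
    fun h => hc.twistedPow_notMem_sup hEc le_sup_left hE h
  have hpow : ∀ {x y : G}, ⁅y, x⁆ ≠ 1 → twistedPow p c x ^ p ≠ 1 := fun h hxp =>
    hc.false_of_notMem_sup hG h (hC _ (notMem_center_of_commutatorElement_ne_one h)) hxp (hK h)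
  have hcard : Nat.card (centerPow G p ⊔ zpowers c : Subgroup G) ≤ Nat.card (zpowers c) := by
    have h1 := hpG.mul_card_le_of_lt (K := centerPow G p ⊔ zpowers c)
      (L := (centerPow G p ⊔ zpowers c) ⊔ zpowers (twistedPow p c x))
      (lt_of_le_not_ge le_sup_left fun h => hE x (notMem_center_of_commutatorElement_ne_one hyx)
        (h (mem_sup_right (mem_zpowers _))))
    have h2 := hpG.mul_card_le_of_lt
      (K := (centerPow G p ⊔ zpowers c) ⊔ zpowers (twistedPow p c x)) (L := center G)
      (lt_of_le_not_ge (sup_le hEc (zpowers_le.2 (hc.twistedPow_mem_center x)))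
        fun h => hK hyx (h (hc.twistedPow_mem_center y)))
    rw [hc.card_zpowers]
    have h3 := (Nat.mul_le_mul_left p h1).trans (h2.trans hZ)
    rw [pow_succ, pow_two, mul_assoc] at h3
    exact Nat.le_of_mul_le_mul_left (Nat.le_of_mul_le_mul_left h3 hp) hp
  have hle : centerPow G p ≤ zpowers c := by
    rw [Subgroup.eq_of_le_of_card_ge le_sup_right hcard]; exact le_sup_left
  have hmem : ∀ g, twistedPow p c g ^ p ∈ zpowers c := fun g =>
    hle ⟨_, hc.twistedPow_mem_center g, rfl⟩
  obtain ⟨k, hk⟩ : twistedPow p c y ^ p ∈ zpowers (twistedPow p c x ^ p) :=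
    zpowers_le.2 (mem_zpowers_of_mem_zpowers_of_ne_one hc.pow_eq_one (hmem x) (hpow hyx)) (hmem y)
  simp only at hk
  have hxy := commutatorElement_ne_one_symm hyx
  by_cases hpk : (p : ℤ) ∣ k
  · exact hpow hxy (hk ▸ (hc.zpow_eq_one_iff (hmem x) (hpow hyx)).2 hpk)
  · have h1 : ⁅y * x ^ (-k), x⁆ ≠ 1 := by
      rw [hG'.mul_left, hG'.zpow_left]; simpa using hyx
    have h2 : ⁅y, x ^ (-k)⁆ ≠ 1 := by
      rw [hG'.zpow_right, Ne, hc.zpow_eq_one_iff (hc.commutator_mem y x) hyx]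
      simpa using hpk
    refine hpow (commutatorElement_ne_one_symm h1) ?_
    have h3 : Commute (twistedPow p c y) (twistedPow p c x ^ (-k)) :=
      mem_center_iff.1 (zpow_mem (hc.twistedPow_mem_center x) _) _
    rw [hc.twistedPow_mul h2, hc.twistedPow_zpow x (by simpa using hpk), h3.mul_pow, ← hk,
      ← zpow_natCast (_ ^ (-k)), zpow_comm, zpow_natCast, ← zpow_add, add_neg_cancel, zpow_zero]

end PrimeCommutator

section SmallOrder

variable {G : Type*} [Group G] {p : ℕ}

theorem center_le_centralizer_inf_centralizer (x y : G) :
    center G ≤ centralizer {x} ⊓ centralizer {y} :=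
  le_inf (center_le_centralizer _) (center_le_centralizer _)

variable [Finite G]

theorem CentralCommutators.card_zpowers_sq_mul_card_le (hG : CentralCommutators G) (x y : G) :
    Nat.card (zpowers ⁅y, x⁆) ^ 2 * Nat.card (centralizer {x} ⊓ centralizer {y} : Subgroup G) ≤
      Nat.card G := by
  let f : G →* G × G := (hG.commHom x).prod (hG.commHom y)
  have hker : f.ker = centralizer {x} ⊓ centralizer {y} := by
    ext g
    rw [mem_inf, mem_centralizer_singleton_iff_commutatorElement,
      mem_centralizer_singleton_iff_commutatorElement]
    simp [f, MonoidHom.mem_ker]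
  have hrange : (zpowers ⁅y, x⁆).prod (zpowers ⁅y, x⁆) ≤ f.range := by
    rintro ⟨_, _⟩ ⟨⟨i, rfl⟩, ⟨j, rfl⟩⟩
    refine ⟨y ^ i * x ^ (-j), ?_⟩
    change (⁅y ^ i * x ^ (-j), x⁆, ⁅y ^ i * x ^ (-j), y⁆) = (⁅y, x⁆ ^ i, ⁅y, x⁆ ^ j)
    simp only [hG.mul_left, hG.zpow_left, commutatorElement_self, one_zpow, mul_one, one_mul]
    rw [zpow_neg, ← inv_zpow, commutatorElement_inv]
  have h := card_le_of_le hrange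
  rw [Nat.card_congr ((zpowers ⁅y, x⁆).prodEquiv (zpowers ⁅y, x⁆)).toEquiv, Nat.card_prod,
    ← pow_two] at h
  rw [← card_mul_index f.ker, index_ker, hker, mul_comm]
  exact Nat.mul_le_mul_left _ h

variable [Fact p.Prime]

theorem CentralCommutators.commutatorElement_pow_eq_one (hG : CentralCommutators G)
    (hpG : IsPGroup p G) (hcard : Nat.card G < p ^ 6) (x y : G) : ⁅y, x⁆ ^ p = 1 := by
  have hp : p.Prime := Fact.out
  by_contra hne
  obtain ⟨m, hm⟩ := IsPGroup.iff_orderOf.1 hpG ⁅y, x⁆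
  have hm2 : 2 ≤ m := by
    by_contra! h
    have : orderOf ⁅y, x⁆ ∣ p := by
      rw [hm]; simpa using pow_dvd_pow p (Nat.le_of_lt_succ h)
    exact hne (orderOf_dvd_iff_pow_eq_one.1 this)
  have h1 : p ^ 2 ≤ Nat.card (zpowers ⁅y, x⁆) := by
    rw [Nat.card_zpowers, hm]; exact Nat.pow_le_pow_right hp.pos hm2
  have h2 : p ^ 2 ≤ Nat.card (centralizer {x} ⊓ centralizer {y} : Subgroup G) :=
    h1.trans (card_le_of_le ((zpowers_le.2 (hG y x)).trans
      (center_le_centralizer_inf_centralizer x y)))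
  refine hcard.not_ge (le_trans ?_ (hG.card_zpowers_sq_mul_card_le x y))
  calc p ^ 6 = (p ^ 2) ^ 2 * p ^ 2 := by ring
    _ ≤ _ := Nat.mul_le_mul (Nat.pow_le_pow_left h1 2) h2

theorem CentralAutomorphisms.false_of_card_center_eq (hG : CentralAutomorphisms G)
    (hZ : Nat.card (center G) = p) {a b : G} (hba : ⁅b, a⁆ ≠ 1) : False := by
  have hG' := hG.centralCommutators
  have hpow : ∀ z ∈ center G, z ^ p = 1 := fun z hz => by
    rw [← hZ]; exact congrArg Subtype.val (pow_card_eq_one' (x := (⟨z, hz⟩ : center G)))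
  have hcp := hpow _ (hG' b a)
  have hc : zpowers ⁅b, a⁆ = center G := eq_of_le_of_card_ge (zpowers_le.2 (hG' b a)) (by
    rw [hZ, Nat.card_zpowers, orderOf_eq_prime hcp hba])
  have hcc : HasPrimeCommutator p ⁅b, a⁆ :=
    ⟨fun x y => hc ▸ hG' x y, hba, hcp, hG' b a⟩
  have hbot : centerPow G p ≤ ⊥ := by
    rintro _ ⟨z, hz, rfl⟩
    exact hpow z hz
  have h1 : ∀ x ∉ center G, twistedPow p ⁅b, a⁆ x ∉ (⊥ : Subgroup G) := fun x hx h =>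
    hcc.twistedPow_notMem hG hx (bot_le (a := centerPow G p) h)
  refine hcc.twistedPow_notMem_sup bot_le hbot h1 hba (mem_sup_right ?_)
  have h2 := mem_zpowers_of_mem_zpowers_of_ne_one hcp (hc ▸ hcc.twistedPow_mem_center a)
    (h1 a (notMem_center_of_commutatorElement_ne_one hba))
  exact zpowers_le.2 h2 (hc ▸ hcc.twistedPow_mem_center b)

theorem CentralAutomorphisms.false_of_commutatorElement_mem_zpowers (hG : CentralAutomorphisms G)
    (hpG : IsPGroup p G) (hcard : Nat.card G < p ^ 6) (hZ : p ^ 2 ≤ Nat.card (center G))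
    (hrange : ∀ a b : G, ⁅b, a⁆ ≠ 1 → ∀ g : G, ⁅g, a⁆ ∈ zpowers ⁅b, a⁆)
    {a b : G} (hba : ⁅b, a⁆ ≠ 1) : False := by
  have hp : p.Prime := Fact.out
  have hG' := hG.centralCommutators
  have hpow := hG'.commutatorElement_pow_eq_one hpG hcard
  have hD : ∀ {a b : G}, ⁅b, a⁆ ≠ 1 → ∀ g, ∃ i j : ℤ,
      ∃ d ∈ centralizer {a} ⊓ centralizer {b}, g = b ^ j * a ^ i * d := by
    intro a b hba g
    obtain ⟨j, hj⟩ := hrange a b hba g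
    obtain ⟨i, hi⟩ := hrange b a (commutatorElement_ne_one_symm hba) g
    refine ⟨i, j, (b ^ j * a ^ i)⁻¹ * g, mem_inf.2 ⟨?_, ?_⟩, by group⟩
    · rw [mem_centralizer_singleton_iff_commutatorElement, hG'.mul_left,
        hG'.inv_left, hG'.mul_left, hG'.zpow_left, hG'.zpow_left]
      simp [← hj]
    · rw [mem_centralizer_singleton_iff_commutatorElement, hG'.mul_left,
        hG'.inv_left, hG'.mul_left, hG'.zpow_left, hG'.zpow_left]
      simp [← hi]
  have hDcard : ∀ {a b : G}, ⁅b, a⁆ ≠ 1 →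
      Nat.card (centralizer {a} ⊓ centralizer {b} : Subgroup G) < p ^ 4 := by
    intro a b hba
    have h := (hG'.card_zpowers_sq_mul_card_le a b).trans_lt hcard
    rw [Nat.card_zpowers, orderOf_eq_prime (hpow a b) hba, show 6 = 2 + 4 from rfl, pow_add] at h
    exact Nat.lt_of_mul_lt_mul_left h
  have hDZ : ∀ {a b : G}, ⁅b, a⁆ ≠ 1 → centralizer {a} ⊓ centralizer {b} ≤ center G := by
    intro a b hba e he
    by_contra hez
    have hlt := hpG.mul_card_le_of_lt (K := center G) (L := center G ⊔ zpowers e)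
      (lt_of_le_not_ge le_sup_left fun h => hez (h (mem_sup_right (mem_zpowers e))))
    have heq : centralizer {a} ⊓ centralizer {b} ≤ center G ⊔ zpowers e := by
      by_contra hnle
      have h2 := hpG.mul_card_le_of_lt (lt_of_le_not_ge
        (sup_le (center_le_centralizer_inf_centralizer a b) (zpowers_le.2 he)) hnle)
      refine (hDcard hba).not_ge (le_trans ?_ ((Nat.mul_le_mul_left p hlt).trans h2))
      calc p ^ 4 = p * (p * p ^ 2) := by ring
        _ ≤ _ := by gcongr
    refine hez (mem_center_of_forall_commutatorElement fun g => ?_)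
    obtain ⟨i, j, d, hd, rfl⟩ := hD hba g
    obtain ⟨z, hz, _, ⟨k, rfl⟩, rfl⟩ := mem_sup_of_normal_left.1 (heq hd)
    have h1 : ⁅a, e⁆ = 1 := by
      rw [← commutatorElement_inv, mem_centralizer_singleton_iff_commutatorElement.1 he.1, inv_one]
    have h2 : ⁅b, e⁆ = 1 := by
      rw [← commutatorElement_inv, mem_centralizer_singleton_iff_commutatorElement.1 he.2, inv_one]
    simp [hG'.mul_left, hG'.zpow_left, h1, h2, commutatorElement_eq_one_of_mem_center_left hz]
  have hc : HasPrimeCommutator p ⁅b, a⁆ := by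
    refine ⟨fun x y => ?_, hba, hpow a b, hG' b a⟩
    obtain ⟨i, j, d, hd, rfl⟩ := hD hba x
    have h1 : ⁅a, y⁆ ∈ zpowers ⁅b, a⁆ := by
      rw [← commutatorElement_inv y]
      exact inv_mem (hrange a b hba y)
    have h2 : ⁅b, y⁆ ∈ zpowers ⁅b, a⁆ := by
      rw [← commutatorElement_inv y, ← zpowers_inv, commutatorElement_inv b]
      exact inv_mem (hrange b a (commutatorElement_ne_one_symm hba) y)
    rw [hG'.mul_left, hG'.mul_left, hG'.zpow_left, hG'.zpow_left,
      commutatorElement_eq_one_of_mem_center_left (hDZ hba hd), mul_one]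
    exact mul_mem (zpow_mem h2 j) (zpow_mem h1 i)
  refine hc.false_of_card_center_le hG hpG (fun x hx g hg => ?_) hba ?_
  · obtain ⟨y, hy⟩ := exists_commutatorElement_ne_one hx
    obtain ⟨i, j, d, hd, rfl⟩ := hD hy g
    rw [hG'.mul_left, hG'.mul_left, hG'.zpow_left, hG'.zpow_left,
      commutatorElement_eq_one_of_mem_center_left (hDZ hy hd), commutatorElement_self, one_zpow,
      mul_one, mul_one, hc.zpow_eq_one_iff (hc.commutator_mem y x) hy] at hg
    obtain ⟨k, rfl⟩ := hg
    have hyk : y ^ ((p : ℤ) * k) ∈ center G := by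
      rw [zpow_mul, zpow_natCast]; exact zpow_mem (hc.pow_mem_center y) k
    refine ⟨i, y ^ ((p : ℤ) * k) * d, mul_mem hyk (hDZ hy hd), ?_⟩
    rw [← mul_assoc, mem_center_iff.1 hyk]
  · have h := (card_le_of_le (center_le_centralizer_inf_centralizer a b)).trans_lt (hDcard hba)
    obtain ⟨m, hm⟩ := IsPGroup.iff_card.1 (hpG.to_subgroup (center G))
    rw [hm] at h ⊢
    exact Nat.pow_le_pow_right hp.pos (Nat.le_of_lt_succ ((Nat.pow_lt_pow_iff_right hp.one_lt).1 h))

end SmallOrder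

section AbelianExtension

theorem exists_hom_of_generators {A H : Type*} [CommGroup A] [CommGroup H] {Z : Subgroup A}
    {b c : A} {b' c' : H} {p : ℕ} (hgen : ∀ m, ∃ i j : ℤ, ∃ z : Z, b ^ i * c ^ j * z = m)
    (hrel : ∀ i j : ℤ, b ^ i * c ^ j ∈ Z → (p : ℤ) ∣ i ∧ (p : ℤ) ∣ j) (hb : b ^ p ∈ Z)
    (hc : c ^ p ∈ Z) (β : Z →* H) (hβb : β ⟨b ^ p, hb⟩ = b' ^ p) (hβc : β ⟨c ^ p, hc⟩ = c' ^ p) :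
    ∃ α : A →* H, α b = b' ∧ α c = c' ∧ ∀ z : Z, α z = β z := by
  let F := Multiplicative ℤ × Multiplicative ℤ × Z
  let f : F →* A := (zpowersHom A b).coprod ((zpowersHom A c).coprod Z.subtype)
  let g : F →* H := (zpowersHom H b').coprod ((zpowersHom H c').coprod β)
  have hf' : ∀ i j z, f (Multiplicative.ofAdd i, Multiplicative.ofAdd j, z) =
    b ^ i * (c ^ j * z) := fun _ _ _ => rfl
  have hg' : ∀ i j z, g (Multiplicative.ofAdd i, Multiplicative.ofAdd j, z) =
    b' ^ i * (c' ^ j * β z) := fun _ _ _ => rfl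
  have hf : Function.Surjective f := by
    intro m
    obtain ⟨i, j, z, rfl⟩ := hgen m
    exact ⟨(Multiplicative.ofAdd i, Multiplicative.ofAdd j, z), by rw [hf', mul_assoc]⟩
  have hfg : f.ker ≤ g.ker := by
    rintro ⟨i, j, z⟩ h
    obtain ⟨i, rfl⟩ := Multiplicative.ofAdd.surjective i
    obtain ⟨j, rfl⟩ := Multiplicative.ofAdd.surjective j
    rw [MonoidHom.mem_ker, hf', ← mul_assoc] at h
    obtain ⟨⟨i, rfl⟩, ⟨j, rfl⟩⟩ := hrel i j (eq_inv_of_mul_eq_one_left h ▸ inv_mem z.2)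
    have hz : (⟨b ^ p, hb⟩ : Z) ^ i * (⟨c ^ p, hc⟩ : Z) ^ j * z = 1 := by
      ext
      simpa [zpow_mul] using h
    have := congrArg β hz
    rw [map_mul, map_mul, map_zpow, map_zpow, hβb, hβc, map_one] at this
    rwa [MonoidHom.mem_ker, hg', zpow_mul, zpow_mul, zpow_natCast, zpow_natCast, ← mul_assoc]
  let α := f.liftOfSurjective hf ⟨g, hfg⟩
  have hα : ∀ (i j : ℤ) (z : Z), α (b ^ i * (c ^ j * z)) = b' ^ i * (c' ^ j * β z) := fun i j z =>
    f.liftOfRightInverse_comp_apply _ _ ⟨g, hfg⟩ (Multiplicative.ofAdd i, Multiplicative.ofAdd j, z)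
  refine ⟨α, ?_, ?_, fun z => ?_⟩
  · simpa using hα 1 0 1
  · simpa using hα 0 1 1
  · simpa using hα 0 0 z

variable {G : Type*} [Group G] {p : ℕ} {M : Subgroup G} {a b c : G}

/-- `M` is an abelian subgroup generated by `b`, `c` and the centre of `G`, the group `G` is
generated by `M` and `a`, and commutation with `a` maps `M` onto the centre, which is elementary
abelian of order `p ^ 2`. -/
structure IsAbelianExtension (p : ℕ) (M : Subgroup G) (a b c : G) : Prop where
  centralCommutators : CentralCommutators G
  left_mem : b ∈ M
  right_mem : c ∈ M
  commute : ∀ m ∈ M, ∀ n ∈ M, ⁅m, n⁆ = 1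
  center_le : center G ≤ M
  exists_mul_zpow_mem : ∀ x, ∃ k : ℤ, x * a ^ k ∈ M
  exists_eq_mul : ∀ m ∈ M, ∃ i j : ℤ, ∃ z ∈ center G, m = b ^ i * c ^ j * z
  exists_commutatorElement_eq : ∀ z ∈ center G, ∃ m ∈ M, ⁅m, a⁆ = z
  pow_eq_one : ∀ z ∈ center G, z ^ p = 1
  left_ne_one : ⁅b, a⁆ ≠ 1
  right_notMem : ⁅c, a⁆ ∉ zpowers ⁅b, a⁆

namespace IsAbelianExtension

theorem normal (h : IsAbelianExtension p M a b c) : M.Normal :=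
  ⟨fun m hm g => by
    rw [mul_mul_inv_eq]
    exact mul_mem (h.center_le (h.centralCommutators g m)) hm⟩

theorem mem_center (h : IsAbelianExtension p M a b c) {m : G} (hm : m ∈ M) (hma : ⁅m, a⁆ = 1) :
    m ∈ center G := by
  refine mem_center_of_forall_commutatorElement fun x => ?_
  obtain ⟨k, hk⟩ := h.exists_mul_zpow_mem x
  have h1 := h.commute _ hk _ hm
  rwa [h.centralCommutators.mul_left, h.centralCommutators.zpow_left, ← commutatorElement_inv m a,
    hma, inv_one, one_zpow, mul_one] at h1

theorem commutatorElement_pow (h : IsAbelianExtension p M a b c) (x y : G) : ⁅x, y⁆ ^ p = 1 :=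
  h.pow_eq_one _ (h.centralCommutators x y)

theorem pow_mem_center (h : IsAbelianExtension p M a b c) (x : G) : x ^ p ∈ center G :=
  mem_center_of_forall_commutatorElement fun y => by
    rw [h.centralCommutators.pow_right, h.commutatorElement_pow]

/-- Replacing `a` by another element of the coset `a M`. -/
theorem mul_right (h : IsAbelianExtension p M a b c) {m : G} (hm : m ∈ M) :
    IsAbelianExtension p M (a * m) b c := by
  have := h.normal
  have hcomm : ∀ n ∈ M, ⁅n, a * m⁆ = ⁅n, a⁆ := fun n hn => by
    rw [h.centralCommutators.mul_right, h.commute n hn m hm, mul_one]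
  refine { h with
    exists_mul_zpow_mem := fun x => ?_
    exists_commutatorElement_eq := fun z hz => ?_
    left_ne_one := ?_
    right_notMem := ?_ }
  · obtain ⟨k, hk⟩ := h.exists_mul_zpow_mem x
    refine ⟨k, ?_⟩
    rw [← QuotientGroup.eq_one_iff] at hk ⊢
    rw [← hk]
    simp [(QuotientGroup.eq_one_iff m).2 hm]
  · obtain ⟨n, hn, hnz⟩ := h.exists_commutatorElement_eq z hz
    exact ⟨n, hn, by rw [hcomm n hn, hnz]⟩
  · rw [hcomm b h.left_mem]; exact h.left_ne_one
  · rw [hcomm b h.left_mem, hcomm c h.right_mem]; exact h.right_notMem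

/-- The `p`-th power map from `M` to the centre. -/
def powHom (h : IsAbelianExtension p M a b c) : M →* center G where
  toFun m := ⟨(m : G) ^ p, h.pow_mem_center m⟩
  map_one' := by ext; simp
  map_mul' m n := by
    ext
    have hmn : Commute (m : G) n := commutatorElement_eq_one_iff_mul_comm.1 (h.commute m m.2 n n.2)
    exact hmn.mul_pow p

/-- Commutation with `a`, as a map from `M` to the centre. -/
def commHom (h : IsAbelianExtension p M a b c) : M →* center G where
  toFun m := ⟨⁅(m : G), a⁆, h.centralCommutators m a⟩
  map_one' := by ext; simp
  map_mul' m n := Subtype.ext (h.centralCommutators.mul_left m n a)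

theorem commHom_surjective (h : IsAbelianExtension p M a b c) :
    Function.Surjective h.commHom := by
  rintro ⟨z, hz⟩
  obtain ⟨m, hm, hmz⟩ := h.exists_commutatorElement_eq z hz
  exact ⟨⟨m, hm⟩, Subtype.ext hmz⟩

theorem mem_center_of_commHom_eq_one (h : IsAbelianExtension p M a b c) {m : M}
    (hm : h.commHom m = 1) : (m : G) ∈ center G :=
  h.mem_center m.2 (congrArg Subtype.val hm)

theorem commHom_eq_one_of_mem_center (h : IsAbelianExtension p M a b c) {m : M}
    (hm : (m : G) ∈ center G) : h.commHom m = 1 :=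
  Subtype.ext (commutatorElement_eq_one_of_mem_center_left hm a)

theorem powHom_eq_one_of_mem_center (h : IsAbelianExtension p M a b c) {m : M}
    (hm : (m : G) ∈ center G) : h.powHom m = 1 :=
  Subtype.ext (h.pow_eq_one _ hm)

theorem mem_center_of_mulAut (h : IsAbelianExtension p M a b c) (hG : CentralAutomorphisms G)
    {φ : MulAut G} {m n : G} (hm : m ∈ M) (hn : n ∈ M) (hφ : φ m = m * n) : n ∈ center G := by
  have h1 := hG φ m
  rwa [hφ, mul_mul_inv_eq, h.commute m hm n hn, one_mul] at h1

theorem right_ne_one (h : IsAbelianExtension p M a b c) : ⁅c, a⁆ ≠ 1 := fun hc =>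
  h.right_notMem (hc ▸ one_mem _)

open scoped IsMulCommutative in
/-- The map `m ↦ a⁻ᵖ (a m)ᵖ`. -/
def cosetPowHom (h : IsAbelianExtension p M a b c) : M →* center G :=
  h.powHom * h.commHom ^ p.choose 2

theorem mul_pow_eq (h : IsAbelianExtension p M a b c) (m : M) :
    (a * m) ^ p = a ^ p * h.cosetPowHom m := by
  rw [h.centralCommutators.mul_pow, mul_assoc]
  rfl

variable [Fact p.Prime]

theorem zpow_eq_one_iff (h : IsAbelianExtension p M a b c) {z : G} (hz : z ∈ center G)
    (hz1 : z ≠ 1) {i : ℤ} : z ^ i = 1 ↔ (p : ℤ) ∣ i := by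
  rw [← orderOf_eq_prime (h.pow_eq_one z hz) hz1, orderOf_dvd_iff_zpow_eq_one]

theorem dvd_of_zpow_mem (h : IsAbelianExtension p M a b c) {i : ℤ} (hi : a ^ i ∈ M) :
    (p : ℤ) ∣ i := by
  have := h.commute b h.left_mem _ hi
  rwa [h.centralCommutators.zpow_right,
    h.zpow_eq_one_iff (h.centralCommutators b a) h.left_ne_one] at this

theorem dvd_of_mul_mem_center (h : IsAbelianExtension p M a b c) {i j : ℤ}
    (hij : b ^ i * c ^ j ∈ center G) : (p : ℤ) ∣ i ∧ (p : ℤ) ∣ j := by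
  have hG := h.centralCommutators
  have h1 := commutatorElement_eq_one_of_mem_center_left hij a
  rw [hG.mul_left, hG.zpow_left, hG.zpow_left] at h1
  have hj : (p : ℤ) ∣ j := by
    by_contra hj
    have hv : ⁅c, a⁆ ^ j ∈ zpowers ⁅b, a⁆ := by
      rw [eq_inv_of_mul_eq_one_right h1]
      exact inv_mem (zpow_mem (mem_zpowers _) i)
    refine h.right_notMem (zpowers_le.2 hv ?_)
    refine mem_zpowers_of_mem_zpowers_of_ne_one (h.commutatorElement_pow c a) ⟨j, rfl⟩ ?_
    rwa [Ne, h.zpow_eq_one_iff (hG c a)]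
    rintro hc
    exact h.right_notMem (hc ▸ one_mem _)
  refine ⟨?_, hj⟩
  obtain ⟨j, rfl⟩ := hj
  rwa [zpow_mul, zpow_natCast, h.commutatorElement_pow, one_zpow, mul_one,
    h.zpow_eq_one_iff (hG b a) h.left_ne_one] at h1

theorem exists_mulAut [Finite G] (h : IsAbelianExtension p M a b c) (ha : a ^ p = 1) {b' c' : G}
    (hb' : b' ∈ M) (hc' : c' ∈ M) (β : center G →* center G) (hβ : Function.Injective β)
    (hβb : β ⟨b ^ p, h.pow_mem_center b⟩ = b' ^ p) (hβc : β ⟨c ^ p, h.pow_mem_center c⟩ = c' ^ p)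
    (hβb' : β ⟨⁅b, a⁆, h.centralCommutators b a⟩ = ⁅b', a⁆)
    (hβc' : β ⟨⁅c, a⁆, h.centralCommutators c a⟩ = ⁅c', a⁆) :
    ∃ φ : MulAut G, φ b = b' ∧ φ c = c' := by
  have hG := h.centralCommutators
  have := h.normal
  let commGroup : CommGroup M :=
    { (inferInstance : Group M) with
      mul_comm := fun m n => Subtype.ext
        (commutatorElement_eq_one_iff_mul_comm.1 (h.commute m m.2 n n.2)) }
  let β' : (center G).subgroupOf M →* M :=
    (inclusion h.center_le).comp (β.comp (subgroupOfEquivOfLe h.center_le).toMonoidHom)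
  have hβ' : ∀ (z : G) (hz : z ∈ center G), (β' ⟨⟨z, h.center_le hz⟩, hz⟩ : G) = β ⟨z, hz⟩ :=
    fun _ _ => rfl
  obtain ⟨α, hαb, hαc, hαβ⟩ : ∃ α : M →* M, α ⟨b, h.left_mem⟩ = ⟨b', hb'⟩ ∧
      α ⟨c, h.right_mem⟩ = ⟨c', hc'⟩ ∧ ∀ z : (center G).subgroupOf M, α z = β' z := by
    refine exists_hom_of_generators (p := p) (fun m => ?_) (fun i j hij => ?_)
      (mem_subgroupOf.2 (h.pow_mem_center b)) (mem_subgroupOf.2 (h.pow_mem_center c)) β'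
      (Subtype.ext hβb) (Subtype.ext hβc)
    · obtain ⟨i, j, z, hz, hm⟩ := h.exists_eq_mul m m.2
      exact ⟨i, j, ⟨⟨z, h.center_le hz⟩, hz⟩, Subtype.ext hm.symm⟩
    · exact h.dvd_of_mul_mem_center hij
  have hαz : ∀ (z : G) (hz : z ∈ center G), (α ⟨z, h.center_le hz⟩ : G) = β ⟨z, hz⟩ :=
    fun z hz => by rw [← hβ', ← hαβ]
  have hακ : ∀ m : M, (β ⟨⁅(m : G), a⁆, hG m a⟩ : G) = ⁅(α m : G), a⁆ := by
    intro m
    obtain ⟨i, j, z, hz, hm⟩ := h.exists_eq_mul m m.2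
    have h1 : m = (⟨b, h.left_mem⟩ : M) ^ i * (⟨c, h.right_mem⟩ : M) ^ j * ⟨z, h.center_le hz⟩ :=
      Subtype.ext hm
    have h2 : (⟨⁅(m : G), a⁆, hG m a⟩ : center G) =
        ⟨⁅b, a⁆, hG b a⟩ ^ i * ⟨⁅c, a⁆, hG c a⟩ ^ j := by
      ext
      simp [hm, hG.mul_left, hG.zpow_left, commutatorElement_eq_one_of_mem_center_left hz]
    have h3 : (α m : G) = b' ^ i * c' ^ j * β ⟨z, hz⟩ := by
      rw [h1, map_mul, map_mul, map_zpow, map_zpow, hαb, hαc, ← hαz]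
      rfl
    rw [h2, h3, map_mul, map_zpow, map_zpow, hG.mul_left, hG.mul_left, hG.zpow_left, hG.zpow_left,
      commutatorElement_eq_one_of_mem_center_left (β ⟨z, hz⟩).2, mul_one]
    simp [hβb', hβc']
  suffices hφ : ∃ φ : MulAut G, (∀ m : M, φ m = M.subtype.comp α m) ∧ φ a = a * 1 by
    obtain ⟨φ, hφ, -⟩ := hφ
    exact ⟨φ, (hφ ⟨b, h.left_mem⟩).trans (congrArg Subtype.val hαb),
      (hφ ⟨c, h.right_mem⟩).trans (congrArg Subtype.val hαc)⟩
  refine exists_mulAut_of_cyclic_extension (n := p) h.exists_mul_zpow_mem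
    (fun i => h.dvd_of_zpow_mem) (ha ▸ one_mem M) (one_mem M) (M.subtype.comp α)
    (fun m => (α m).2) ?_ ?_ ?_
  · refine Subtype.val_injective.comp ((injective_iff_map_eq_one α).2 fun m hm => ?_)
    have h1 := hακ m
    rw [hm, OneMemClass.coe_one, commutatorElement_one_left, OneMemClass.coe_eq_one,
      map_eq_one_iff β hβ] at h1
    have h2 := h.mem_center m.2 (congrArg Subtype.val h1)
    have h3 := hαz m h2
    rw [show (⟨(m : G), h.center_le h2⟩ : M) = m from rfl, hm, OneMemClass.coe_one, eq_comm,
      OneMemClass.coe_eq_one, map_eq_one_iff β hβ] at h3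
    exact Subtype.ext (show (m : G) = 1 from congrArg Subtype.val h3)
  · intro m hm hm'
    have h1 : (⟨a * m * a⁻¹, hm'⟩ : M) =
        (⟨⁅m, a⁆, h.center_le (hG m a)⟩ : M)⁻¹ * ⟨m, hm⟩ :=
      Subtype.ext ((mul_mul_inv_eq a m).trans (by rw [← commutatorElement_inv m a]; rfl))
    rw [mul_one, h1]
    change (α _ : G) = a * α ⟨m, hm⟩ * a⁻¹
    rw [mul_mul_inv_eq, map_mul, map_inv, ← commutatorElement_inv _ a, ← hακ ⟨m, hm⟩, ← hαz]
    rfl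
  · rw [mul_one, show (⟨a ^ p, ha ▸ one_mem M⟩ : M) = 1 from Subtype.ext ha, map_one, ha]
open scoped IsMulCommutative

theorem mem_center_of_cosetPowHom_eq_one [Finite G] (h : IsAbelianExtension p M a b c)
    (hG : CentralAutomorphisms G) {m : M} (hm : h.cosetPowHom m = 1) : (m : G) ∈ center G := by
  by_contra hmc
  have ham : ⁅a, (m : G)⁆ ≠ 1 := fun h1 =>
    hmc (h.mem_center m.2 (by rw [← commutatorElement_inv, h1, inv_one]))
  refine hG.mul_pow_ne ham (h.commutatorElement_pow _ _) (fun g => ?_)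
    (by rw [h.mul_pow_eq, hm, OneMemClass.coe_one, mul_one])
  obtain ⟨k, hk⟩ := h.exists_mul_zpow_mem g
  have h1 := h.commute _ hk m m.2
  rw [h.centralCommutators.mul_left, h.centralCommutators.zpow_left] at h1
  rw [eq_inv_of_mul_eq_one_left h1]
  exact inv_mem (zpow_mem (mem_zpowers _) k)

theorem cosetPowHom_surjective [Finite G] (h : IsAbelianExtension p M a b c)
    (hG : CentralAutomorphisms G) : Function.Surjective h.cosetPowHom := by
  have hker : h.cosetPowHom.ker ≤ h.commHom.ker := fun m hm =>
    h.commHom_eq_one_of_mem_center (h.mem_center_of_cosetPowHom_eq_one hG hm)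
  have hle := Nat.le_of_dvd (Nat.pos_of_ne_zero index_ne_zero_of_finite) (index_dvd_of_le hker)
  rw [index_ker, index_ker, MonoidHom.range_eq_top.2 h.commHom_surjective] at hle
  exact MonoidHom.range_eq_top.1 (eq_of_le_of_card_ge le_top hle)

theorem false_of_pow_eq_one_of_odd [Finite G] (h : IsAbelianExtension p M a b c)
    (hG : CentralAutomorphisms G) (hp : p ≠ 2) (ha : a ^ p = 1) : False := by
  obtain ⟨φ, hφ, -⟩ := h.exists_mulAut ha (inv_mem h.left_mem) (inv_mem h.right_mem)
    invMonoidHom inv_injective (by simp) (by simp) (by simp [h.centralCommutators.inv_left])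
    (by simp [h.centralCommutators.inv_left])
  have h1 : b ^ (-2 : ℤ) ∈ center G :=
    h.mem_center_of_mulAut hG h.left_mem (zpow_mem h.left_mem _) (by rw [hφ]; group)
  have h2 := commutatorElement_eq_one_of_mem_center_left h1 a
  rw [h.centralCommutators.zpow_left,
    h.zpow_eq_one_iff (h.centralCommutators b a) h.left_ne_one, dvd_neg] at h2
  exact hp ((Nat.prime_dvd_prime_iff_eq Fact.out Nat.prime_two).1 (by exact_mod_cast h2))

theorem sq_eq_one_of_sq_eq_one [Finite G] {M : Subgroup G} (h : IsAbelianExtension 2 M a b c)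
    (hG : CentralAutomorphisms G) (ha : a ^ 2 = 1) : b ^ 2 = 1 ∧ c ^ 2 = 1 := by
  have hN : ∀ m, h.cosetPowHom m = h.powHom m * h.commHom m := fun m => by simp [cosetPowHom]
  have hker : h.commHom.ker ≤ h.cosetPowHom.ker := fun m hm => by
    have hm' := h.mem_center_of_commHom_eq_one hm
    rw [MonoidHom.mem_ker, hN, h.powHom_eq_one_of_mem_center hm',
      h.commHom_eq_one_of_mem_center hm', mul_one]
  let β := h.commHom.liftOfSurjective h.commHom_surjective ⟨h.cosetPowHom, hker⟩
  have hβ : ∀ m, β (h.commHom m) = h.cosetPowHom m :=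
    h.commHom.liftOfRightInverse_comp_apply _ _ ⟨h.cosetPowHom, hker⟩
  have hβ_inj : Function.Injective β := by
    refine (injective_iff_map_eq_one β).2 fun z hz => ?_
    obtain ⟨m, rfl⟩ := h.commHom_surjective z
    rw [hβ] at hz
    exact h.commHom_eq_one_of_mem_center (h.mem_center_of_cosetPowHom_eq_one hG hz)
  have hβp : ∀ m t, h.commHom t = h.powHom m → β (h.powHom m) = h.powHom (m * t) := by
    intro m t hmt
    rw [← hmt, hβ, hN, hmt, map_mul, mul_comm]
  have hβκ : ∀ m t, h.commHom t = h.powHom m → β (h.commHom m) = h.commHom (m * t) := by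
    intro m t hmt
    rw [hβ, hN, ← hmt, map_mul, mul_comm]
  obtain ⟨t, ht⟩ := h.commHom_surjective (h.powHom ⟨b, h.left_mem⟩)
  obtain ⟨s, hs⟩ := h.commHom_surjective (h.powHom ⟨c, h.right_mem⟩)
  obtain ⟨φ, hφb, hφc⟩ := h.exists_mulAut ha (mul_mem h.left_mem t.2) (mul_mem h.right_mem s.2)
    β hβ_inj (congrArg Subtype.val (hβp _ _ ht)) (congrArg Subtype.val (hβp _ _ hs))
    (congrArg Subtype.val (hβκ _ _ ht)) (congrArg Subtype.val (hβκ _ _ hs))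
  rw [h.commHom_eq_one_of_mem_center (h.mem_center_of_mulAut hG h.left_mem t.2 hφb)] at ht
  rw [h.commHom_eq_one_of_mem_center (h.mem_center_of_mulAut hG h.right_mem s.2 hφc)] at hs
  exact ⟨(congrArg Subtype.val ht).symm, (congrArg Subtype.val hs).symm⟩

theorem false_of_sq_eq_one [Finite G] {M : Subgroup G} (h : IsAbelianExtension 2 M a b c)
    (hG : CentralAutomorphisms G) (ha : a ^ 2 = 1) : False := by
  have hG' := h.centralCommutators
  obtain ⟨hb2, hc2⟩ := h.sq_eq_one_of_sq_eq_one hG ha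
  let u : center G := ⟨⁅b, a⁆, hG' b a⟩
  let v : center G := ⟨⁅c, a⁆, hG' c a⟩
  have huv : u ∉ zpowers v := by
    rintro ⟨i, hi⟩
    exact h.right_notMem (mem_zpowers_of_mem_zpowers_of_ne_one (h.commutatorElement_pow c a)
      ⟨i, congrArg Subtype.val hi⟩ h.left_ne_one)
  have hv : v ^ 2 = 1 := Subtype.ext (h.commutatorElement_pow c a)
  obtain ⟨η, hη, hηu, hηv⟩ := exists_hom_of_notMem (p := 2) (S := zpowers v)
    (fun x y => by rw [commutatorElement_eq_one_iff_mul_comm.2 (mul_comm x y)]; exact one_mem _)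
    (fun x => by rw [show x ^ 2 = 1 from Subtype.ext (h.pow_eq_one x x.2)]; exact one_mem _) huv hv
  let β : center G →* center G := MonoidHom.id _ * η
  have hβ : ∀ z, β z = z * η z := fun _ => rfl
  have hβ_inj : Function.Injective β := by
    refine (injective_iff_map_eq_one β).2 fun z hz => ?_
    rw [hβ] at hz
    have h1 : η z = 1 := hη z (by rw [eq_inv_of_mul_eq_one_left hz]; exact inv_mem (hηv z))
    rwa [h1, mul_one] at hz
  have hbc : (b * c) ^ 2 = 1 := by
    have : Commute b c := commutatorElement_eq_one_iff_mul_comm.1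
      (h.commute b h.left_mem c h.right_mem)
    rw [this.mul_pow, hb2, hc2, mul_one]
  obtain ⟨φ, hφ, -⟩ := h.exists_mulAut ha (mul_mem h.left_mem h.right_mem) h.right_mem β hβ_inj
    (by rw [show (⟨b ^ 2, h.pow_mem_center b⟩ : center G) = 1 from Subtype.ext hb2, map_one, hbc,
      OneMemClass.coe_one])
    (by rw [show (⟨c ^ 2, h.pow_mem_center c⟩ : center G) = 1 from Subtype.ext hc2, map_one, hc2,
      OneMemClass.coe_one])
    (by change (β u : G) = _; rw [hβ, hηu, hG'.mul_left]; rfl)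
    (by change (β v : G) = _; rw [hβ, hη v (mem_zpowers v), mul_one])
  exact h.right_ne_one (commutatorElement_eq_one_of_mem_center_left
    (h.mem_center_of_mulAut hG h.left_mem h.right_mem hφ) a)

theorem not_centralAutomorphisms [Finite G] (h : IsAbelianExtension p M a b c) :
    ¬ CentralAutomorphisms G := by
  intro hG
  obtain ⟨m, hm⟩ := h.cosetPowHom_surjective hG (⟨a ^ p, h.pow_mem_center a⟩⁻¹)
  have ha : (a * m) ^ p = 1 := by
    rw [h.mul_pow_eq, hm]
    exact mul_inv_cancel _
  have h' := h.mul_right m.2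
  by_cases hp : p = 2
  · subst hp
    exact h'.false_of_sq_eq_one hG ha
  · exact h'.false_of_pow_eq_one_of_odd hG hp ha

end IsAbelianExtension

end AbelianExtension

section Reduction

variable {G : Type*} [Group G] {p : ℕ}

namespace CentralCommutators

variable {a b c : G}

theorem card_centralizer_mul_card_range (hG : CentralCommutators G) (a : G) :
    Nat.card (centralizer {a}) * Nat.card (hG.commHom a).range = Nat.card G := by
  have hker : (hG.commHom a).ker = centralizer {a} := by
    ext g
    rw [mem_centralizer_singleton_iff_commutatorElement, MonoidHom.mem_ker, commHom_apply]
  rw [← card_mul_index (hG.commHom a).ker, index_ker, hker]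

variable [Finite G] [Fact p.Prime]

theorem center_eq_and_centralizer_eq (hG : CentralCommutators G) (hpG : IsPGroup p G)
    (hcard : Nat.card G < p ^ 6) (hba : ⁅b, a⁆ ≠ 1) (hca : ⁅c, a⁆ ∉ zpowers ⁅b, a⁆) :
    center G = zpowers ⁅b, a⁆ ⊔ zpowers ⁅c, a⁆ ∧ centralizer {a} = center G ⊔ zpowers a := by
  have hu : p * p ≤ Nat.card (zpowers ⁅b, a⁆ ⊔ zpowers ⁅c, a⁆ : Subgroup G) := by
    have h := hpG.mul_card_le_of_lt (lt_of_le_not_ge le_sup_left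
      fun h : zpowers ⁅b, a⁆ ⊔ zpowers ⁅c, a⁆ ≤ _ => hca (h (mem_sup_right (mem_zpowers _))))
    rwa [Nat.card_zpowers,
      orderOf_eq_prime (hG.commutatorElement_pow_eq_one hpG hcard a b) hba] at h
  have hrange := card_le_of_le (show zpowers ⁅b, a⁆ ⊔ zpowers ⁅c, a⁆ ≤ (hG.commHom a).range from
    sup_le (zpowers_le.2 ⟨b, rfl⟩) (zpowers_le.2 ⟨c, rfl⟩))
  have hsmall : ¬ p * (p * (p * p)) ≤ Nat.card (centralizer {a}) := fun h => by
    refine hcard.not_ge ?_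
    rw [← hG.card_centralizer_mul_card_range a]
    calc p ^ 6 = p * (p * (p * p)) * (p * p) := by ring
      _ ≤ _ := Nat.mul_le_mul h (hu.trans hrange)
  have haC : zpowers a ≤ centralizer {a} :=
    zpowers_le.2 (mem_centralizer_singleton_iff_commutatorElement.2 (commutatorElement_self a))
  have hle : center G ⊔ zpowers a ≤ centralizer {a} := sup_le (center_le_centralizer _) haC
  have hlt := hpG.mul_card_le_of_lt (lt_of_le_not_ge le_sup_left
    fun h : center G ⊔ zpowers a ≤ center G =>
      notMem_center_of_commutatorElement_ne_one hba (h (mem_sup_right (mem_zpowers a))))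
  have hleZ : zpowers ⁅b, a⁆ ⊔ zpowers ⁅c, a⁆ ≤ center G :=
    sup_le (zpowers_le.2 (hG b a)) (zpowers_le.2 (hG c a))
  refine ⟨(hleZ.eq_or_lt.resolve_right fun h => hsmall ?_).symm,
    (hle.eq_or_lt.resolve_right fun h => hsmall ?_).symm⟩
  · refine le_trans ?_ (hlt.trans (card_le_of_le hle))
    exact Nat.mul_le_mul_left p ((Nat.mul_le_mul_left p hu).trans (hpG.mul_card_le_of_lt h))
  · refine le_trans ?_ (hpG.mul_card_le_of_lt h)
    exact Nat.mul_le_mul_left p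
      ((Nat.mul_le_mul_left p (hu.trans (card_le_of_le hleZ))).trans hlt)

theorem exists_zpow_mul_zpow_eq (hG : CentralCommutators G) (hpG : IsPGroup p G)
    (hcard : Nat.card G < p ^ 6) (hba : ⁅b, a⁆ ≠ 1) (hca : ⁅c, a⁆ ∉ zpowers ⁅b, a⁆) {z : G}
    (hz : z ∈ center G) : ∃ i j : ℤ, ⁅b, a⁆ ^ i * ⁅c, a⁆ ^ j = z := by
  have : (zpowers ⁅b, a⁆).Normal := normal_of_le_center (zpowers_le.2 (hG b a))
  rw [(hG.center_eq_and_centralizer_eq hpG hcard hba hca).1] at hz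
  obtain ⟨_, ⟨i, rfl⟩, _, ⟨j, rfl⟩, h⟩ := mem_sup_of_normal_left.1 hz
  exact ⟨i, j, h⟩

theorem exists_eq_mul_zpow (hG : CentralCommutators G) (hpG : IsPGroup p G)
    (hcard : Nat.card G < p ^ 6) (hba : ⁅b, a⁆ ≠ 1) (hca : ⁅c, a⁆ ∉ zpowers ⁅b, a⁆) (g : G) :
    ∃ i j k : ℤ, ∃ z ∈ center G, g = b ^ i * c ^ j * z * a ^ k := by
  obtain ⟨i, j, hij⟩ := hG.exists_zpow_mul_zpow_eq hpG hcard hba hca (hG g a)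
  have h : (b ^ i * c ^ j)⁻¹ * g ∈ centralizer {a} := by
    rw [mem_centralizer_singleton_iff_commutatorElement, hG.mul_left, hG.inv_left, hG.mul_left,
      hG.zpow_left, hG.zpow_left, hij, inv_mul_cancel]
  rw [(hG.center_eq_and_centralizer_eq hpG hcard hba hca).2] at h
  obtain ⟨z, hz, _, ⟨k, rfl⟩, h⟩ := mem_sup_of_normal_left.1 h
  exact ⟨i, j, k, z, hz, by rw [mul_assoc, show z * a ^ k = _ from h]; group⟩

theorem isAbelianExtension (hG : CentralCommutators G) (hpG : IsPGroup p G)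
    (hcard : Nat.card G < p ^ 6) (hba : ⁅b, a⁆ ≠ 1) (hca : ⁅c, a⁆ ∉ zpowers ⁅b, a⁆)
    (hcb : ⁅c, b⁆ = 1) : IsAbelianExtension p (centralizer {b}) a b c := by
  have hpow := hG.commutatorElement_pow_eq_one hpG hcard
  have hbb : b ∈ centralizer {b} :=
    mem_centralizer_singleton_iff_commutatorElement.2 (commutatorElement_self b)
  have hcb' : c ∈ centralizer {b} := mem_centralizer_singleton_iff_commutatorElement.2 hcb
  have hab : ⁅a, b⁆ ≠ 1 := commutatorElement_ne_one_symm hba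
  have hmem : ∀ m ∈ centralizer {b}, ∃ i j : ℤ, ∃ z ∈ center G, m = b ^ i * c ^ j * z := by
    intro m hm
    obtain ⟨i, j, k, z, hz, rfl⟩ := hG.exists_eq_mul_zpow hpG hcard hba hca m
    rw [mem_centralizer_singleton_iff_commutatorElement, hG.mul_left, hG.mul_left, hG.mul_left,
      hG.zpow_left, hG.zpow_left, hG.zpow_left, hcb, commutatorElement_self,
      commutatorElement_eq_one_of_mem_center_left hz, one_zpow, one_zpow, one_mul, one_mul,
      one_mul, ← orderOf_dvd_iff_zpow_eq_one, orderOf_eq_prime (hpow b a) hab] at hm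
    obtain ⟨k, rfl⟩ := hm
    refine ⟨i, j, z * a ^ ((p : ℤ) * k), mul_mem hz ?_, by rw [mul_assoc]⟩
    rw [zpow_mul, zpow_natCast]
    exact zpow_mem (mem_center_of_forall_commutatorElement fun y => by
      rw [hG.pow_right, hpow]) k
  refine ⟨hG, hbb, hcb', fun m hm n hn => ?_, center_le_centralizer _, fun x => ?_, hmem,
    fun z hz => ?_, fun z hz => ?_, hba, hca⟩
  · obtain ⟨i, j, z, hz, rfl⟩ := hmem m hm
    obtain ⟨i', j', z', hz', rfl⟩ := hmem n hn
    have hbc : ⁅b, c⁆ = 1 := by rw [← commutatorElement_inv, hcb, inv_one]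
    simp [hG.mul_left, hG.mul_right, hG.zpow_left, hG.zpow_right, hbc, hcb,
      commutatorElement_eq_one_of_mem_center_left hz,
      commutatorElement_eq_one_of_mem_center_right hz']
  · obtain ⟨i, j, k, z, hz, rfl⟩ := hG.exists_eq_mul_zpow hpG hcard hba hca x
    refine ⟨-k, ?_⟩
    rw [mul_assoc, ← zpow_add, add_neg_cancel, zpow_zero, mul_one]
    exact mul_mem (mul_mem (zpow_mem hbb i) (zpow_mem hcb' j)) (center_le_centralizer _ hz)
  · obtain ⟨i, j, rfl⟩ := hG.exists_zpow_mul_zpow_eq hpG hcard hba hca hz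
    exact ⟨b ^ i * c ^ j, mul_mem (zpow_mem hbb i) (zpow_mem hcb' j), by
      rw [hG.mul_left, hG.zpow_left, hG.zpow_left]⟩
  · obtain ⟨i, j, rfl⟩ := hG.exists_zpow_mul_zpow_eq hpG hcard hba hca hz
    rw [← hG.zpow_left, ← hG.zpow_left, ← hG.mul_left, hpow]

theorem exists_isAbelianExtension (hG : CentralCommutators G) (hpG : IsPGroup p G)
    (hcard : Nat.card G < p ^ 6) (hba : ⁅b, a⁆ ≠ 1) (hca : ⁅c, a⁆ ∉ zpowers ⁅b, a⁆) :
    ∃ b' c' : G, IsAbelianExtension p (centralizer {b'}) a b' c' := by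
  obtain ⟨i, j, hij⟩ := hG.exists_zpow_mul_zpow_eq hpG hcard hba hca (hG c b)
  have hb : ⁅b * a ^ (-j), a⁆ = ⁅b, a⁆ := by
    rw [hG.mul_left, hG.zpow_left, commutatorElement_self, one_zpow, mul_one]
  have hc : ⁅c * a ^ i, a⁆ = ⁅c, a⁆ := by
    rw [hG.mul_left, hG.zpow_left, commutatorElement_self, one_zpow, mul_one]
  refine ⟨b * a ^ (-j), c * a ^ i, hG.isAbelianExtension hpG hcard (by rwa [hb]) (by rwa [hb, hc])
    ?_⟩
  rw [hG.mul_right, hG.zpow_right, hc, hG.mul_left, hG.zpow_left, ← hij,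
    ← commutatorElement_inv b, mem_center_iff.1 (zpow_mem (hG c a) j), inv_zpow,
    mul_inv_cancel_right, zpow_neg, mul_inv_cancel]

end CentralCommutators

end Reduction

/-- A Miller `p`-group has order at least `p ^ 6`. -/
theorem miller_pGroup_card_ge_p_pow_six
    (p : ℕ) (hp : p.Prime)
    (G : Type*) [Group G] (hG : IsMiller G) (hpG : IsPGroup p G) :
    p ^ 6 ≤ Nat.card G := by
  by_contra! hcard
  have : Fact p.Prime := ⟨hp⟩
  have : Finite G := hG.1
  have hA := hG.centralAutomorphisms
  obtain ⟨b, a, hab⟩ := hG.2.1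
  have hba : ⁅b, a⁆ ≠ 1 := fun h => hab (commutatorElement_eq_one_iff_mul_comm.1 h)
  by_cases hrange : ∀ a b : G, ⁅b, a⁆ ≠ 1 → ∀ g : G, ⁅g, a⁆ ∈ zpowers ⁅b, a⁆
  · obtain ⟨m, hm⟩ := IsPGroup.iff_card.1 (hpG.to_subgroup (center G))
    have hm0 : m ≠ 0 := by
      rintro rfl
      refine hba ?_
      have := hA.centralCommutators b a
      rwa [card_eq_one.1 (hm.trans (pow_zero p)), mem_bot] at this
    obtain rfl | hm1 := eq_or_ne m 1
    · exact hA.false_of_card_center_eq (hm.trans (pow_one p)) hba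
    · exact hA.false_of_commutatorElement_mem_zpowers hpG hcard
        (hm ▸ Nat.pow_le_pow_right hp.pos (by omega)) hrange hba
  · push Not at hrange
    obtain ⟨a, b, hba, c, hca⟩ := hrange
    obtain ⟨b', c', h⟩ := hA.centralCommutators.exists_isAbelianExtension hpG hcard hba hca
    exact h.not_centralAutomorphisms hA
end

section
/- If p is an odd prime and G is a Miller p-group, then |G| ≥ p^7. -/
open scoped commutatorElement

section ClassTwo

variable {G : Type*} [Group G]

theorem commutatorElement_mul_left_of_commute (hc : ∀ a b c : G, Commute ⁅a, b⁆ c) (a b c : G) :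
    ⁅a * b, c⁆ = ⁅a, c⁆ * ⁅b, c⁆ := by
  have h := (hc b c (a * c)).eq
  have h' := (hc b c a).eq
  calc ⁅a * b, c⁆ = a * ⁅b, c⁆ * c * a⁻¹ * c⁻¹ := by simp only [commutatorElement_def]; group
    _ = ⁅b, c⁆ * ⁅a, c⁆ := by rw [← h']; simp only [commutatorElement_def]; group
    _ = ⁅a, c⁆ * ⁅b, c⁆ := hc b c _

theorem commutatorElement_mul_right_of_commute (hc : ∀ a b c : G, Commute ⁅a, b⁆ c) (a b c : G) :
    ⁅a, b * c⁆ = ⁅a, b⁆ * ⁅a, c⁆ := by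
  rw [← commutatorElement_inv, commutatorElement_mul_left_of_commute hc, mul_inv_rev,
    commutatorElement_inv, commutatorElement_inv]
  exact hc a c _

/-- The symmetrizing factor of Baer's addition. -/
def baerFactor (h : ℕ) (x y : G) : G := ⁅y, x⁆ ^ h

variable {h : ℕ} (hh : ∀ g : G, (g ^ h) ^ 2 = g) (hc : ∀ a b c : G, Commute ⁅a, b⁆ c)
include hc

theorem baerFactor_commute (x y z : G) : Commute (baerFactor h x y) z := (hc y x z).pow_left h

theorem baerFactor_mul_left (x y z : G) :
    baerFactor h (x * y) z = baerFactor h x z * baerFactor h y z := by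
  rw [baerFactor, commutatorElement_mul_right_of_commute hc, (hc z x _).mul_pow]; rfl

theorem baerFactor_mul_right (x y z : G) :
    baerFactor h x (y * z) = baerFactor h x y * baerFactor h x z := by
  rw [baerFactor, commutatorElement_mul_left_of_commute hc, (hc y x _).mul_pow]; rfl

theorem baerFactor_baerFactor_left (x y z : G) : baerFactor h (baerFactor h x y) z = 1 := by
  rw [baerFactor, commutatorElement_eq_one_iff_commute.2 (baerFactor_commute hc x y z).symm,
    one_pow]

theorem baerFactor_baerFactor_right (x y z : G) : baerFactor h z (baerFactor h x y) = 1 := by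
  rw [baerFactor, commutatorElement_eq_one_iff_commute.2 (baerFactor_commute hc x y z), one_pow]

omit hc in
theorem baerFactor_swap (x y : G) : baerFactor h x y = (baerFactor h y x)⁻¹ := by
  rw [baerFactor, baerFactor, ← inv_pow, commutatorElement_inv]

omit hc in
theorem baerFactor_of_commute {x y : G} (hxy : Commute x y) : baerFactor h x y = 1 := by
  rw [baerFactor, commutatorElement_eq_one_iff_commute.2 hxy.symm, one_pow]

include hh in
/-- Baer's Lie ring of a group of class at most two, on the same carrier: `h` is a half modulo the
exponent and the sum of `x` and `y` is `x * y * ⁅y, x⁆ ^ h`. -/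
@[reducible] def baerAddCommGroup : AddCommGroup G where
  add x y := x * y * baerFactor h x y
  zero := 1
  neg x := x⁻¹
  add_assoc x y z := by
    change x * y * baerFactor h x y * z * baerFactor h (x * y * baerFactor h x y) z =
      x * (y * z * baerFactor h y z) * baerFactor h x (y * z * baerFactor h y z)
    simp only [baerFactor_mul_left hc, baerFactor_mul_right hc, baerFactor_baerFactor_left hc,
      baerFactor_baerFactor_right hc, mul_one]
    have h1 := (baerFactor_commute (h := h) hc x y z).eq
    have h2 := (baerFactor_commute (h := h) hc y z (baerFactor h x y * baerFactor h x z)).eq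
    have h3 := (baerFactor_commute (h := h) hc x z (baerFactor h y z)).eq
    simp only [mul_assoc] at *
    rw [h2, ← mul_assoc (baerFactor h x y) z, h1]
    simp only [mul_assoc]
  zero_add x := by
    change 1 * x * baerFactor h 1 x = x
    rw [baerFactor_of_commute (Commute.one_left x), one_mul, mul_one]
  add_zero x := by
    change x * 1 * baerFactor h x 1 = x
    rw [baerFactor_of_commute (Commute.one_right x), mul_one, mul_one]
  neg_add_cancel x := by
    change x⁻¹ * x * baerFactor h x⁻¹ x = 1
    rw [baerFactor_of_commute (Commute.refl x).inv_left, inv_mul_cancel, mul_one]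
  add_comm x y := by
    change x * y * baerFactor h x y = y * x * baerFactor h y x
    have h1 : baerFactor h x y * baerFactor h x y = ⁅y, x⁆ := by rw [← sq]; exact hh _
    have h2 : y * x = baerFactor h x y * baerFactor h x y * (x * y) := by
      rw [h1, commutatorElement_def]; group
    rw [h2, baerFactor_swap y x, mul_assoc (baerFactor h x y), mul_assoc (baerFactor h x y),
      (baerFactor_commute hc x y (baerFactor h x y * (x * y) * _)).eq, inv_mul_cancel_right,
      (baerFactor_commute hc x y (x * y)).eq]
  nsmul n x := x ^ n
  nsmul_zero x := pow_zero x
  nsmul_succ n x := by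
    change x ^ (n + 1) = x ^ n * x * baerFactor h (x ^ n) x
    rw [baerFactor_of_commute (Commute.pow_self x n), mul_one, pow_succ]
  zsmul n x := x ^ n
  zsmul_zero' x := zpow_zero x
  zsmul_succ' n x := by
    change x ^ ((n + 1 : ℕ) : ℤ) = x ^ (n : ℤ) * x * baerFactor h (x ^ (n : ℤ)) x
    rw [baerFactor_of_commute (Commute.zpow_self x n), mul_one, zpow_natCast, zpow_natCast,
      pow_succ]
  zsmul_neg' n x := by
    change x ^ Int.negSucc n = (x ^ ((n + 1 : ℕ) : ℤ))⁻¹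
    rw [zpow_negSucc, zpow_natCast]

include hh in
/-- The commutator as a biadditive map for Baer's addition. -/
@[reducible] def baerBracket :
    letI := baerAddCommGroup hh hc
    G →+ G →+ G :=
  letI := baerAddCommGroup hh hc
  AddMonoidHom.mk' (fun x => AddMonoidHom.mk' (fun y => ⁅x, y⁆) fun y z => by
    change ⁅x, y * z * ⁅z, y⁆ ^ h⁆ = ⁅x, y⁆ * ⁅x, z⁆ * ⁅⁅x, z⁆, ⁅x, y⁆⁆ ^ h
    rw [commutatorElement_mul_right_of_commute hc, commutatorElement_mul_right_of_commute hc,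
      commutatorElement_eq_one_iff_commute.2 (hc x z _),
      commutatorElement_eq_one_iff_commute.2 ((hc z y x).pow_left h).symm, one_pow]) fun x y => by
    ext z
    change ⁅x * y * ⁅y, x⁆ ^ h, z⁆ = ⁅x, z⁆ * ⁅y, z⁆ * ⁅⁅y, z⁆, ⁅x, z⁆⁆ ^ h
    rw [commutatorElement_mul_left_of_commute hc, commutatorElement_mul_left_of_commute hc,
      commutatorElement_eq_one_iff_commute.2 (hc y z _),
      commutatorElement_eq_one_iff_commute.2 ((hc y x z).pow_left h), one_pow]

end ClassTwo

/-- Some additive injection preserving the bracket moves an element modulo the centre. -/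
def HasNoncentralAut {L : Type*} [AddCommGroup L] (B : L →+ L →+ L) : Prop :=
  ∃ φ : L →+ L, Function.Injective φ ∧ (∀ x y, φ (B x y) = B (φ x) (φ y)) ∧
    ∃ x y, B (φ x) y ≠ B x y

theorem IsMiller.commute_commutatorElement {G : Type*} [Group G] (hG : IsMiller G) (a b c : G) :
    Commute ⁅a, b⁆ c := by
  have h := DFunLike.congr_fun (hG.2.2 (MulAut.conj a) (MulAut.conj b)) (a⁻¹ * b⁻¹ * c * b * a)
  simp only [MulAut.mul_apply, MulAut.conj_apply] at h
  have h' : a * b * a⁻¹ * b⁻¹ * c = c * (a * b * a⁻¹ * b⁻¹) := by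
    have := congrArg (· * (a * b * a⁻¹ * b⁻¹)) h
    simp only [mul_assoc, inv_mul_cancel_left, mul_inv_cancel_left, mul_inv_cancel, mul_one] at this
    simpa only [mul_assoc] using this
  exact h'

theorem IsMiller.commutatorElement_map_left {G : Type*} [Group G] (hG : IsMiller G)
    (φ : MulAut G) (x y : G) : ⁅φ x, y⁆ = ⁅x, y⁆ := by
  have h := DFunLike.congr_fun (hG.2.2 φ (MulAut.conj x)) (φ⁻¹ y)
  simp only [MulAut.mul_apply, MulAut.conj_apply, map_mul, map_inv, MulAut.apply_inv_self] at h
  rw [commutatorElement_def, commutatorElement_def, h]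

theorem IsMiller.not_hasNoncentralAut {G : Type*} [Group G] (hG : IsMiller G) {h : ℕ}
    (hh : ∀ g : G, (g ^ h) ^ 2 = g) :
    letI := baerAddCommGroup hh hG.commute_commutatorElement
    ¬ HasNoncentralAut (baerBracket hh hG.commute_commutatorElement) := by
  let := baerAddCommGroup hh hG.commute_commutatorElement
  have := hG.1
  rintro ⟨φ, hφ, hB, x, y, hxy⟩
  have hadd (a b : G) : φ (a * b * ⁅b, a⁆ ^ h) = φ a * φ b * ⁅φ b, φ a⁆ ^ h := φ.map_add a b
  have hpow (a : G) (n : ℕ) : φ (a ^ n) = φ a ^ n := φ.map_nsmul n a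
  have hbr (a b : G) : φ ⁅a, b⁆ = ⁅φ a, φ b⁆ := hB a b
  have hcen (a b : G) (c : G) : φ (a * ⁅b, c⁆ ^ h) = φ a * φ (⁅b, c⁆ ^ h) := by
    have hcomm := (hG.commute_commutatorElement b c a).pow_left h
    have := hadd a (⁅b, c⁆ ^ h)
    rw [commutatorElement_eq_one_iff_commute.2 hcomm, one_pow, mul_one, hpow, hbr,
      commutatorElement_eq_one_iff_commute.2
        ((hG.commute_commutatorElement (φ b) (φ c) (φ a)).pow_left h), one_pow, mul_one] at this
    rw [this, hpow, hbr]
  have hmul (a b : G) : φ (a * b) = φ a * φ b := by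
    have := hadd a b
    rw [hcen, hpow, hbr] at this
    exact mul_right_cancel this
  let ψ : MulAut G := MulEquiv.ofBijective (MonoidHom.mk' φ hmul)
    (Finite.injective_iff_bijective.1 hφ)
  exact hxy (hG.commutatorElement_map_left ψ x y)

section LieRing

variable {L : Type*} [AddCommGroup L] {B : L →+ L →+ L}

theorem bracket_swap (halt : ∀ x, B x x = 0) (x y : L) : B y x = -B x y := by
  have h := halt (x + y)
  simp only [map_add, AddMonoidHom.add_apply, halt, zero_add, add_zero] at h
  exact eq_neg_of_add_eq_zero_left h

theorem injective_of_injective_on_center (hnil : ∀ x y z, B (B x y) z = 0) (φ : L →+ L)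
    (hφ : ∀ x y, φ (B x y) = B (φ x) (φ y))
    (hZ : ∀ z, (∀ y, B z y = 0) → φ z = 0 → z = 0) : Function.Injective φ := by
  refine (injective_iff_map_eq_zero φ).2 fun x hx => hZ x (fun y => ?_) hx
  refine hZ _ (hnil x y) ?_
  rw [hφ, hx, map_zero, AddMonoidHom.zero_apply]

/-- The shift `x ↦ x + k x • u`, where `B u x = k x • w`. -/
theorem hasNoncentralAut_of_bracket_mem_zmultiples (halt : ∀ x, B x x = 0)
    (hnil : ∀ x y z, B (B x y) z = 0) {u y w : L} (hw : B u y = w) (hw0 : w ≠ 0)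
    (hu : ∀ x, B u x ∈ AddSubgroup.zmultiples w) (hord : ∀ m : ℤ, m • w = 0 → m • u = 0) :
    HasNoncentralAut B := by
  choose k hk using fun x => AddSubgroup.mem_zmultiples_iff.1 (hu x)
  let φ : L →+ L := AddMonoidHom.mk' (fun x => x + k x • u) fun a b => by
    have : (k (a + b) - (k a + k b)) • u = 0 := hord _ (by
      rw [sub_smul, add_smul, hk, hk, hk, map_add, sub_self])
    rw [sub_smul, add_smul, sub_eq_zero] at this
    rw [this]; abel
  have hφ (x : L) : φ x = x + k x • u := rfl
  have hk0 (x : L) (hx : B u x = 0) : k x • u = 0 := hord _ (by rw [hk, hx])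
  have hbr (a b : L) : φ (B a b) = B (φ a) (φ b) := by
    rw [hφ, hφ, hφ, hk0 _ (by rw [bracket_swap halt, hnil, neg_zero])]
    simp only [map_add, map_zsmul, AddMonoidHom.add_apply, AddMonoidHom.zsmul_apply, halt,
      smul_zero, add_zero]
    rw [bracket_swap halt u a, ← hk a, ← hk b, smul_neg, smul_smul, smul_smul, mul_comm]
    abel
  refine ⟨φ, injective_of_injective_on_center hnil φ hbr fun z hz h0 => ?_, hbr, y, y, ?_⟩
  · rwa [hφ, hk0 z (by rw [bracket_swap halt, hz, neg_zero]), add_zero] at h0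
  · rw [hφ]
    simp only [map_add, map_zsmul, AddMonoidHom.add_apply, AddMonoidHom.zsmul_apply]
    rwa [halt, zero_add, hw, hk, hw]

/-- The inversion of the abelian ideal `M` fixing its abelian complement `C`. -/
theorem hasNoncentralAut_of_isCompl [Finite L] (hodd : Odd (Nat.card L)) (halt : ∀ x, B x x = 0)
    (M C : Submodule ℤ L) (h : IsCompl M C)
    (hM : ∀ x ∈ M, ∀ y ∈ M, B x y = 0) (hC : ∀ x ∈ C, ∀ y ∈ C, B x y = 0)
    (hMC : ∀ x ∈ M, ∀ y, B x y ∈ M) (hne : ∃ x ∈ M, ∃ y, B x y ≠ 0) :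
    HasNoncentralAut B := by
  have htwo (z : L) (hz : z + z = 0) : z = 0 := by
    rw [← two_nsmul] at hz
    exact (Nat.Coprime.nsmul_right_bijective hodd.coprime_two_right).1 (by simpa using hz)
  let P : L →ₗ[ℤ] L := M.subtype ∘ₗ M.projectionOnto C h
  have hP (x : L) : P x ∈ M := (M.projectionOnto C h x).2
  have hPM (x : L) (hx : x ∈ M) : P x = x := by
    exact congrArg Subtype.val (Submodule.projectionOnto_apply_left h ⟨x, hx⟩)
  have hPC (x : L) : x - P x ∈ C := by
    rw [← Submodule.projectionOnto_apply_eq_zero_iff h]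
    rw [map_sub, sub_eq_zero]
    exact (Submodule.projectionOnto_apply_left h _).symm
  let φ : L →+ L := AddMonoidHom.mk' (fun x => (x - P x) - P x) fun a b => by
    rw [map_add]; abel
  have hφ (x : L) : φ x = (x - P x) - P x := rfl
  refine ⟨φ, (injective_iff_map_eq_zero φ).2 fun x hx => ?_, fun x y => ?_, ?_⟩
  · have h1 : P (φ x) = 0 := by rw [hx, map_zero]
    rw [hφ, map_sub, map_sub, hPM _ (hP x), sub_self, zero_sub, neg_eq_zero] at h1
    rwa [hφ, h1, sub_zero, sub_zero] at hx
  · have key : ∀ m ∈ M, ∀ c ∈ C, ∀ m' ∈ M, ∀ c' ∈ C,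
        B (c + m) (c' + m') - P (B (c + m) (c' + m')) - P (B (c + m) (c' + m')) =
          B (c - m) (c' - m') := by
      intro m hm c hc m' hm' c' hc'
      have h1 := hPM _ (hMC m hm c')
      have h2 := hPM _ (hMC m' hm' c)
      rw [bracket_swap halt, map_neg, neg_inj] at h2
      simp only [map_add, map_sub, AddMonoidHom.add_apply, AddMonoidHom.sub_apply, hC c hc c' hc',
        hM m hm m' hm', h1, h2, map_zero]
      abel
    have := key _ (hP x) _ (hPC x) _ (hP y) _ (hPC y)
    rwa [sub_add_cancel, sub_add_cancel] at this
  · obtain ⟨x, hx, y, hxy⟩ := hne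
    refine ⟨x, y, fun h => hxy (htwo _ ?_)⟩
    rw [hφ, hPM x hx, sub_self, zero_sub, map_neg, AddMonoidHom.neg_apply] at h
    nth_rewrite 1 [← h]
    rw [neg_add_cancel]

end LieRing

/-- A pair of linear maps compatible with the bracket `ω` and the power map `π` that moves some
vector of `V`. -/
def HasLinearAut {F V W : Type*} [Field F] [AddCommGroup V] [Module F V] [AddCommGroup W]
    [Module F W] (ω : V →ₗ[F] V →ₗ[F] W) (π : V →ₗ[F] W) : Prop :=
  ∃ (A : V →ₗ[F] V) (C : W →ₗ[F] W), Function.Injective C ∧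
    (∀ u v, ω (A u) (A v) = C (ω u v)) ∧ (∀ v, π (A v) = C (π v)) ∧ ∃ v, A v ≠ v

section Lift

variable {p : ℕ} [Fact p.Prime] {L V W : Type*} [AddCommGroup L] [AddCommGroup V]
  [Module (ZMod p) V] [AddCommGroup W] [Module (ZMod p) W]

theorem exists_addMonoidHom_lift [FiniteDimensional (ZMod p) V] {q : L →+ V} {ι : W →+ L}
    (hq : Function.Surjective q) (hι : Function.Injective ι)
    (hex : ∀ x, q x = 0 ↔ ∃ z, ι z = x) {π : V →ₗ[ZMod p] W}
    (hπ : ∀ x, ι (π (q x)) = p • x) (A : V →ₗ[ZMod p] V) (C : W →ₗ[ZMod p] W)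
    (hAC : ∀ v, π (A v) = C (π v)) :
    ∃ φ : L →+ L, (∀ x, q (φ x) = A (q x)) ∧ ∀ z, φ (ι z) = ι (C z) := by
  classical
  let b := Module.finBasis (ZMod p) V
  choose x hx using fun i => hq (b i)
  choose y hy using fun i => hq (A (b i))
  let f : (Fin (Module.finrank (ZMod p) V) → ℤ) × W →+ L :=
    (Fintype.linearCombination ℤ x).toAddMonoidHom.coprod ι
  let g : (Fin (Module.finrank (ZMod p) V) → ℤ) × W →+ L :=
    (Fintype.linearCombination ℤ y).toAddMonoidHom.coprod (ι.comp C.toAddMonoidHom)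
  have hf (n z) : f (n, z) = ∑ i, n i • x i + ι z := rfl
  have hg (n z) : g (n, z) = ∑ i, n i • y i + ι (C z) := rfl
  have hqι (z : W) : q (ι z) = 0 := (hex _).2 ⟨z, rfl⟩
  have hqf (n z) : q (f (n, z)) = ∑ i, (n i : ZMod p) • b i := by
    simp [hf, hqι, hx, Int.cast_smul_eq_zsmul]
  have hqg (n z) : q (g (n, z)) = A (∑ i, (n i : ZMod p) • b i) := by
    simp [hg, hqι, hy, Int.cast_smul_eq_zsmul]
  have hfs : Function.Surjective f := by
    intro l
    choose n hn using fun i => ZMod.intCast_surjective (b.repr (q l) i)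
    obtain ⟨z, hz⟩ := (hex (l - f (n, 0))).1 (by
      rw [map_sub, hqf, sub_eq_zero]
      simp only [hn, b.sum_repr])
    exact ⟨(n, z), by rw [hf, hz, hf, map_zero, add_zero, add_sub_cancel]⟩
  have hker : f.ker ≤ g.ker := by
    rintro ⟨n, z⟩ hnz
    rw [AddMonoidHom.mem_ker] at hnz ⊢
    have h0 := hqf n z
    rw [hnz, map_zero] at h0
    have hn (i) : (n i : ZMod p) = 0 :=
      Fintype.linearIndependent_iff.1 b.linearIndependent _ h0.symm i
    choose m hm using fun i => (ZMod.intCast_zmod_eq_zero_iff_dvd (n i) p).1 (hn i)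
    have hxs : ∑ i, n i • x i = ι (π (∑ i, m i • b i)) := by
      simp only [map_sum, map_zsmul]
      refine Finset.sum_congr rfl fun i _ => ?_
      rw [← hx, hπ, hm, mul_comm, mul_smul, natCast_zsmul]
    have hys : ∑ i, n i • y i = ι (C (π (∑ i, m i • b i))) := by
      simp only [map_sum, map_zsmul]
      refine Finset.sum_congr rfl fun i _ => ?_
      rw [← hAC, ← hy, hπ, hm, mul_comm, mul_smul, natCast_zsmul]
    rw [hf, hxs, ← map_add] at hnz
    rw [hg, hys, ← map_add, ← map_add, (injective_iff_map_eq_zero ι).1 hι _ hnz, map_zero, map_zero]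
  let φ : L →+ L := f.liftOfSurjective hfs ⟨g, hker⟩
  have hφ (t) : φ (f t) = g t := AddMonoidHom.liftOfRightInverse_comp_apply _ _ _ ⟨g, hker⟩ t
  refine ⟨φ, fun l => ?_, fun z => ?_⟩
  · obtain ⟨⟨n, z⟩, rfl⟩ := hfs l
    rw [hφ, hqf, hqg]
  · have h1 : ι z = f (0, z) := by simp [hf]
    rw [h1, hφ, hg]; simp

theorem HasLinearAut.hasNoncentralAut [FiniteDimensional (ZMod p) V] {B : L →+ L →+ L}
    (hnil : ∀ x y z, B (B x y) z = 0) {q : L →+ V} {ι : W →+ L}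
    (hq : Function.Surjective q) (hι : Function.Injective ι)
    (hcen : ∀ x, q x = 0 ↔ ∀ y, B x y = 0) (hex : ∀ x, q x = 0 ↔ ∃ z, ι z = x)
    {ω : V →ₗ[ZMod p] V →ₗ[ZMod p] W} {π : V →ₗ[ZMod p] W}
    (hω : ∀ x y, ι (ω (q x) (q y)) = B x y) (hπ : ∀ x, ι (π (q x)) = p • x)
    (h : HasLinearAut ω π) : HasNoncentralAut B := by
  obtain ⟨A, C, hC, hAω, hAπ, v, hv⟩ := h
  obtain ⟨φ, hφq, hφι⟩ := exists_addMonoidHom_lift hq hι hex hπ A C hAπ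
  have hbr (x y : L) : φ (B x y) = B (φ x) (φ y) := by
    rw [← hω, ← hω, hφι, hφq, hφq, hAω]
  refine ⟨φ, injective_of_injective_on_center hnil φ hbr fun z hz h0 => ?_, hbr, ?_⟩
  · obtain ⟨t, rfl⟩ := (hex z).1 ((hcen z).2 hz)
    rw [hφι] at h0
    rw [(injective_iff_map_eq_zero C).1 hC t ((injective_iff_map_eq_zero ι).1 hι _ h0), map_zero]
  · obtain ⟨x, rfl⟩ := hq v
    by_contra! hall
    refine hv ?_
    rw [← hφq, ← sub_eq_zero, ← map_sub, hcen]
    intro y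
    rw [map_sub, AddMonoidHom.sub_apply, hall, sub_self]

end Lift

section LinearAlgebra

variable {F V W : Type*} [Field F] [AddCommGroup V] [Module F V] [AddCommGroup W] [Module F W]
  {ω : V →ₗ[F] V →ₗ[F] W} {π : V →ₗ[F] W}

theorem linear_bracket_swap (halt : ∀ v, ω v v = 0) (u v : V) : ω v u = -ω u v :=
  (LinearMap.IsAlt.neg halt u v).symm

theorem hasLinearAut_of_basis {n : ℕ} (halt : ∀ v, ω v v = 0) (b : Module.Basis (Fin n) F V)
    (y : Fin n → V) (C : W →ₗ[F] W) (hC : Function.Injective C)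
    (hy : ∀ i j, i < j → ω (y i) (y j) = C (ω (b i) (b j)))
    (hπ : ∀ i, π (y i) = C (π (b i))) (hne : ∃ i, y i ≠ b i) : HasLinearAut ω π := by
  let A := b.constr F y
  have hA (i) : A (b i) = y i := b.constr_basis F y i
  have hyy (i j) : ω (y i) (y j) = C (ω (b i) (b j)) := by
    rcases lt_trichotomy i j with h | rfl | h
    · exact hy i j h
    · rw [halt, halt, map_zero]
    · rw [linear_bracket_swap halt, hy j i h, ← map_neg, ← linear_bracket_swap halt]
  have h1 : ω.compl₁₂ A A = ω.compr₂ C := b.ext fun i => b.ext fun j => by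
    simp only [LinearMap.compl₁₂_apply, LinearMap.compr₂_apply, hA, hyy]
  have h2 : π ∘ₗ A = C ∘ₗ π := b.ext fun i => by
    simp only [LinearMap.comp_apply, hA, hπ]
  obtain ⟨i, hi⟩ := hne
  exact ⟨A, C, hC, fun u v => LinearMap.congr_fun₂ h1 u v, LinearMap.congr_fun h2, b i, by rwa [hA]⟩

theorem linearIndependent_triple_iff {a b c : V} : LinearIndependent F ![a, b, c] ↔
    ∀ x y z : F, x • a + y • b + z • c = 0 → x = 0 ∧ y = 0 ∧ z = 0 := by
  rw [Fintype.linearIndependent_iff]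
  constructor
  · intro h x y z hxyz
    have := h ![x, y, z] (by simpa [Fin.sum_univ_three] using hxyz)
    exact ⟨this 0, this 1, this 2⟩
  · intro h g hg
    obtain ⟨h0, h1, h2⟩ := h (g 0) (g 1) (g 2) (by simpa [Fin.sum_univ_three] using hg)
    intro i
    fin_cases i <;> assumption

/-- Three independent vectors with dependent brackets span a space containing two independent
commuting vectors, which complete to three independent vectors of that space. -/
theorem exists_commuting_of_not_linearIndependent (halt : ∀ v, ω v v = 0) {a b c : V}
    (K : Submodule F V) (ha : a ∈ K) (hb : b ∈ K) (hc : c ∈ K)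
    (hk : LinearIndependent F ![a, b, c])
    (h : ¬ LinearIndependent F ![ω b c, ω c a, ω a b]) :
    ∃ a' ∈ K, ∃ b' ∈ K, ∃ c' ∈ K, LinearIndependent F ![a', b', c'] ∧ ω a' b' = 0 := by
  have main : ∀ a ∈ K, ∀ b ∈ K, ∀ c ∈ K, LinearIndependent F ![a, b, c] → ∀ s t r : F, r ≠ 0 →
      s • ω b c + t • ω c a + r • ω a b = 0 →
      ∃ a' ∈ K, ∃ b' ∈ K, ∃ c' ∈ K, LinearIndependent F ![a', b', c'] ∧ ω a' b' = 0 := by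
    intro a ha b hb c hc hl s t r hr h
    refine ⟨r • a - s • c, K.sub_mem (K.smul_mem r ha) (K.smul_mem s hc),
      r • b - t • c, K.sub_mem (K.smul_mem r hb) (K.smul_mem t hc), c, hc, ?_, ?_⟩
    · rw [linearIndependent_triple_iff] at hl ⊢
      intro x y z hxyz
      obtain ⟨h1, h2, h3⟩ := hl (x * r) (y * r) (z - x * s - y * t) (by rw [← hxyz]; module)
      have hx : x = 0 := by simpa [hr] using h1
      have hy : y = 0 := by simpa [hr] using h2
      exact ⟨hx, hy, by simpa [hx, hy] using h3⟩
    · have e1 : ω (r • a - s • c) (r • b - t • c)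
          = r • (s • ω b c + t • ω c a + r • ω a b) := by
        simp only [map_sub, map_smul, LinearMap.sub_apply, LinearMap.smul_apply, halt,
          linear_bracket_swap halt b c, linear_bracket_swap halt c a]
        module
      rw [e1, h, smul_zero]
  have hk' := linearIndependent_triple_iff.1 hk
  simp only [linearIndependent_triple_iff, not_forall] at h
  obtain ⟨s, t, r, h0, hne⟩ := h
  by_cases hr : r = 0
  · by_cases ht : t = 0
    · have hs : s ≠ 0 := fun hs => hne ⟨hs, ht, hr⟩
      refine main b hb c hc a ha (linearIndependent_triple_iff.2 fun x y z hxyz => ?_) t r s hs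
        (by rw [← h0]; module)
      obtain ⟨h1, h2, h3⟩ := hk' z x y (by rw [← hxyz]; module)
      exact ⟨h2, h3, h1⟩
    · refine main c hc a ha b hb (linearIndependent_triple_iff.2 fun x y z hxyz => ?_) r s t ht
        (by rw [← h0]; module)
      obtain ⟨h1, h2, h3⟩ := hk' y z x (by rw [← hxyz]; module)
      exact ⟨h3, h1, h2⟩
  · exact main a ha b hb c hc hk s t r hr h0

theorem exists_eq_of_linearIndependent_triple (hV : Module.finrank F V = 3) {a b c : V}
    (h : LinearIndependent F ![a, b, c]) (v : V) : ∃ x y z : F, v = x • a + y • b + z • c := by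
  let e := basisOfLinearIndependentOfCardEqFinrank h (by simp [hV])
  refine ⟨e.repr v 0, e.repr v 1, e.repr v 2, ?_⟩
  conv_lhs => rw [← e.sum_repr v]
  simp [Fin.sum_univ_three, e]

/-- The brackets of a basis of a three-dimensional space span all brackets. -/
theorem bracket_linearIndependent (halt : ∀ v, ω v v = 0) (hV : Module.finrank F V = 3)
    (hW : Module.finrank F W = 3) {a b c a' b' c' : V}
    (h : LinearIndependent F ![ω b c, ω c a, ω a b]) (h' : LinearIndependent F ![a', b', c']) :
    LinearIndependent F ![ω b' c', ω c' a', ω a' b'] := by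
  refine linearIndependent_of_top_le_span_of_card_eq_finrank ?_ (by simp [hW])
  have hmem (u v : V) : ω u v ∈ Submodule.span F (Set.range ![ω b' c', ω c' a', ω a' b']) := by
    obtain ⟨x, y, z, rfl⟩ := exists_eq_of_linearIndependent_triple hV h' u
    obtain ⟨x', y', z', rfl⟩ := exists_eq_of_linearIndependent_triple hV h' v
    have : ω (x • a' + y • b' + z • c') (x' • a' + y' • b' + z' • c') =
        (y * z' - z * y') • ω b' c' + (z * x' - x * z') • ω c' a'
          + (x * y' - y * x') • ω a' b' := by
      simp only [map_add, map_smul, LinearMap.add_apply, LinearMap.smul_apply, halt,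
        linear_bracket_swap halt b' c', linear_bracket_swap halt c' a',
        linear_bracket_swap halt a' b']
      module
    rw [this]
    refine add_mem (add_mem ?_ ?_) ?_ <;> refine Submodule.smul_mem _ _ (Submodule.subset_span ?_)
    · exact ⟨0, rfl⟩
    · exact ⟨1, rfl⟩
    · exact ⟨2, rfl⟩
  rintro w -
  obtain ⟨x, y, z, rfl⟩ := exists_eq_of_linearIndependent_triple hW h w
  exact add_mem (add_mem (Submodule.smul_mem _ _ (hmem _ _)) (Submodule.smul_mem _ _ (hmem _ _)))
    (Submodule.smul_mem _ _ (hmem _ _))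

theorem hasLinearAut_of_triple (halt : ∀ v, ω v v = 0) (hV : Module.finrank F V = 3)
    (hW : Module.finrank F W = 3) {a b c a' b' c' : V} (h : LinearIndependent F ![a, b, c])
    (h' : LinearIndependent F ![a', b', c'])
    (hω : LinearIndependent F ![ω b c, ω c a, ω a b])
    (hπ : ∀ C : W →ₗ[F] W, C (ω b c) = ω b' c' → C (ω c a) = ω c' a' → C (ω a b) = ω a' b' →
      π a' = C (π a) ∧ π b' = C (π b) ∧ π c' = C (π c))
    (hne : a' ≠ a ∨ b' ≠ b ∨ c' ≠ c) : HasLinearAut ω π := by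
  have hω' := bracket_linearIndependent halt hV hW hω h'
  let e := basisOfLinearIndependentOfCardEqFinrank h (by simp [hV])
  let f := basisOfLinearIndependentOfCardEqFinrank hω (by simp [hW])
  let C : W →ₗ[F] W := Fintype.linearCombination F ![ω b' c', ω c' a', ω a' b'] ∘ₗ f.equivFun
  have hCf (i) : C (f i) = ![ω b' c', ω c' a', ω a' b'] i := by
    simp [C, Fintype.linearCombination_apply, Finsupp.single_apply]
  have h0 : C (ω b c) = ω b' c' := by simpa [f] using hCf 0
  have h1 : C (ω c a) = ω c' a' := by simpa [f] using hCf 1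
  have h2 : C (ω a b) = ω a' b' := by simpa [f] using hCf 2
  obtain ⟨p0, p1, p2⟩ := hπ C h0 h1 h2
  refine hasLinearAut_of_basis halt e ![a', b', c'] C ?_ ?_ ?_ ?_
  · exact (linearIndependent_iff_injective_fintypeLinearCombination.1 hω').comp f.equivFun.injective
  · intro i j hij
    fin_cases i <;> fin_cases j <;> simp [e] at hij ⊢
    · exact h2.symm
    · rw [linear_bracket_swap halt c' a', linear_bracket_swap halt c a, map_neg, h1]
    · exact h0.symm
  · intro i
    fin_cases i <;> simp [e, p0, p1, p2]
  · rcases hne with h | h | h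
    · exact ⟨0, by simpa [e]⟩
    · exact ⟨1, by simpa [e]⟩
    · exact ⟨2, by simpa [e]⟩

theorem exists_linearIndependent_triple_of_lt (hV : 3 ≤ Module.finrank F V) {a : V} (ha : a ≠ 0) :
    ∃ b c, LinearIndependent F ![a, b, c] := by
  have h1 : LinearIndependent F ![a] := LinearIndependent.of_subsingleton 0 ha
  obtain ⟨b, hb⟩ := exists_linearIndependent_cons_of_lt_finrank h1 (by omega)
  obtain ⟨c, hc⟩ := exists_linearIndependent_cons_of_lt_finrank hb (by omega)
  have hc := linearIndependent_triple_iff.1 hc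
  refine ⟨b, c, linearIndependent_triple_iff.2 fun x y z h => ?_⟩
  obtain ⟨h1, h2, h3⟩ := hc z y x (by rw [← h]; module)
  exact ⟨h3, h2, h1⟩

theorem exists_linearIndependent_triple_of_functional (hV : 3 ≤ Module.finrank F V) {a : V}
    (ha : a ≠ 0) (f : V →ₗ[F] F) : ∃ b c, f b = 0 ∧ LinearIndependent F ![a, b, c] := by
  obtain ⟨b, c, h⟩ := exists_linearIndependent_triple_of_lt hV ha
  have h' := linearIndependent_triple_iff.1 h
  by_cases hc : f c = 0
  · refine ⟨c, b, hc, linearIndependent_triple_iff.2 fun x y z h => ?_⟩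
    obtain ⟨h1, h2, h3⟩ := h' x z y (by rw [← h]; module)
    exact ⟨h1, h3, h2⟩
  · refine ⟨b - (f b / f c) • c, c, by simp [hc], linearIndependent_triple_iff.2 fun x y z h => ?_⟩
    obtain ⟨h1, h2, h3⟩ := h' x y (z - y * (f b / f c)) (by rw [← h]; module)
    exact ⟨h1, h2, by simpa [h2] using h3⟩

theorem exists_pairing (halt : ∀ v, ω v v = 0) (hV : Module.finrank F V = 3)
    (hW : Module.finrank F W = 3) {a b c : V} (h : LinearIndependent F ![a, b, c])
    (hω : LinearIndependent F ![ω b c, ω c a, ω a b]) :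
    ∃ T : W →ₗ[F] V →ₗ[F] F, (∀ u v, T (ω u v) u = 0) ∧ (∀ u v, T (ω u v) v = 0) ∧
      ∀ w, T w = 0 → w = 0 := by
  let e := basisOfLinearIndependentOfCardEqFinrank h (by simp [hV])
  let f := basisOfLinearIndependentOfCardEqFinrank hω (by simp [hW])
  let T : W →ₗ[F] V →ₗ[F] F := f.constr F e.coord
  have hT (i j) : T (f i) (e j) = if j = i then 1 else 0 := by
    simp [T, Finsupp.single_apply]
  have t00 : T (ω b c) a = 1 := by simpa [f, e] using hT 0 0
  have t01 : T (ω b c) b = 0 := by simpa [f, e] using hT 0 1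
  have t02 : T (ω b c) c = 0 := by simpa [f, e] using hT 0 2
  have t10 : T (ω c a) a = 0 := by simpa [f, e] using hT 1 0
  have t11 : T (ω c a) b = 1 := by simpa [f, e] using hT 1 1
  have t12 : T (ω c a) c = 0 := by simpa [f, e] using hT 1 2
  have t20 : T (ω a b) a = 0 := by simpa [f, e] using hT 2 0
  have t21 : T (ω a b) b = 0 := by simpa [f, e] using hT 2 1
  have t22 : T (ω a b) c = 1 := by simpa [f, e] using hT 2 2
  have key (u v : V) : T (ω u v) u = 0 := by
    obtain ⟨x, y, z, rfl⟩ := exists_eq_of_linearIndependent_triple hV h u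
    obtain ⟨x', y', z', rfl⟩ := exists_eq_of_linearIndependent_triple hV h v
    simp only [map_add, map_smul, LinearMap.add_apply, LinearMap.smul_apply, halt, map_zero,
      LinearMap.zero_apply, smul_zero, linear_bracket_swap halt b c, linear_bracket_swap halt c a,
      linear_bracket_swap halt a b, map_neg, LinearMap.neg_apply, t00, t01, t02, t10, t11, t12,
      t20, t21, t22, smul_eq_mul]
    ring
  refine ⟨T, key, fun u v => ?_, fun w hw => ?_⟩
  · rw [linear_bracket_swap halt v u, map_neg, LinearMap.neg_apply, key, neg_zero]
  · obtain ⟨x, y, z, rfl⟩ := exists_eq_of_linearIndependent_triple hW hω w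
    have ha := LinearMap.congr_fun hw a
    have hb := LinearMap.congr_fun hw b
    have hc := LinearMap.congr_fun hw c
    simp only [map_add, map_smul, LinearMap.add_apply, LinearMap.smul_apply, t00, t01, t02, t10,
      t11, t12, t20, t21, t22, LinearMap.zero_apply, smul_eq_mul, mul_one, mul_zero, add_zero,
      zero_add] at ha hb hc
    simp [ha, hb, hc]

theorem exists_ne_zero_of_alternating (hV : Module.finrank F V = 3) (N : V →ₗ[F] V →ₗ[F] F)
    (hN : ∀ v, N v v = 0) : ∃ n, n ≠ 0 ∧ N n = 0 := by
  have : Module.Finite F V := Module.finite_of_finrank_pos (by omega)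
  have : Nontrivial V := Module.nontrivial_of_finrank_pos (R := F) (by omega)
  obtain ⟨a, ha⟩ := exists_ne (0 : V)
  obtain ⟨b, c, h⟩ := exists_linearIndependent_triple_of_lt hV.ge ha
  have h' := linearIndependent_triple_iff.1 h
  by_cases h0 : N b c = 0 ∧ N c a = 0 ∧ N a b = 0
  · refine ⟨a, ha, LinearMap.ext fun v => ?_⟩
    obtain ⟨x, y, z, rfl⟩ := exists_eq_of_linearIndependent_triple hV h v
    simp [h0, hN, linear_bracket_swap hN c a]
  · refine ⟨N b c • a + N c a • b + N a b • c, fun hn => h0 (h' _ _ _ hn),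
      LinearMap.ext fun v => ?_⟩
    obtain ⟨x, y, z, rfl⟩ := exists_eq_of_linearIndependent_triple hV h v
    simp only [map_add, map_smul, LinearMap.add_apply, LinearMap.smul_apply, hN,
      linear_bracket_swap hN b c, linear_bracket_swap hN c a,
      linear_bracket_swap hN a b, LinearMap.zero_apply, smul_eq_mul]
    ring

theorem hasLinearAut_of_negation (two : (2 : F) ≠ 0) (halt : ∀ v, ω v v = 0)
    (hV : Module.finrank F V = 3) (hW : Module.finrank F W = 3) {a b c : V}
    (h : LinearIndependent F ![a, b, c]) (hω : LinearIndependent F ![ω b c, ω c a, ω a b])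
    {α γ x y' y z s : F} (ha : π a = α • ω b c + γ • ω a b)
    (hb : π b = x • ω c a + y' • ω a b) (hc : π c = γ • ω b c + y • ω c a + z • ω a b)
    (hs : α * s = 2 * γ) : HasLinearAut ω π := by
  have hl := linearIndependent_triple_iff.1 h
  refine hasLinearAut_of_triple halt hV hW h (a' := a) (b' := -b)
    (c' := -c + s • a) (linearIndependent_triple_iff.2 fun x y z h0 => ?_) hω
    (fun C h0 h1 h2 => ?_) ?_
  · obtain ⟨h1, h2, h3⟩ := hl (x + z * s) (-y) (-z) (by rw [← h0]; module)
    rw [neg_eq_zero] at h2 h3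
    exact ⟨by simpa [h3] using h1, h2, h3⟩
  · have e0 : C (ω b c) = ω b c + s • ω a b := by
      rw [h0]
      simp only [map_add, map_smul, map_neg, LinearMap.neg_apply, linear_bracket_swap halt a b]
      module
    have e1 : C (ω c a) = -ω c a := by
      rw [h1]
      simp only [map_add, map_smul, map_neg, LinearMap.neg_apply, LinearMap.add_apply,
        LinearMap.smul_apply, halt]
      module
    have e2 : C (ω a b) = -ω a b := by rw [h2, map_neg]
    simp only [ha, hb, hc, e0, e1, e2, map_add, map_smul, map_neg]
    refine ⟨?_, ?_, ?_⟩
    · match_scalars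
      · ring
      · linear_combination -hs
    · module
    · match_scalars
      · linear_combination hs
      · ring
      · ring
  · refine .inr (.inl fun hb => ?_)
    have := (hl 0 2 0 (by rw [zero_smul, zero_smul, two_smul]; nth_rw 1 [← hb]; simp)).2.1
    exact two this

theorem hasLinearAut_of_shear (two : (2 : F) ≠ 0) (halt : ∀ v, ω v v = 0)
    (hV : Module.finrank F V = 3) (hW : Module.finrank F W = 3) {a b c : V}
    (h : LinearIndependent F ![a, b, c]) (hω : LinearIndependent F ![ω b c, ω c a, ω a b])
    {γ x y' y z : F} (hγ : γ ≠ 0) (ha : π a = γ • ω a b)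
    (hb : π b = x • ω c a + y' • ω a b) (hc : π c = γ • ω b c + y • ω c a + z • ω a b) :
    HasLinearAut ω π := by
  have hl := linearIndependent_triple_iff.1 h
  obtain ⟨s, hs⟩ : ∃ s, γ * s = -x := ⟨-x / γ, by field_simp⟩
  obtain ⟨t, ht⟩ : ∃ t, γ * (2 * t) = -(y + y' + x) :=
    ⟨-(y + y' + x) / (2 * γ), by field_simp⟩
  refine hasLinearAut_of_triple halt hV hW h (a' := a) (b' := b + s • a)
    (c' := c + b + t • a) (linearIndependent_triple_iff.2 fun k l m h0 => ?_) hω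
    (fun C h0 h1 h2 => ?_) ?_
  · obtain ⟨h1, h2, h3⟩ := hl (k + l * s + m * t) (l + m) m (by rw [← h0]; module)
    have hl0 : l = 0 := by simpa [h3] using h2
    exact ⟨by simpa [hl0, h3] using h1, hl0, h3⟩
  · have e0 : C (ω b c) = ω b c - s • ω c a + (s - t) • ω a b := by
      rw [h0]
      simp only [map_add, map_smul, LinearMap.add_apply, LinearMap.smul_apply, halt,
        linear_bracket_swap halt a b, linear_bracket_swap halt c a]
      module
    have e1 : C (ω c a) = ω c a - ω a b := by
      rw [h1]
      simp only [map_add, map_smul, LinearMap.add_apply,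
        LinearMap.smul_apply, halt, linear_bracket_swap halt a b]
      module
    have e2 : C (ω a b) = ω a b := by rw [h2, map_add, map_smul, halt, smul_zero, add_zero]
    simp only [ha, hb, hc, e0, e1, e2, map_add, map_smul]
    refine ⟨?_, ?_, ?_⟩
    · trivial
    · match_scalars
      · ring
      · linear_combination hs
    · match_scalars
      · ring
      · linear_combination hs
      · linear_combination ht - hs
  · refine .inr (.inr fun hc => ?_)
    have := (hl t 1 0 (by
      rw [zero_smul, one_smul, add_zero]
      refine add_left_cancel (a := c) ?_
      nth_rw 2 [← hc]
      module)).2.1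
    exact one_ne_zero this

/-- Three-dimensional spaces whose bracket is a cross product admit a compatible pair. -/
theorem hasLinearAut_of_bracket_linearIndependent (two : (2 : F) ≠ 0) (halt : ∀ v, ω v v = 0)
    (hV : Module.finrank F V = 3) (hW : Module.finrank F W = 3) {a b c : V}
    (h : LinearIndependent F ![a, b, c]) (hω : LinearIndependent F ![ω b c, ω c a, ω a b]) :
    HasLinearAut ω π := by
  obtain ⟨T, hT1, hT2, hT⟩ := exists_pairing halt hV hW h hω
  have hcyc (x y z : V) : T (ω x y) z = T (ω y z) x := by
    have := hT1 (x + z) y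
    simp only [map_add, LinearMap.add_apply, hT1] at this
    rw [linear_bracket_swap halt z y, map_neg, LinearMap.neg_apply]
    linear_combination this
  obtain ⟨n, hn, hN⟩ := exists_ne_zero_of_alternating hV (T ∘ₗ π - (T ∘ₗ π).flip)
    (fun v => by simp)
  have hN (v : V) : T (π n) v = T (π v) n := by
    simpa [sub_eq_zero] using LinearMap.congr_fun hN v
  obtain ⟨b', c', hb, h'⟩ := exists_linearIndependent_triple_of_functional hV.ge hn (T (π n))
  have hω' := bracket_linearIndependent halt hV hW hω h'
  clear h hω
  rename' h' => h, hω' => hω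
  clear a b c
  rename' n => a, b' => b, c' => c
  set δ := T (ω b c) a with hδ
  have hδ1 : T (ω c a) b = δ := (hcyc b c a).symm
  have hδ2 : T (ω a b) c = δ := (hcyc _ _ _)
  have hδ0 : δ ≠ 0 := by
    intro h0
    have h00 : ω b c = 0 := hT _ <| LinearMap.ext fun v => by
      obtain ⟨x, y, z, rfl⟩ := exists_eq_of_linearIndependent_triple hV h v
      simp [hT1, hT2, ← hδ, h0]
    have := hω.ne_zero 0
    simp [h00] at this
  obtain ⟨α, β, γ, ha⟩ := exists_eq_of_linearIndependent_triple hW hω (π a)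
  obtain ⟨β', x, y', hb'⟩ := exists_eq_of_linearIndependent_triple hW hω (π b)
  obtain ⟨γ', y, z, hc'⟩ := exists_eq_of_linearIndependent_triple hW hω (π c)
  have e1 := hN b
  have e2 := hN c
  simp only [ha, hb', hc', map_add, map_smul, LinearMap.add_apply, LinearMap.smul_apply, hT1, hT2,
    hδ1, hδ2, ← hδ, smul_eq_mul, mul_zero, add_zero, zero_add] at hb e1 e2
  have hβ : β = 0 := by simpa [hδ0] using hb
  have hβ' : β' = 0 := by simpa [hβ, hδ0] using e1
  have hγ : γ' = γ := mul_right_cancel₀ hδ0 e2.symm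
  subst hβ hβ' hγ
  simp only [zero_smul, add_zero, zero_add] at ha hb'
  by_cases hαγ : α = 0 ∧ γ' ≠ 0
  · obtain ⟨rfl, hγ⟩ := hαγ
    rw [zero_smul, zero_add] at ha
    exact hasLinearAut_of_shear two halt hV hW h hω hγ ha hb' hc'
  · obtain ⟨s, hs⟩ : ∃ s, α * s = 2 * γ' := by
      by_cases hα : α = 0
      · exact ⟨0, by simp_all⟩
      · exact ⟨2 * γ' / α, by field_simp⟩
    exact hasLinearAut_of_negation two halt hV hW h hω ha hb' hc' hs

theorem HasLinearAut.of_bijective {β : V →ₗ[F] V →ₗ[F] V} (hπ : Function.Bijective π)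
    (hβ : ∀ u v, π (β u v) = ω u v) (h : HasLinearAut β LinearMap.id) : HasLinearAut ω π := by
  obtain ⟨A, C, hC, hA, hAC, v, hv⟩ := h
  obtain rfl : A = C := LinearMap.ext hAC
  let e := LinearEquiv.ofBijective π hπ
  have he (v) : e.symm (π v) = v := e.symm_apply_apply v
  refine ⟨A, π ∘ₗ A ∘ₗ e.symm.toLinearMap, ?_, fun u v => ?_, fun v => ?_, v, hv⟩
  · exact hπ.1.comp (hC.comp e.symm.injective)
  · simp [← hβ, hA, he]
  · simp [he]

theorem hasLinearAut_id_of_triple {β : V →ₗ[F] V →ₗ[F] V} (halt : ∀ v, β v v = 0)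
    (hV : Module.finrank F V = 3) {a b c a' b' c' : V} (h : LinearIndependent F ![a, b, c])
    (h' : LinearIndependent F ![a', b', c'])
    (hβ : ∀ A : V →ₗ[F] V, A a = a' → A b = b' → A c = c' →
      β b' c' = A (β b c) ∧ β c' a' = A (β c a) ∧ β a' b' = A (β a b))
    (hne : a' ≠ a ∨ b' ≠ b ∨ c' ≠ c) : HasLinearAut β LinearMap.id := by
  let e := basisOfLinearIndependentOfCardEqFinrank h (by simp [hV])
  let A : V →ₗ[F] V := Fintype.linearCombination F ![a', b', c'] ∘ₗ e.equivFun
  have hA (i) : A (e i) = ![a', b', c'] i := by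
    simp [A, Fintype.linearCombination_apply, Finsupp.single_apply]
  have h0 : A a = a' := by simpa [e] using hA 0
  have h1 : A b = b' := by simpa [e] using hA 1
  have h2 : A c = c' := by simpa [e] using hA 2
  obtain ⟨p0, p1, p2⟩ := hβ A h0 h1 h2
  refine hasLinearAut_of_basis halt e ![a', b', c'] A ?_ ?_ ?_ ?_
  · exact (linearIndependent_iff_injective_fintypeLinearCombination.1 h').comp e.equivFun.injective
  · intro i j hij
    fin_cases i <;> fin_cases j <;> simp [e] at hij ⊢
    · exact p2
    · rw [linear_bracket_swap halt c' a', linear_bracket_swap halt c a, map_neg, p1]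
    · exact p0
  · intro i
    fin_cases i <;> simp [e, h0, h1, h2]
  · rcases hne with h | h | h
    · exact ⟨0, by simpa [e]⟩
    · exact ⟨1, by simpa [e]⟩
    · exact ⟨2, by simpa [e]⟩

theorem LinearIndependent.neg_ne_of_triple (two : (2 : F) ≠ 0) {a b c : V}
    (h : LinearIndependent F ![a, b, c]) : -a ≠ a := by
  intro ha
  have h0 : (2 : F) • a = 0 := by rw [two_smul]; nth_rw 1 [← ha]; simp
  exact two (linearIndependent_triple_iff.1 h 2 0 0 (by rw [h0]; simp)).1

/-- A three-dimensional anticommutative algebra with two independent commuting elements has a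
nontrivial automorphism. -/
theorem hasLinearAut_id_of_commuting (two : (2 : F) ≠ 0) {β : V →ₗ[F] V →ₗ[F] V}
    (halt : ∀ v, β v v = 0) (hV : Module.finrank F V = 3) {a b q : V}
    (h : LinearIndependent F ![a, b, q]) (hab : β a b = 0) : HasLinearAut β LinearMap.id := by
  have main : ∀ a b : V, ∀ x y x' y' z : F, LinearIndependent F ![a, b, q] → β a b = 0 →
      β q a = x • a + y • b → β q b = x' • a + y' • b + z • q →
      HasLinearAut β LinearMap.id := by
    clear h hab a b
    intro a b x y x' y' z h hab ha hb
    have hl := linearIndependent_triple_iff.1 h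
    have hba : β b a = 0 := by rw [linear_bracket_swap halt a b, hab, neg_zero]
    have hbq := linear_bracket_swap halt q b
    have haq := linear_bracket_swap halt q a
    by_cases hz : z = 0
    · refine hasLinearAut_id_of_triple halt hV h (a' := a) (b' := b) (c' := q + a)
        (linearIndependent_triple_iff.2 fun r s t h0 => ?_) (fun A h0 h1 h2 => ?_) ?_
      · obtain ⟨h1, h2, h3⟩ := hl (r + t) s t (by rw [← h0]; module)
        exact ⟨by simpa [h3] using h1, h2, h3⟩
      · simp only [hbq, ha, hb, hab, hz, map_add, map_smul, map_neg, LinearMap.add_apply, h0, h1,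
          halt, map_zero, zero_smul, hba, add_zero, and_self]
      · refine .inr (.inr fun hq => ?_)
        have ha0 : a = 0 := by simpa using hq
        exact h.ne_zero 0 (by simpa using ha0)
    by_cases hy : y = 0
    · subst hy
      refine hasLinearAut_id_of_triple halt hV h (a' := -a) (b' := b) (c' := q + (2 * x' / z) • a)
        (linearIndependent_triple_iff.2 fun r s t h0 => ?_) (fun A h0 h1 h2 => ?_)
        (.inl (h.neg_ne_of_triple two))
      · obtain ⟨h1, h2, h3⟩ := hl (-r + t * (2 * x' / z)) s t (by rw [← h0]; module)
        exact ⟨by simpa [h3] using h1, h2, h3⟩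
      · simp only [hbq, ha, hb, hab, map_add, map_smul, map_neg, LinearMap.add_apply, h0, h1, h2,
          halt, map_zero, zero_smul, hba, add_zero, LinearMap.smul_apply, smul_zero,
          LinearMap.neg_apply, neg_zero, and_true]
        constructor
        · match_scalars <;> field_simp
          ring
        · module
    · have hz' : y * z ≠ 0 := mul_ne_zero hy hz
      have ht : β q (x • a + y • b) =
          (y * x' - y' * x) • a + (x + y') • (x • a + y • b) + (y * z) • q := by
        simp only [map_add, map_smul, ha, hb]
        module
      generalize y * x' - y' * x = X, x + y' = Y, y * z = Z at *
      have hc : LinearIndependent F ![a, x • a + y • b, q] :=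
        linearIndependent_triple_iff.2 fun r s t h0 => by
          obtain ⟨h1, h2, h3⟩ := hl (r + s * x) (s * y) t (by rw [← h0]; module)
          have hs : s = 0 := by simpa [hy] using h2
          exact ⟨by simpa [hs] using h1, hs, h3⟩
      have hat : β a (x • a + y • b) = 0 := by simp [halt, hab]
      generalize x • a + y • b = t at *
      have hta : β t a = 0 := by rw [linear_bracket_swap halt a t, hat, neg_zero]
      have htq := linear_bracket_swap halt q t
      have hl := linearIndependent_triple_iff.1 hc
      refine hasLinearAut_id_of_triple halt hV hc (a' := -a) (b' := t)
        (c' := -q - (2 * Y / Z) • t)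
        (linearIndependent_triple_iff.2 fun r s m h0 => ?_) (fun A h0 h1 h2 => ?_)
        (.inl (hc.neg_ne_of_triple two))
      · obtain ⟨h1, h2, h3⟩ := hl (-r) (s - m * (2 * Y / Z)) (-m) (by rw [← h0]; module)
        rw [neg_eq_zero] at h1 h3
        exact ⟨h1, by simpa [h3] using h2, h3⟩
      · simp only [htq, ha, ht, hat, map_add, map_smul, map_neg, map_sub,
          h0, h1, h2, halt, map_zero, hta, LinearMap.smul_apply, smul_zero, neg_neg,
          LinearMap.neg_apply, neg_zero, LinearMap.sub_apply, sub_zero, and_true]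
        match_scalars <;> field_simp
        ring
  obtain ⟨x, y, z, ha⟩ := exists_eq_of_linearIndependent_triple hV h (β q a)
  obtain ⟨x', y', z', hb⟩ := exists_eq_of_linearIndependent_triple hV h (β q b)
  by_cases hz : z = 0
  · subst hz
    exact main a b x y x' y' z' h hab (by rw [ha]; module) hb
  · have hl := linearIndependent_triple_iff.1 h
    refine main (b - (z' / z) • a) a (y' - (z' / z) * y)
      (x' - (z' / z) * x + (y' - (z' / z) * y) * (z' / z)) y (x + y * (z' / z)) z
      (linearIndependent_triple_iff.2 fun r s t h0 => ?_) ?_ ?_ ?_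
    · obtain ⟨h1, h2, h3⟩ := hl (s - r * (z' / z)) r t (by rw [← h0]; module)
      exact ⟨h2, by simpa [h2] using h1, h3⟩
    · simp [halt, linear_bracket_swap halt a b, hab]
    · simp only [map_sub, map_smul, ha, hb]
      match_scalars <;> field_simp <;> ring
    · rw [ha]
      module

theorem hasLinearAut_of_bijective (two : (2 : F) ≠ 0) (halt : ∀ v, ω v v = 0)
    (hπ : Function.Bijective π) (hV : Module.finrank F V = 3) {a b q : V}
    (h : LinearIndependent F ![a, b, q]) (hab : ω a b = 0) : HasLinearAut ω π := by
  let e := LinearEquiv.ofBijective π hπ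
  have he (w) : π (e.symm w) = w := e.apply_symm_apply w
  refine (hasLinearAut_id_of_commuting two
    (β := ω.compr₂ e.symm.toLinearMap) ?_ hV h ?_).of_bijective
    hπ fun u v => ?_
  · simp [halt]
  · simp [hab]
  · simp [he]

theorem hasLinearAut_of_bracket_eq_smul {k : V} (hk : π k = 0) (hk0 : ω k ≠ 0)
    (halt : ∀ v, ω v v = 0) {w : W} (hw : ∀ u, ∃ t : F, ω k u = t • w) : HasLinearAut ω π := by
  have hw0 : w ≠ 0 := by
    rintro rfl
    refine hk0 (LinearMap.ext fun u => ?_)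
    obtain ⟨t, ht⟩ := hw u
    simpa using ht
  choose t ht using hw
  let l : V →ₗ[F] F :=
    { toFun := t
      map_add' := fun u v => smul_left_injective F hw0 (by simp [← ht, add_smul])
      map_smul' := fun c u => smul_left_injective F hw0 (by simp [← ht, mul_smul]) }
  have hl (u) : ω k u = l u • w := ht u
  have hl' (u) : ω u k = -(l u • w) := by rw [linear_bracket_swap halt k u, hl]
  have hlk : l k = 0 := by simpa [hl, hw0] using halt k
  refine ⟨LinearMap.id + l.smulRight k, LinearMap.id, Function.injective_id, fun u v => ?_,
    fun v => by simp [hk], ?_⟩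
  · simp only [LinearMap.add_apply, LinearMap.id_apply, LinearMap.smulRight_apply, map_add,
      map_smul, LinearMap.smul_apply, hl, hl', hlk]
    module
  · by_contra! h
    refine hk0 (LinearMap.ext fun u => ?_)
    have := h u
    simp only [LinearMap.add_apply, LinearMap.id_apply, LinearMap.smulRight_apply,
      add_eq_left, smul_eq_zero] at this
    rcases this with h | rfl
    · simp [hl, h]
    · simp

theorem hasLinearAut_of_commuting_ker (halt : ∀ v, ω v v = 0) (hV : Module.finrank F V = 4)
    (hW : Module.finrank F W = 2) {a b : V} (hab : LinearIndependent F ![a, b])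
    (ha : π a = 0) (hb : π b = 0) (hc : ω a b = 0) : HasLinearAut ω π := by
  obtain ⟨v, hv⟩ := exists_linearIndependent_cons_of_lt_finrank hab (by omega)
  obtain ⟨w, hw⟩ := exists_linearIndependent_cons_of_lt_finrank hv (by omega)
  have hw : LinearIndependent F ![w, v, a, b] := hw
  have hca : ω b a = 0 := by rw [linear_bracket_swap halt a b, hc, neg_zero]
  let e := basisOfLinearIndependentOfCardEqFinrank hw (by simp [hV])
  have : Module.Finite F W := Module.finite_of_finrank_pos (by omega)
  let f : (Fin 4 → F) →ₗ[F] W :=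
    Fintype.linearCombination F ![ω w a, ω w b, ω a v, ω b v]
  have hf (g) : f g = g 0 • ω w a + g 1 • ω w b + g 2 • ω a v + g 3 • ω b v := by
    simp [f, Fintype.linearCombination_apply, Fin.sum_univ_four]
  obtain ⟨g, hg, hg0⟩ := Submodule.exists_mem_ne_zero_of_ne_bot
    (LinearMap.ker_ne_bot_of_finrank_lt (f := f) (by simp [hW]))
  rw [LinearMap.mem_ker, hf] at hg
  refine hasLinearAut_of_basis halt e
    ![w + (g 2 • a + g 3 • b), v + (g 0 • a + g 1 • b), a, b] LinearMap.id
    Function.injective_id ?_ ?_ ?_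
  · intro i j hij
    have h1 : ω (w + (g 2 • a + g 3 • b)) (v + (g 0 • a + g 1 • b)) = ω w v := by
      simp only [map_add, map_smul, LinearMap.add_apply, LinearMap.smul_apply, halt, hc, hca]
      rw [← sub_eq_zero]
      refine Eq.trans ?_ hg
      module
    fin_cases i <;> fin_cases j <;> simp [e, halt, hc, hca] at hij ⊢
    simpa [halt, hc, hca] using h1
  · intro i
    fin_cases i <;> simp [e, ha, hb]
  · by_contra! h
    refine hg0 (funext fun i => ?_)
    have h0 := LinearIndependent.pair_iff.1 hab _ _ (by simpa [e] using h 0)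
    have h1 := LinearIndependent.pair_iff.1 hab _ _ (by simpa [e] using h 1)
    fin_cases i
    exacts [h1.1, h1.2, h0.1, h0.2]

theorem linearIndependent_of_ker {k₁ k₂ v₁ v₂ : V} (hk : LinearIndependent F ![k₁, k₂])
    (hv : LinearIndependent F ![π v₁, π v₂]) (hk₁ : π k₁ = 0) (hk₂ : π k₂ = 0) :
    LinearIndependent F ![k₁, k₂, v₁, v₂] := by
  rw [Fintype.linearIndependent_iff]
  intro g hg
  simp only [Fin.sum_univ_four, Matrix.cons_val] at hg
  have h1 := congrArg π hg
  simp only [map_add, map_smul, hk₁, hk₂, smul_zero, zero_add, map_zero] at h1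
  obtain ⟨g2, g3⟩ := LinearIndependent.pair_iff.1 hv _ _ h1
  obtain ⟨g0, g1⟩ := LinearIndependent.pair_iff.1 hk (g 0) (g 1) (by simpa [g2, g3] using hg)
  intro i
  fin_cases i <;> assumption

theorem hasLinearAut_of_graded (two : (2 : F) ≠ 0) (halt : ∀ v, ω v v = 0)
    (hV : Module.finrank F V = 4)
    (hW : Module.finrank F W = 2) {k₁ k₂ v₁ v₂ : V} {z₁ z₂ : W} (hk : LinearIndependent F ![k₁, k₂])
    (hz : LinearIndependent F ![z₁, z₂]) (hk₁ : π k₁ = 0) (hk₂ : π k₂ = 0) (hv₁ : π v₁ = z₁)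
    (hv₂ : π v₂ = z₂) {a b c d e f : F} (h11 : ω k₁ v₁ = a • z₁) (h22 : ω k₂ v₂ = b • z₁)
    (hkk : ω k₁ k₂ = c • z₂) (h12 : ω k₁ v₂ = d • z₂) (h21 : ω k₂ v₁ = e • z₂)
    (hvv : ω v₁ v₂ = f • z₂) : HasLinearAut ω π := by
  have hli := linearIndependent_of_ker hk (hv₁.symm ▸ hv₂.symm ▸ hz) hk₁ hk₂
  let B := basisOfLinearIndependentOfCardEqFinrank hli (by simp [hV])
  let D := basisOfLinearIndependentOfCardEqFinrank hz (by simp [hW])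
  have hz' : LinearIndependent F ![z₁, -z₂] := LinearIndependent.pair_iff.2 fun s t h => by
    obtain ⟨h1, h2⟩ := LinearIndependent.pair_iff.1 hz s (-t) (by rw [← h]; module)
    exact ⟨h1, by simpa using h2⟩
  let C : W →ₗ[F] W := Fintype.linearCombination F ![z₁, -z₂] ∘ₗ D.equivFun
  have hC (i) : C (D i) = ![z₁, -z₂] i := by
    simp [C, Fintype.linearCombination_apply, Finsupp.single_apply]
  have h1 : C z₁ = z₁ := by simpa [D] using hC 0
  have h2 : C z₂ = -z₂ := by simpa [D] using hC 1
  refine hasLinearAut_of_basis halt B ![k₁, -k₂, v₁, -v₂] C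
    ((linearIndependent_iff_injective_fintypeLinearCombination.1 hz').comp D.equivFun.injective)
    ?_ ?_ ⟨1, ?_⟩
  · intro i j hij
    have h21' := linear_bracket_swap halt v₁ k₂
    fin_cases i <;> fin_cases j <;> simp [B, *] at hij ⊢
  · intro i
    fin_cases i <;> simp [B, *]
  · intro h
    have h0 : (2 : F) • k₂ = 0 := by
      rw [two_smul]
      nth_rw 1 [← show -k₂ = k₂ by simpa [B] using h]
      simp
    exact two (LinearIndependent.pair_iff.1 hk 0 2 (by rw [h0]; simp)).2

theorem hasLinearAut_of_normal_form (two : (2 : F) ≠ 0) (halt : ∀ v, ω v v = 0)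
    (hV : Module.finrank F V = 4)
    (hW : Module.finrank F W = 2) {k₁ k₂ v₁ v₂ : V} {z₁ z₂ : W} (hk : LinearIndependent F ![k₁, k₂])
    (hz : LinearIndependent F ![z₁, z₂]) (hk₁ : π k₁ = 0) (hk₂ : π k₂ = 0) (hv₁ : π v₁ = z₁)
    (hv₂ : π v₂ = z₂) {a b c d e f g h : F} (ha : a ≠ 0) (hc : c ≠ 0)
    (h11 : ω k₁ v₁ = a • z₁ + b • z₂) (h22 : ω k₂ v₂ = c • z₁ + d • z₂)
    (hkk : ω k₁ k₂ = z₂) (h12 : ω k₁ v₂ = e • z₂) (h21 : ω k₂ v₁ = f • z₂)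
    (hvv : ω v₁ v₂ = g • z₁ + h • z₂) : HasLinearAut ω π := by
  obtain ⟨r, hr⟩ : ∃ r, 2 * a ^ 2 * r = g - b * c - a * d :=
    ⟨(g - b * c - a * d) / (2 * a ^ 2), by field_simp⟩
  obtain ⟨r', hr'⟩ : ∃ r', r' * c + r * a = 0 := ⟨-r * a / c, by field_simp; ring⟩
  obtain ⟨s, hs⟩ : ∃ s, s = d + r * (e + a) := ⟨_, rfl⟩
  obtain ⟨t, ht⟩ : ∃ t, t = -b - r' * (e - a) := ⟨_, rfl⟩
  have s11 := linear_bracket_swap halt k₁ v₁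
  have s22 := linear_bracket_swap halt k₂ v₂
  have skk := linear_bracket_swap halt k₁ k₂
  have s12 := linear_bracket_swap halt k₁ v₂
  have s21 := linear_bracket_swap halt k₂ v₁
  have svv := linear_bracket_swap halt v₁ v₂
  refine hasLinearAut_of_graded two halt hV hW (k₁ := k₁) (k₂ := k₂ + r • k₁)
    (v₁ := v₁ + r' • v₂ + t • (k₂ + r • k₁)) (v₂ := v₂ + s • k₁) (z₁ := z₁ + r' • z₂) (z₂ := z₂)
    (LinearIndependent.pair_iff.2 fun x y h => ?_) (LinearIndependent.pair_iff.2 fun x y h => ?_)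
    hk₁ (by simp [hk₁, hk₂]) (by simp [hk₁, hk₂, hv₁, hv₂]) (by simp [hk₁, hv₂])
    (a := a) (b := c) (c := 1) (d := e) (e := f + r' * d + r * b + r * r' * e)
    (f := h - s * b - r' * s * e + t * (d + r * e) - t * s) ?_ ?_ ?_ ?_ ?_ ?_
  · obtain ⟨h1, h2⟩ := LinearIndependent.pair_iff.1 hk (x + y * r) y (by rw [← h]; module)
    exact ⟨by simpa [h2] using h1, h2⟩
  · obtain ⟨h1, h2⟩ := LinearIndependent.pair_iff.1 hz x (x * r' + y) (by rw [← h]; module)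
    exact ⟨h1, by simpa [h1] using h2⟩
  · simp only [map_add, map_smul, halt, h11, hkk, h12]
    match_scalars
    · ring
    · linear_combination ht
  · simp only [map_add, map_smul, LinearMap.add_apply, LinearMap.smul_apply, halt, skk, h22, hkk,
      h12]
    match_scalars
    · ring
    · linear_combination -hs - hr'
  · simp [halt, hkk]
  · simp [halt, h12]
  · simp only [map_add, map_smul, LinearMap.add_apply, LinearMap.smul_apply, halt, skk, h22, hkk,
      h12, h21, h11]
    match_scalars
    · ring
    · linear_combination hr'
  · simp only [map_add, map_smul, LinearMap.add_apply, LinearMap.smul_apply, halt, s11, skk,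
      s12, h11, h22, hkk, h12, hvv]
    match_scalars
    · linear_combination c * ht - a * hs - (e - a) * hr' - hr
    · ring

/-- In dimensions four and two, a bracket with trivial radical admits a compatible pair. -/
theorem hasLinearAut_of_finrank_eq_four (two : (2 : F) ≠ 0) (halt : ∀ v, ω v v = 0)
    (hV : Module.finrank F V = 4) (hW : Module.finrank F W = 2) (hrad : ∀ v, ω v = 0 → v = 0) :
    HasLinearAut ω π := by
  have : Module.Finite F V := Module.finite_of_finrank_pos (by omega)
  have : Module.Finite F W := Module.finite_of_finrank_pos (by omega)
  by_contra hno
  have hcomm {a b : V} (hab : LinearIndependent F ![a, b]) (ha : π a = 0) (hb : π b = 0) :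
      ω a b ≠ 0 := fun h0 => hno (hasLinearAut_of_commuting_ker halt hV hW hab ha hb h0)
  have honto {k : V} (hk : π k = 0) (hk0 : k ≠ 0) (w : W) : ¬ ∀ u, ∃ t : F, ω k u = t • w :=
    fun h => hno (hasLinearAut_of_bracket_eq_smul hk (fun h0 => hk0 (hrad k h0)) halt h)
  have hrank := π.finrank_range_add_finrank_ker
  have hK2 : Module.finrank F (LinearMap.ker π) ≤ 2 := by
    by_contra! hK
    obtain ⟨f, hf⟩ := exists_linearIndependent_of_le_finrank (R := F) hK
    have hf' : LinearIndependent F ![(f 0 : V), f 1, f 2] := by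
      have h : ![(f 0 : V), f 1, f 2] = (LinearMap.ker π).subtype ∘ f := by
        ext i
        fin_cases i <;> rfl
      exact h ▸ hf.map' _ (Submodule.ker_subtype _)
    obtain ⟨a, ha, b, hb, c, hc, h, h0⟩ := exists_commuting_of_not_linearIndependent halt
      (LinearMap.ker π) (f 0).2 (f 1).2 (f 2).2 hf' fun h => by
        have := h.fintype_card_le_finrank
        simp [hW] at this
    refine hcomm (LinearIndependent.pair_iff.2 fun s t hst => ?_) ha hb h0
    obtain ⟨h1, h2, -⟩ := linearIndependent_triple_iff.1 h s t 0 (by simpa using hst)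
    exact ⟨h1, h2⟩
  have hR := (LinearMap.range π).finrank_le
  have hsurj : Function.Surjective π :=
    LinearMap.range_eq_top.1 (Submodule.eq_top_of_finrank_eq (by omega))
  obtain ⟨f, hf⟩ := exists_linearIndependent_of_le_finrank (R := F) (M := LinearMap.ker π)
    (n := 2) (by omega)
  obtain ⟨k₁, k₂, hk₁, hk₂, hf'⟩ :
      ∃ k₁ k₂, π k₁ = 0 ∧ π k₂ = 0 ∧ LinearIndependent F ![k₁, k₂] := by
    have h : ![(f 0 : V), f 1] = (LinearMap.ker π).subtype ∘ f := by
      ext i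
      fin_cases i <;> rfl
    exact ⟨f 0, f 1, (f 0).2, (f 1).2, h ▸ hf.map' _ (Submodule.ker_subtype _)⟩
  have hz2 := hcomm hf' hk₁ hk₂
  have h1 : LinearIndependent F ![ω k₁ k₂] := LinearIndependent.of_subsingleton 0 hz2
  obtain ⟨z₁, hz⟩ := exists_linearIndependent_cons_of_lt_finrank h1 (by omega)
  replace hz : LinearIndependent F ![z₁, ω k₁ k₂] := hz
  obtain ⟨v₁, hv₁⟩ := hsurj z₁
  obtain ⟨v₂, hv₂⟩ := hsurj (ω k₁ k₂)
  have hcoord (w : W) : ∃ x y : F, w = x • z₁ + y • ω k₁ k₂ := by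
    let e := basisOfLinearIndependentOfCardEqFinrank hz (by simp [hW])
    refine ⟨e.repr w 0, e.repr w 1, ?_⟩
    conv_lhs => rw [← e.sum_repr w]
    simp [Fin.sum_univ_two, e]
  have main : ∀ k₁' k₂' : V, π k₁' = 0 → π k₂' = 0 → LinearIndependent F ![k₁', k₂'] →
      ω k₁' k₂' = ω k₁ k₂ → (∃ e : F, ω k₁' v₂ = e • ω k₁ k₂) → False := by
    intro k₁' k₂' hk₁' hk₂' hk hkk ⟨e, he⟩
    have hspan (u : V) : ∃ x y s t : F, u = x • k₁' + y • k₂' + s • v₁ + t • v₂ := by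
      let B := basisOfLinearIndependentOfCardEqFinrank
        (linearIndependent_of_ker hk (hv₁.symm ▸ hv₂.symm ▸ hz) hk₁' hk₂') (by simp [hV])
      refine ⟨B.repr u 0, B.repr u 1, B.repr u 2, B.repr u 3, ?_⟩
      conv_lhs => rw [← B.sum_repr u]
      simp [Fin.sum_univ_four, B]
    obtain ⟨a, b, h11⟩ := hcoord (ω k₁' v₁)
    have ha : a ≠ 0 := by
      rintro rfl
      refine honto hk₁' (hk.ne_zero 0) (ω k₁ k₂) fun u => ?_
      obtain ⟨x, y, s, t, rfl⟩ := hspan u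
      refine ⟨y + s * b + t * e, ?_⟩
      simp only [map_add, map_smul, halt, hkk, h11, he]
      module
    obtain ⟨f', f, h21⟩ := hcoord (ω k₂' v₁)
    obtain ⟨c, d, h22⟩ := hcoord (ω k₂' v₂)
    obtain ⟨g, h, hvv⟩ := hcoord (ω v₁ v₂)
    have h21' : ω (k₂' - (f' / a) • k₁') v₁ = (f - f' / a * b) • ω k₁ k₂ := by
      simp only [map_sub, map_smul, LinearMap.sub_apply, LinearMap.smul_apply, h11, h21]
      match_scalars <;> field_simp
      ring
    have h22' : ω (k₂' - (f' / a) • k₁') v₂ = c • z₁ + (d - f' / a * e) • ω k₁ k₂ := by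
      simp only [map_sub, map_smul, LinearMap.sub_apply, LinearMap.smul_apply, h22, he]
      module
    have hk' : LinearIndependent F ![k₁', k₂' - (f' / a) • k₁'] :=
      LinearIndependent.pair_iff.2 fun s t h => by
        obtain ⟨h1, h2⟩ := LinearIndependent.pair_iff.1 hk (s - t * (f' / a)) t
          (by rw [← h]; module)
        exact ⟨by simpa [h2] using h1, h2⟩
    have hπ : π (k₂' - (f' / a) • k₁') = 0 := by simp [hk₁', hk₂']
    have hkk' : ω k₁' (k₂' - (f' / a) • k₁') = ω k₁ k₂ := by simp [halt, hkk]
    have hc : c ≠ 0 := by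
      rintro rfl
      refine honto hπ (hk'.ne_zero 1) (ω k₁ k₂) fun u => ?_
      obtain ⟨x, y, s, t, rfl⟩ := hspan u
      refine ⟨-x - y * (f' / a) + s * (f - f' / a * b) + t * (d - f' / a * e), ?_⟩
      have e1 := linear_bracket_swap halt k₁' (k₂' - (f' / a) • k₁')
      have e2 : ω (k₂' - (f' / a) • k₁') k₂' = -((f' / a) • ω k₁ k₂) := by
        simp [halt, hkk]
      simp only [map_add, map_smul, h21', h22', e1, e2, hkk']
      module
    exact hno (hasLinearAut_of_normal_form two halt hV hW hk' (by rwa [hkk']) hk₁' hπ hv₁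
      (by rw [hkk', hv₂]) ha hc (by rw [h11, hkk']) (by rw [h22', hkk']) rfl (by rw [he, hkk'])
      (by rw [h21', hkk']) (by rw [hvv, hkk']))
  obtain ⟨p, e, h12⟩ := hcoord (ω k₁ v₂)
  obtain ⟨c, d, h22⟩ := hcoord (ω k₂ v₂)
  by_cases hp : p = 0
  · exact main k₁ k₂ hk₁ hk₂ hf' rfl ⟨e, by rw [h12, hp]; module⟩
  · refine main (k₂ - (c / p) • k₁) (-k₁) ?_ ?_ (LinearIndependent.pair_iff.2 fun s t h => ?_) ?_
      ⟨d - c / p * e, ?_⟩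
    · rw [map_sub, map_smul, hk₁, hk₂, smul_zero, sub_zero]
    · rw [map_neg, hk₁, neg_zero]
    · obtain ⟨h1, h2⟩ := LinearIndependent.pair_iff.1 hf' (-t - s * (c / p)) s
        (by rw [← h]; module)
      exact ⟨h2, by simpa [h2] using h1⟩
    · simp [halt, linear_bracket_swap halt k₁ k₂]
    · simp only [map_sub, map_smul, LinearMap.sub_apply, LinearMap.smul_apply, h12, h22]
      match_scalars <;> field_simp
      ring

end LinearAlgebra

theorem mem_zmultiples_of_addOrderOf_dvd {A : Type*} [AddGroup A] [Finite A] [IsAddCyclic A]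
    {a b : A} (h : addOrderOf a ∣ addOrderOf b) : a ∈ AddSubgroup.zmultiples b := by
  classical
  cases nonempty_fintype A
  have hb : 0 < addOrderOf b := addOrderOf_pos b
  have hsub : (AddSubgroup.zmultiples b : Set A).toFinset ⊆
      {x : A | addOrderOf b • x = 0}.toFinset := by
    intro x hx
    simp only [Set.mem_toFinset, SetLike.mem_coe, Set.mem_ofPred_eq] at hx ⊢
    exact addOrderOf_dvd_iff_nsmul_eq_zero.1 (addOrderOf_dvd_of_mem_zmultiples hx)
  have heq := Finset.eq_of_subset_of_card_le hsub (by
    have h1 := IsAddCyclic.card_nsmul_eq_zero_le (α := A) hb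
    have h2 : (AddSubgroup.zmultiples b : Set A).toFinset.card = addOrderOf b := by
      rw [Set.toFinset_card, ← Nat.card_eq_fintype_card]
      exact Nat.card_zmultiples b
    rw [h2]
    convert h1 using 2
    ext; simp)
  have ha : a ∈ {x : A | addOrderOf b • x = 0}.toFinset := by
    simpa using addOrderOf_dvd_iff_nsmul_eq_zero.1 h
  rw [← heq] at ha
  simpa using ha

theorem mem_zmultiples_of_isAddCyclic {A : Type*} [AddGroup A] [Finite A] (Z : AddSubgroup A)
    [IsAddCyclic Z] {a b : A} (ha : a ∈ Z) (hb : b ∈ Z) (h : addOrderOf a ∣ addOrderOf b) :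
    a ∈ AddSubgroup.zmultiples b := by
  obtain ⟨k, hk⟩ := AddSubgroup.mem_zmultiples_iff.1 (mem_zmultiples_of_addOrderOf_dvd
    (a := (⟨a, ha⟩ : Z)) (b := ⟨b, hb⟩) (by simpa [← AddSubgroup.addOrderOf_coe] using h))
  exact AddSubgroup.mem_zmultiples_iff.2 ⟨k, congrArg Subtype.val hk⟩

section PLieRing

variable {p n : ℕ} {L : Type*} [AddCommGroup L] [Finite L] {B : L →+ L →+ L}

omit [Finite L] in
theorem addOrderOf_dvd_of_le (hp : p.Prime) (hcard : Nat.card L = p ^ n) {a b : L}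
    (h : addOrderOf a ≤ addOrderOf b) : addOrderOf a ∣ addOrderOf b := by
  obtain ⟨i, -, hi⟩ := (Nat.dvd_prime_pow hp).1 (hcard ▸ addOrderOf_dvd_natCard a)
  obtain ⟨j, -, hj⟩ := (Nat.dvd_prime_pow hp).1 (hcard ▸ addOrderOf_dvd_natCard b)
  rw [hi, hj] at h ⊢
  exact pow_dvd_pow p ((Nat.pow_le_pow_iff_right hp.one_lt).1 h)

omit [Finite L] in
theorem mem_ker_of_bracket (hnil : ∀ x y z, B (B x y) z = 0) (x y : L) : B x y ∈ B.ker :=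
  AddMonoidHom.ext fun z => hnil x y z

theorem hasNoncentralAut_of_isAddCyclic_ker (hp : p.Prime) (hcard : Nat.card L = p ^ n)
    (halt : ∀ x, B x x = 0) (hnil : ∀ x y z, B (B x y) z = 0) (hB : B ≠ 0)
    [IsAddCyclic B.ker] : HasNoncentralAut B := by
  obtain ⟨⟨x, y⟩, hmax⟩ := Finite.exists_max fun q : L × L => addOrderOf (B q.1 q.2)
  have hmem (u v : L) : B u v ∈ AddSubgroup.zmultiples (B x y) :=
    mem_zmultiples_of_isAddCyclic B.ker (mem_ker_of_bracket hnil u v)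
      (mem_ker_of_bracket hnil x y) (addOrderOf_dvd_of_le hp hcard (hmax (u, v)))
  have hw0 : B x y ≠ 0 := by
    intro h0
    refine hB (AddMonoidHom.ext fun u => AddMonoidHom.ext fun v => ?_)
    have := hmem u v
    rwa [h0, AddSubgroup.zmultiples_zero_eq_bot, AddSubgroup.mem_bot] at this
  have hker (u : L) : addOrderOf (B x y) • u ∈ B.ker := AddMonoidHom.ext fun v => by
    rw [map_nsmul, AddMonoidHom.nsmul_apply, AddMonoidHom.zero_apply]
    exact addOrderOf_dvd_iff_nsmul_eq_zero.1 (addOrderOf_dvd_of_mem_zmultiples (hmem u v))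
  have main (x y : L) (hmem : ∀ u v, B u v ∈ AddSubgroup.zmultiples (B x y)) (hw0 : B x y ≠ 0)
      (h : addOrderOf (B x y) • x ∈ AddSubgroup.zmultiples (addOrderOf (B x y) • y)) :
      HasNoncentralAut B := by
    obtain ⟨m, hm⟩ := AddSubgroup.mem_zmultiples_iff.1 h
    have hw : B (x - m • y) y = B x y := by simp [halt]
    refine hasNoncentralAut_of_bracket_mem_zmultiples halt hnil hw hw0 (fun v => hmem _ v)
      fun k hk => ?_
    obtain ⟨j, rfl⟩ := addOrderOf_dvd_iff_zsmul_eq_zero.2 hk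
    have h0 : addOrderOf (B x y) • (x - m • y) = 0 := by
      rw [smul_sub, ← hm, smul_comm, sub_self]
    rw [mul_comm, mul_smul, natCast_zsmul, h0, smul_zero]
  rcases le_total (addOrderOf (addOrderOf (B x y) • x)) (addOrderOf (addOrderOf (B x y) • y))
    with h | h
  · exact main x y hmem hw0 (mem_zmultiples_of_isAddCyclic B.ker (hker x) (hker y)
      (addOrderOf_dvd_of_le hp hcard h))
  · have hyx : B y x = -B x y := bracket_swap halt x y
    refine main y x (fun u v => ?_) ?_ ?_
    · rw [hyx, AddSubgroup.zmultiples_neg]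
      exact hmem u v
    · rwa [hyx, neg_ne_zero]
    · rw [hyx, addOrderOf_neg]
      exact mem_zmultiples_of_isAddCyclic B.ker (hker y) (hker x)
        (addOrderOf_dvd_of_le hp hcard h)
omit [Finite L] in
theorem exists_card_addSubgroup_eq_pow (hp : p.Prime) (hcard : Nat.card L = p ^ n)
    (S : AddSubgroup L) : ∃ k, Nat.card S = p ^ k := by
  obtain ⟨k, -, hk⟩ := (Nat.dvd_prime_pow hp).1 (hcard ▸ S.card_addSubgroup_dvd_card)
  exact ⟨k, hk⟩

theorem nsmul_bracket_eq_zero (hp : p.Prime) (hcard : Nat.card L = p ^ n) (hn : n ≤ 6)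
    (halt : ∀ x, B x x = 0) (hnil : ∀ x y z, B (B x y) z = 0) (hno : ¬ IsAddCyclic B.ker)
    (x y : L) : p • B x y = 0 := by
  by_contra hw
  set w := B x y with hwxy
  obtain ⟨k, hk⟩ := exists_card_addSubgroup_eq_pow hp hcard (AddSubgroup.zmultiples w)
  obtain ⟨z, hz⟩ := exists_card_addSubgroup_eq_pow hp hcard B.ker
  have hwk : addOrderOf w = p ^ k := by rw [← Nat.card_zmultiples, hk]
  have hk2 : 2 ≤ k := by
    by_contra! h
    refine hw (addOrderOf_dvd_iff_nsmul_eq_zero.1 ?_)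
    rw [hwk]
    exact (pow_dvd_pow p (by omega : k ≤ 1)).trans (by simp)
  have hle : AddSubgroup.zmultiples w ≤ B.ker :=
    AddSubgroup.zmultiples_le.2 (mem_ker_of_bracket hnil x y)
  have hzk : k ≤ z := by
    have := AddSubgroup.card_le_of_le hle
    rwa [hk, hz, Nat.pow_le_pow_iff_right hp.one_lt] at this
  let f : L →+ L × L := (B x).prod (B y)
  have hker : B.ker ≤ f.ker := fun l hl => by
    have hl : B l = 0 := hl
    simp [f, AddMonoidHom.mem_ker, bracket_swap halt l, hl]
  have hran : (AddSubgroup.zmultiples w).prod (AddSubgroup.zmultiples w) ≤ f.range := by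
    rintro ⟨-, -⟩ ⟨⟨i, rfl⟩, ⟨j, rfl⟩⟩
    refine ⟨i • y - j • x, ?_⟩
    simp [f, halt, bracket_swap halt x y, ← hwxy]
  have h1 := AddSubgroup.card_le_of_le hker
  have h2 := AddSubgroup.card_le_of_le hran
  rw [Nat.card_congr (AddSubgroup.prodEquiv _ _).toEquiv, Nat.card_prod, hk] at h2
  have h3 := f.ker.card_mul_index
  rw [AddSubgroup.index_ker, hcard] at h3
  have h4 : p ^ (z + (k + k)) ≤ p ^ n := by
    rw [← h3, pow_add, pow_add, ← hz]
    exact Nat.mul_le_mul h1 h2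
  rw [Nat.pow_le_pow_iff_right hp.one_lt] at h4
  have heq : AddSubgroup.zmultiples w = B.ker := AddSubgroup.eq_of_le_of_card_ge hle (by
    rw [hk, hz, Nat.pow_le_pow_iff_right hp.one_lt]
    omega)
  exact hno (heq ▸ inferInstance)

end PLieRing

theorem exists_isCompl_zmultiples {p a : ℕ} (hp : p.Prime) {L : Type*} [AddCommGroup L] [Finite L]
    {M T : AddSubgroup L} {x : L} (hx : addOrderOf x = p ^ (a + 1)) (hpx : p • x ∈ M)
    (hMx : ∀ l, ∃ i : ℤ, l - i • x ∈ M) (hTM : T ≤ M) (hT : ∀ m ∈ M, p ^ a • m ∈ T)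
    (hxT : p ^ a • x ∉ T) :
    ∃ C : AddSubgroup L, T ≤ C ∧ C ≤ M ∧ IsCompl C (AddSubgroup.zmultiples x) := by
  obtain ⟨χ, hχ⟩ := AddChar.exists_apply_ne_zero.2
    (mt (QuotientAddGroup.eq_zero_iff (N := T) (p ^ a • x)).1 hxT)
  let ψ : AddChar L ℂ := χ.compAddMonoidHom (QuotientAddGroup.mk' T)
  have hψT : ∀ t ∈ T, ψ t = 1 := fun t ht => by
    change χ (t : L ⧸ T) = 1
    rw [(QuotientAddGroup.eq_zero_iff t).2 ht, AddChar.map_zero_eq_one]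
  have hψx : ψ x ^ p ^ a ≠ 1 := by
    rw [← AddChar.map_nsmul_eq_pow]
    exact hχ
  have : Fact p.Prime := ⟨hp⟩
  have hord : orderOf (ψ x) = p ^ (a + 1) := by
    refine orderOf_eq_prime_pow hψx ?_
    rw [← AddChar.map_nsmul_eq_pow, ← hx, addOrderOf_nsmul_eq_zero, AddChar.map_zero_eq_one]
  have hprim : IsPrimitiveRoot (ψ (p • x)) (p ^ a) := by
    rw [AddChar.map_nsmul_eq_pow]
    exact (hord ▸ IsPrimitiveRoot.orderOf (ψ x)).pow (pow_pos hp.pos _) (pow_succ' p a)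
  let C : AddSubgroup L :=
    { carrier := {m | m ∈ M ∧ ψ m = 1}
      zero_mem' := ⟨M.zero_mem, ψ.map_zero_eq_one⟩
      add_mem' := fun hm hl => ⟨M.add_mem hm.1 hl.1, by
        rw [AddChar.map_add_eq_mul, hm.2, hl.2, one_mul]⟩
      neg_mem' := fun hm => ⟨M.neg_mem hm.1, by
        rw [AddChar.map_neg_eq_inv, hm.2, inv_one]⟩ }
  refine ⟨C, fun t ht => ⟨hTM ht, hψT t ht⟩, fun m hm => hm.1, ?_, ?_⟩
  · rw [AddSubgroup.disjoint_def]
    rintro _ hm hmx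
    obtain ⟨i, rfl⟩ := mem_multiples_iff_mem_zmultiples.2 hmx
    have h1 : ψ x ^ i = 1 := by
      rw [← AddChar.map_nsmul_eq_pow]
      exact hm.2
    rw [← orderOf_dvd_iff_pow_eq_one, hord, ← hx] at h1
    exact addOrderOf_dvd_iff_nsmul_eq_zero.1 h1
  · rw [codisjoint_iff, eq_top_iff]
    rintro l -
    obtain ⟨i, hi⟩ := hMx l
    have : NeZero (p ^ a) := ⟨(pow_pos hp.pos _).ne'⟩
    obtain ⟨k, -, hk⟩ := hprim.eq_pow_of_pow_eq_one (ξ := ψ (l - i • x)) (by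
      rw [← AddChar.map_nsmul_eq_pow]
      exact hψT _ (hT _ hi))
    have hmem : l - i • x - k • p • x ∈ C := by
      refine ⟨M.sub_mem hi (M.nsmul_mem hpx k), ?_⟩
      rw [AddChar.map_sub_eq_div, AddChar.map_nsmul_eq_pow _ k, hk]
      exact div_self (ψ.val_isUnit _).ne_zero
    have hx' := AddSubgroup.mem_zmultiples x
    rw [show l = (l - i • x - k • p • x) + (i • x + k • p • x) by abel]
    exact AddSubgroup.add_mem_sup hmem
      (AddSubgroup.add_mem _ (AddSubgroup.zsmul_mem _ hx' i)
        (AddSubgroup.nsmul_mem _ (AddSubgroup.nsmul_mem _ hx' p) k))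

theorem hasNoncentralAut_of_isCompl_addSubgroup {L : Type*} [AddCommGroup L] [Finite L]
    {B : L →+ L →+ L} (hodd : Odd (Nat.card L)) (halt : ∀ x, B x x = 0) (M C : AddSubgroup L)
    (h : IsCompl M C) (hM : ∀ x ∈ M, ∀ y ∈ M, B x y = 0) (hC : ∀ x ∈ C, ∀ y ∈ C, B x y = 0)
    (hMC : ∀ x ∈ M, ∀ y, B x y ∈ M) (hne : ∃ x ∈ M, ∃ y, B x y ≠ 0) : HasNoncentralAut B :=
  hasNoncentralAut_of_isCompl hodd halt (AddSubgroup.toIntSubmodule M)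
    (AddSubgroup.toIntSubmodule C) (AddSubgroup.toIntSubmodule.isCompl h) hM hC hMC hne

section PLieRing

variable {p n : ℕ} {L : Type*} [AddCommGroup L] [Finite L] {B : L →+ L →+ L}

theorem hasNoncentralAut_of_rank_two (hp : p.Prime) (hodd : Odd p) (hcard : Nat.card L = p ^ n)
    (halt : ∀ x, B x x = 0) (hnil : ∀ x y z, B (B x y) z = 0) (hpB : ∀ x y, p • B x y = 0)
    (hB : B ≠ 0)
    (hr : ∀ x y, B x y ≠ 0 → ∀ l, ∃ i j : ℤ, B (l - (i • x + j • y)) = 0) :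
    HasNoncentralAut B := by
  have hoddL : Odd (Nat.card L) := hcard ▸ hodd.pow
  have hexp : ∀ x y, B x y ≠ 0 → ∀ l, ∃ i j : ℤ, (∀ k, B l k = i • B x k + j • B y k) ∧
      B (l - (i • x + j • y)) = 0 := fun x y hxy l => by
    obtain ⟨i, j, h⟩ := hr x y hxy l
    refine ⟨i, j, fun k => ?_, h⟩
    have := DFunLike.congr_fun h k
    rw [map_sub, AddMonoidHom.sub_apply, AddMonoidHom.zero_apply, sub_eq_zero] at this
    simpa using this
  have hspan : ∀ x y, B x y ≠ 0 → ∀ k l, B k l ∈ AddSubgroup.zmultiples (B x y) := by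
    intro x y hxy k l
    obtain ⟨i, j, h, -⟩ := hexp x y hxy k
    obtain ⟨i', j', h', -⟩ := hexp x y hxy l
    rw [h, bracket_swap halt l x, bracket_swap halt l y, h', h', halt, halt,
      bracket_swap halt x y]
    refine ⟨i * j' - j * i', ?_⟩
    module
  have hcentral : ∀ x y l, B (B x y) l = 0 ∧ B l (B x y) = 0 := fun x y l => by
    simp [bracket_swap halt (B x y) l, hnil]
  -- the centralizer of a noncentral element, together with a suitable cyclic complement
  have hcompl : ∀ x y, B x y ≠ 0 → ∀ a, addOrderOf x = p ^ (a + 1) → ∀ S : AddSubgroup L,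
      S ≤ (B y).ker → (∀ s ∈ S, ∀ m, B y m = 0 → p ^ a • x ≠ s + p ^ a • m) →
      ∃ C : AddSubgroup L, S ≤ C ∧ IsCompl C (AddSubgroup.zmultiples x) ∧
        ∀ k ∈ C, ∀ l ∈ C, B k l = 0 := by
    intro x y hxy a ha S hS hSx
    obtain ⟨C, hTC, hCM, hC⟩ := exists_isCompl_zmultiples hp (M := (B y).ker)
      (T := S ⊔ (B y).ker.map (nsmulAddMonoidHom (p ^ a))) ha
      (by rw [AddMonoidHom.mem_ker, map_nsmul, hpB])
      (fun l => by
        obtain ⟨i, j, -, h⟩ := hexp x y hxy l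
        refine ⟨i, ?_⟩
        have h2 := bracket_swap halt y (l - (i • x + j • y))
        rw [h, AddMonoidHom.zero_apply, zero_eq_neg] at h2
        rw [AddMonoidHom.mem_ker]
        simpa [halt, sub_add_eq_sub_sub] using h2)
      (sup_le hS (by
        rintro - ⟨m, hm, rfl⟩
        rw [AddMonoidHom.mem_ker, nsmulAddMonoidHom_apply, map_nsmul, (B y).mem_ker.1 hm,
          smul_zero]))
      (fun m hm => AddSubgroup.mem_sup_right ⟨m, hm, rfl⟩)
      (fun h => by
        obtain ⟨s, hs, -, ⟨m, hm, rfl⟩, hsm⟩ := AddSubgroup.mem_sup.1 h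
        exact hSx s hs m hm hsm.symm)
    refine ⟨C, le_sup_left.trans hTC, hC, fun k hk l hl => ?_⟩
    have hk' : B y k = 0 := hCM hk
    have hl' : B y l = 0 := hCM hl
    obtain ⟨i, j, h, -⟩ := hexp x y hxy k
    obtain ⟨i', j', h', -⟩ := hexp x y hxy l
    have h1 : i • B x y = 0 := by
      have := h y
      rwa [bracket_swap halt y k, hk', halt, smul_zero, neg_zero, add_zero, eq_comm] at this
    rw [h, hl', bracket_swap halt l x, h', halt, bracket_swap halt x y]
    linear_combination (norm := module) j' • h1
  obtain ⟨x₀, hx₀⟩ : ∃ x, B x ≠ 0 := by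
    by_contra! h
    exact hB (AddMonoidHom.ext h)
  obtain ⟨x₁, hx₁, hmin₁⟩ :=
    Set.exists_min_image {x | B x ≠ 0} addOrderOf (Set.toFinite _) ⟨x₀, hx₀⟩
  have hpow : ∀ x, B x ≠ 0 → ∃ a, addOrderOf x = p ^ (a + 1) := fun x hx => by
    obtain ⟨k, hk⟩ := exists_card_addSubgroup_eq_pow hp hcard (AddSubgroup.zmultiples x)
    rw [Nat.card_zmultiples] at hk
    rcases k with - | k
    · rw [pow_zero, AddMonoid.addOrderOf_eq_one_iff] at hk
      exact absurd (by rw [hk, map_zero]) hx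
    · exact ⟨k, hk⟩
  have hex : ∀ x, B x ≠ 0 → ∃ y, B x y ≠ 0 := fun x hx => by
    by_contra! h
    exact hx (AddMonoidHom.ext h)
  by_cases hA : ∃ x, B x ≠ 0 ∧ (∀ x', B x' ≠ 0 → addOrderOf x ≤ addOrderOf x') ∧
      ∀ k l, B k l ∈ AddSubgroup.zmultiples x
  · obtain ⟨x, hx, hmin, hcyc⟩ := hA
    obtain ⟨a, ha⟩ := hpow x hx
    obtain ⟨y, hxy⟩ := hex x hx
    obtain ⟨C, -, hC, habel⟩ := hcompl x y hxy a ha ⊥ bot_le (by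
      rintro s hs m hm h
      rw [AddSubgroup.mem_bot.1 hs, zero_add, ← sub_eq_zero, ← smul_sub] at h
      have hne : B (x - m) ≠ 0 := fun h0 => hxy (by
        have := DFunLike.congr_fun h0 y
        simpa [bracket_swap halt y m, hm] using this)
      have h1 := Nat.le_of_dvd (pow_pos hp.pos _) (addOrderOf_dvd_of_nsmul_eq_zero h)
      have h2 := (hmin _ hne).trans h1
      rw [ha, Nat.pow_le_pow_iff_right hp.one_lt] at h2
      omega)
    refine hasNoncentralAut_of_isCompl_addSubgroup hoddL halt _ C hC.symm ?_ habel
      (fun k _ l => hcyc k l) ⟨x, AddSubgroup.mem_zmultiples x, y, hxy⟩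
    rintro - ⟨i, rfl⟩ - ⟨j, rfl⟩
    simp [halt]
  · have hx : B x₁ ≠ 0 := hx₁
    obtain ⟨a, ha⟩ := hpow x₁ hx
    obtain ⟨y, hxy⟩ := hex x₁ hx
    obtain ⟨C, hSC, hC, habel⟩ := hcompl x₁ y hxy a ha (AddSubgroup.zmultiples (B x₁ y))
      (AddSubgroup.zmultiples_le.2 (hcentral x₁ y y).2) (by
        rintro - ⟨j, rfl⟩ m hm h
        beta_reduce at h
        rw [← sub_eq_iff_eq_add, ← smul_sub] at h
        have hBu : B (x₁ - m) y = B x₁ y := by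
          simp [bracket_swap halt y m, hm]
        have hne : B (x₁ - m) ≠ 0 := fun h0 => hxy (by
          rw [← hBu, h0, AddMonoidHom.zero_apply])
        have hle : addOrderOf (x₁ - m) ≤ addOrderOf x₁ := by
          refine Nat.le_of_dvd (addOrderOf_pos x₁) (addOrderOf_dvd_of_nsmul_eq_zero ?_)
          rw [ha, pow_succ', mul_smul, h, smul_comm, hpB, smul_zero]
        have hj : j • B x₁ y ≠ 0 := fun h0 => by
          rw [h0] at h
          have h1 := Nat.le_of_dvd (pow_pos hp.pos _) (addOrderOf_dvd_of_nsmul_eq_zero h)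
          have h2 := (hmin₁ _ hne).trans h1
          rw [ha, Nat.pow_le_pow_iff_right hp.one_lt] at h2
          omega
        refine hA ⟨x₁ - m, hne, fun x' hx' => hle.trans (hmin₁ x' hx'), fun k l => ?_⟩
        have hle' : B x₁ y ∈ AddSubgroup.zmultiples (x₁ - m) := by
          have hcop : IsCoprime (p : ℤ) j := by
            rw [(Nat.prime_iff_prime_int.1 hp).coprime_iff_not_dvd]
            rintro ⟨c, rfl⟩
            exact hj (by rw [mul_comm, mul_smul, natCast_zsmul, hpB, smul_zero])
          obtain ⟨s, t, hst⟩ := hcop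
          refine ⟨t * (p ^ a : ℕ), ?_⟩
          beta_reduce
          rw [mul_smul, natCast_zsmul, h, ← mul_smul]
          have : (1 - s * p : ℤ) • B x₁ y = B x₁ y := by
            rw [sub_smul, one_smul, mul_smul, natCast_zsmul, hpB, smul_zero, sub_zero]
          rw [← this]
          congr 1
          linarith
        exact AddSubgroup.zmultiples_le.2 hle' (hspan x₁ y hxy k l))
    refine hasNoncentralAut_of_isCompl_addSubgroup hoddL halt C _ hC habel ?_
      (fun k _ l => hSC (hspan x₁ y hxy k l)) ?_
    · rintro - ⟨i, rfl⟩ - ⟨j, rfl⟩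
      simp [halt]
    · obtain ⟨c, hc, -, ⟨i, rfl⟩, hci⟩ := AddSubgroup.mem_sup.1
        (hC.sup_eq_top ▸ AddSubgroup.mem_top y)
      refine ⟨c, hc, x₁, ?_⟩
      have : B c x₁ = -B x₁ y := by
        rw [← bracket_swap halt x₁ y, ← hci]
        simp [halt]
      rwa [this, neg_ne_zero]

end PLieRing

section LinearModel

universe u

variable {p : ℕ} {L : Type u} [AddCommGroup L] {B : L →+ L →+ L}

theorem exists_addMonoidHom_factor {L V W X : Type*} [AddCommGroup L] [AddCommGroup V]
    [AddCommGroup W] [AddCommGroup X] {q : L →+ V} {ι : W →+ X} (hq : Function.Surjective q)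
    (hι : Function.Injective ι) (f : L →+ X) (hker : ∀ x, q x = 0 → f x = 0)
    (hran : ∀ x, ∃ z, ι z = f x) : ∃ g : V →+ W, ∀ x, ι (g (q x)) = f x := by
  choose s hs using hq
  choose t ht using hran
  have key : ∀ x, ι (t (s (q x))) = f x := fun x => by
    rw [ht, ← sub_eq_zero, ← map_sub]
    exact hker _ (by rw [map_sub, hs, sub_self])
  refine ⟨AddMonoidHom.mk' (fun v => t (s v)) fun u v => hι ?_, key⟩
  rw [map_add, ← hs u, ← hs v, ← map_add, key, key, key, map_add]

theorem exists_linearMap_factor {V W X : Type*} [AddCommGroup V] [AddCommGroup W]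
    [AddCommGroup X] [Module (ZMod p) V] [Module (ZMod p) W] {q : L →+ V} {ι : W →+ X}
    (hq : Function.Surjective q) (hι : Function.Injective ι) (f : L →+ X)
    (hker : ∀ x, q x = 0 → f x = 0) (hran : ∀ x, ∃ z, ι z = f x) :
    ∃ g : V →ₗ[ZMod p] W, ∀ x, ι (g (q x)) = f x := by
  obtain ⟨g, hg⟩ := exists_addMonoidHom_factor hq hι f hker hran
  exact ⟨g.toZModLinearMap p, hg⟩

theorem exists_bilinear_factor {V W : Type*} [AddCommGroup V] [AddCommGroup W]
    [Module (ZMod p) V] [Module (ZMod p) W] {q : L →+ V} {ι : W →+ L}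
    (hq : Function.Surjective q) (hι : Function.Injective ι) (halt : ∀ x, B x x = 0)
    (hker : ∀ x, q x = 0 → B x = 0) (hran : ∀ x y, ∃ z, ι z = B x y) :
    ∃ ω : V →ₗ[ZMod p] V →ₗ[ZMod p] W, ∀ x y, ι (ω (q x) (q y)) = B x y := by
  have h1 : ∀ x, ∃ g : V →ₗ[ZMod p] W, ∀ y, ι (g (q y)) = B x y := fun x =>
    exists_linearMap_factor hq hι (B x)
      (fun y hy => by rw [bracket_swap halt y x, hker y hy, AddMonoidHom.zero_apply, neg_zero])
      (hran x)
  choose g hg using h1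
  have hext : ∀ {h₁ h₂ : V →ₗ[ZMod p] W}, (∀ y, ι (h₁ (q y)) = ι (h₂ (q y))) → h₁ = h₂ :=
    fun h => LinearMap.ext fun v => by
      obtain ⟨y, rfl⟩ := hq v
      exact hι (h y)
  let G : L →+ (V →ₗ[ZMod p] W) := AddMonoidHom.mk' g fun x x' => hext fun y => by
    simp [hg]
  obtain ⟨ω, hω⟩ := exists_linearMap_factor (p := p) (ι := AddMonoidHom.id _) hq
    Function.injective_id G
    (fun x hx => hext fun y => by
      change ι (g x (q y)) = _
      rw [hg, hker x hx, AddMonoidHom.zero_apply, LinearMap.zero_apply, map_zero])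
    (fun x => ⟨G x, rfl⟩)
  refine ⟨ω, fun x y => ?_⟩
  rw [show ω (q x) = g x from hω x, hg]

theorem exists_linear_model (hnil : ∀ x y z, B (B x y) z = 0) (halt : ∀ x, B x x = 0)
    (hpB : ∀ x y, p • B x y = 0) :
    ∃ (V W : Type u) (_ : AddCommGroup V) (_ : AddCommGroup W) (_ : Module (ZMod p) V)
      (_ : Module (ZMod p) W) (q : L →+ V) (ι : W →+ L) (ω : V →ₗ[ZMod p] V →ₗ[ZMod p] W),
      Function.Surjective q ∧ Function.Injective ι ∧ (∀ x, q x = 0 ↔ B x = 0) ∧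
      (∀ x, (∃ z, ι z = x) ↔ B x = 0 ∧ p • x = 0) ∧ ∀ x y, ι (ω (q x) (q y)) = B x y := by
  let W : AddSubgroup L := B.ker ⊓ (nsmulAddMonoidHom p : L →+ L).ker
  have hV : ∀ v : L ⧸ B.ker, p • v = 0 := fun v => by
    obtain ⟨x, rfl⟩ := QuotientAddGroup.mk_surjective v
    rw [← QuotientAddGroup.mk_nsmul, QuotientAddGroup.eq_zero_iff]
    exact AddMonoidHom.ext fun y => by simp [hpB]
  have hW : ∀ w : W, p • w = 0 := fun w => Subtype.ext w.2.2
  let _ : Module (ZMod p) (L ⧸ B.ker) := AddCommGroup.zmodModule hV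
  let _ : Module (ZMod p) W := AddCommGroup.zmodModule hW
  have hq : ∀ x, QuotientAddGroup.mk' B.ker x = 0 ↔ B x = 0 := fun x =>
    QuotientAddGroup.eq_zero_iff x
  have hran : ∀ x, (∃ z, W.subtype z = x) ↔ B x = 0 ∧ p • x = 0 := fun x =>
    ⟨fun ⟨z, hz⟩ => hz ▸ z.2, fun h => ⟨⟨x, h⟩, rfl⟩⟩
  obtain ⟨ω, hω⟩ := exists_bilinear_factor (p := p) (QuotientAddGroup.mk'_surjective B.ker)
    W.subtype_injective halt (fun x => (hq x).1)
    (fun x y => (hran _).2 ⟨AddMonoidHom.ext fun z => hnil x y z, hpB x y⟩)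
  exact ⟨L ⧸ B.ker, W, _, _, _, _, _, _, ω, QuotientAddGroup.mk'_surjective B.ker,
    W.subtype_injective, hq, hran, hω⟩

end LinearModel

theorem ZMod.two_ne_zero_of_odd {p : ℕ} [Fact p.Prime] (hodd : Odd p) : (2 : ZMod p) ≠ 0 := by
  intro h
  have h2 : ((2 : ℕ) : ZMod p) = 0 := by exact_mod_cast h
  rw [ZMod.natCast_eq_zero_iff, Nat.prime_dvd_prime_iff_eq Fact.out Nat.prime_two] at h2
  subst h2
  exact absurd hodd (by decide)

/-- `V` is a model of `L` modulo the centre of the bracket `B`, and `W` one of the `p`-torsion of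
the centre, in which the bracket becomes the bilinear map `ω`. -/
structure IsLinearModel {p : ℕ} {L V W : Type*} [AddCommGroup L] [AddCommGroup V]
    [AddCommGroup W] [Module (ZMod p) V] [Module (ZMod p) W] (B : L →+ L →+ L) (q : L →+ V)
    (ι : W →+ L) (ω : V →ₗ[ZMod p] V →ₗ[ZMod p] W) : Prop where
  surjective : Function.Surjective q
  injective : Function.Injective ι
  map_eq_zero_iff : ∀ x, q x = 0 ↔ B x = 0
  exists_eq_iff : ∀ x, (∃ z, ι z = x) ↔ B x = 0 ∧ p • x = 0
  map_bracket : ∀ x y, ι (ω (q x) (q y)) = B x y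

namespace IsLinearModel

variable {p n z : ℕ} {L V W : Type*} [AddCommGroup L] [AddCommGroup V] [AddCommGroup W]
  [Module (ZMod p) V] [Module (ZMod p) W] {B : L →+ L →+ L} {q : L →+ V} {ι : W →+ L}
  {ω : V →ₗ[ZMod p] V →ₗ[ZMod p] W}

theorem nsmul_bracket (hm : IsLinearModel B q ι ω) (x y : L) : p • B x y = 0 :=
  ((hm.exists_eq_iff _).1 ⟨_, hm.map_bracket x y⟩).2

theorem form_self (hm : IsLinearModel B q ι ω) (halt : ∀ x, B x x = 0) (v : V) : ω v v = 0 := by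
  obtain ⟨x, rfl⟩ := hm.surjective v
  exact hm.injective (by rw [hm.map_bracket, halt, map_zero])

theorem eq_zero_of_form_eq_zero (hm : IsLinearModel B q ι ω) (v : V) (hv : ω v = 0) : v = 0 := by
  obtain ⟨x, rfl⟩ := hm.surjective v
  refine (hm.map_eq_zero_iff x).2 (AddMonoidHom.ext fun y => ?_)
  rw [← hm.map_bracket, hv, LinearMap.zero_apply, map_zero, AddMonoidHom.zero_apply]

theorem bracket_nsmul_eq_zero (hm : IsLinearModel B q ι ω) (x : L) : B (p • x) = 0 :=
  AddMonoidHom.ext fun y => by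
    rw [map_nsmul, AddMonoidHom.nsmul_apply, hm.nsmul_bracket, AddMonoidHom.zero_apply]

theorem exists_powerMap (hm : IsLinearModel B q ι ω) (hZ : ∀ x, B x = 0 → p • x = 0) :
    ∃ π : V →ₗ[ZMod p] W, ∀ x, ι (π (q x)) = p • x :=
  exists_linearMap_factor hm.surjective hm.injective (nsmulAddMonoidHom p)
    (fun x hx => hZ x ((hm.map_eq_zero_iff x).1 hx))
    (fun x => (hm.exists_eq_iff _).2
      ⟨hm.bracket_nsmul_eq_zero x, hZ _ (hm.bracket_nsmul_eq_zero x)⟩)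

theorem hasNoncentralAut [Fact p.Prime] [FiniteDimensional (ZMod p) V]
    (hm : IsLinearModel B q ι ω) (hnil : ∀ x y z, B (B x y) z = 0)
    (hZ : ∀ x, B x = 0 → p • x = 0) {π : V →ₗ[ZMod p] W} (hπ : ∀ x, ι (π (q x)) = p • x)
    (h : HasLinearAut ω π) : HasNoncentralAut B :=
  h.hasNoncentralAut hnil hm.surjective hm.injective
    (fun x => (hm.map_eq_zero_iff x).trans DFunLike.ext_iff)
    (fun x => by
      rw [hm.map_eq_zero_iff, hm.exists_eq_iff]
      exact ⟨fun hx => ⟨hx, hZ x hx⟩, And.left⟩)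
    hm.map_bracket hπ

theorem finite_left [Finite L] (hm : IsLinearModel B q ι ω) : Finite V :=
  Finite.of_surjective q hm.surjective

theorem finite_right [Finite L] (hm : IsLinearModel B q ι ω) : Finite W :=
  Finite.of_injective ι hm.injective

theorem range_le (hm : IsLinearModel B q ι ω) : ι.range ≤ B.ker := by
  rintro x hx
  exact ((hm.exists_eq_iff x).1 hx).1

section Card

variable [Fact p.Prime] [Finite L]

theorem finrank_add (hm : IsLinearModel B q ι ω) (hcard : Nat.card L = p ^ n)
    (hz : Nat.card B.ker = p ^ z) : Module.finrank (ZMod p) V + z = n := by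
  have := hm.finite_left
  have hker : q.ker = B.ker := AddSubgroup.ext hm.map_eq_zero_iff
  have h := q.ker.card_mul_index
  rw [AddSubgroup.index_ker, AddMonoidHom.range_eq_top.2 hm.surjective, AddSubgroup.card_top,
    hker, hz, hcard, Module.natCard_eq_pow_finrank (K := ZMod p), Nat.card_zmod, ← pow_add] at h
  linarith [Nat.pow_right_injective (Fact.out : p.Prime).two_le h]

theorem card_range (hm : IsLinearModel B q ι ω) :
    Nat.card ι.range = p ^ Module.finrank (ZMod p) W := by
  have := hm.finite_right
  rw [← Nat.card_congr (AddMonoidHom.ofInjective hm.injective).toEquiv,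
    Module.natCard_eq_pow_finrank (K := ZMod p), Nat.card_zmod]

theorem finrank_le (hm : IsLinearModel B q ι ω) (hz : Nat.card B.ker = p ^ z) :
    Module.finrank (ZMod p) W ≤ z := by
  have h := AddSubgroup.card_le_of_le hm.range_le
  rwa [hm.card_range, hz, Nat.pow_le_pow_iff_right (Fact.out : p.Prime).one_lt] at h

theorem le_finrank_iff (hm : IsLinearModel B q ι ω) (hz : Nat.card B.ker = p ^ z) :
    z ≤ Module.finrank (ZMod p) W ↔ ∀ x, B x = 0 → p • x = 0 := by
  constructor
  · intro h x hx
    have heq : ι.range = B.ker := AddSubgroup.eq_of_le_of_card_ge hm.range_le (by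
      rw [hz, hm.card_range]
      exact Nat.pow_le_pow_right (Fact.out : p.Prime).pos h)
    have hx' : x ∈ ι.range := heq ▸ hx
    exact ((hm.exists_eq_iff x).1 hx').2
  · intro h
    have hle : B.ker ≤ ι.range := fun x hx => (hm.exists_eq_iff x).2 ⟨hx, h x hx⟩
    have h := AddSubgroup.card_le_of_le hle
    rwa [hm.card_range, hz, Nat.pow_le_pow_iff_right (Fact.out : p.Prime).one_lt] at h

end Card

theorem hasNoncentralAut_of_finrank_eq_four [Fact p.Prime] [Finite L]
    (hm : IsLinearModel B q ι ω) (hodd : Odd p) (halt : ∀ x, B x x = 0)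
    (hnil : ∀ x y z, B (B x y) z = 0) (hz : Nat.card B.ker = p ^ 2) (hno : ¬ IsAddCyclic B.ker)
    (hV : Module.finrank (ZMod p) V = 4) : HasNoncentralAut B := by
  have := hm.finite_left
  have hZ : ∀ x, B x = 0 → p • x = 0 := fun x hx => by
    have hdvd : addOrderOf (⟨x, hx⟩ : B.ker) ∣ p ^ 2 := hz ▸ addOrderOf_dvd_natCard _
    obtain ⟨k, hk, hk'⟩ := (Nat.dvd_prime_pow Fact.out).1 hdvd
    have hk2 : k ≠ 2 := fun h => hno
      (isAddCyclic_of_addOrderOf_eq_card (⟨x, hx⟩ : B.ker) (by rw [hk', h, hz]))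
    have h1 : addOrderOf (⟨x, hx⟩ : B.ker) ∣ p := by
      rw [hk']
      exact (pow_dvd_pow p (by omega : k ≤ 1)).trans (by simp)
    exact congrArg Subtype.val (addOrderOf_dvd_iff_nsmul_eq_zero.1 h1)
  obtain ⟨π, hπ⟩ := hm.exists_powerMap hZ
  exact hm.hasNoncentralAut hnil hZ hπ (_root_.hasLinearAut_of_finrank_eq_four
    (ZMod.two_ne_zero_of_odd hodd) (hm.form_self halt) hV
    (le_antisymm (hm.finrank_le hz) ((hm.le_finrank_iff hz).2 hZ))
    hm.eq_zero_of_form_eq_zero)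

theorem hasNoncentralAut_of_finrank_eq_two [Fact p.Prime] [Finite L]
    (hm : IsLinearModel B q ι ω) (hodd : Odd p) (halt : ∀ x, B x x = 0)
    (hnil : ∀ x y z, B (B x y) z = 0) (hcard : Nat.card L = p ^ n) (hB : B ≠ 0)
    (hV : Module.finrank (ZMod p) V = 2) : HasNoncentralAut B := by
  have := hm.finite_left
  have alt := hm.form_self halt
  refine hasNoncentralAut_of_rank_two Fact.out hodd hcard halt hnil hm.nsmul_bracket hB
    fun x y hxy l => ?_
  have hne : ω (q x) (q y) ≠ 0 := fun h => hxy (by rw [← hm.map_bracket, h, map_zero])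
  have hli : LinearIndependent (ZMod p) ![q x, q y] := by
    rw [LinearIndependent.pair_iff]
    intro s t h
    have h1 := congrArg (fun v => ω v (q y)) h
    have h2 := congrArg (fun v => ω (q x) v) h
    simp only [map_add, map_smul, map_zero, LinearMap.add_apply, LinearMap.smul_apply, alt,
      LinearMap.zero_apply, smul_zero, add_zero, zero_add, smul_eq_zero, hne, or_false] at h1 h2
    exact ⟨h1, h2⟩
  let b := basisOfLinearIndependentOfCardEqFinrank hli (by simp [hV])
  obtain ⟨i, hi⟩ := ZMod.intCast_surjective (b.repr (q l) 0)
  obtain ⟨j, hj⟩ := ZMod.intCast_surjective (b.repr (q l) 1)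
  refine ⟨i, j, (hm.map_eq_zero_iff _).1 ?_⟩
  have hsum := b.sum_repr (q l)
  rw [Fin.sum_univ_two, ← hi, ← hj] at hsum
  rw [map_sub, ← hsum]
  simp [b, Int.cast_smul_eq_zsmul]

theorem dvd_of_zsmul_eq_zero [Fact p.Prime] {w : L} (hpw : p • w = 0) (hw : w ≠ 0) {m : ℤ}
    (h : m • w = 0) : (p : ℤ) ∣ m := by
  rwa [← addOrderOf_eq_prime hpw hw, addOrderOf_dvd_iff_zsmul_eq_zero]

theorem hasNoncentralAut_of_nsmul_eq_zero [Fact p.Prime] [Finite L]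
    (hm : IsLinearModel B q ι ω) (hodd : Odd (Nat.card L)) (halt : ∀ x, B x x = 0)
    (hnil : ∀ x y z, B (B x y) z = 0) {f : V →ₗ[ZMod p] ZMod p}
    (hf : ∀ u v, f u = 0 → f v = 0 → ω u v = 0) {u : L} (hu : B u ≠ 0) (hpu : p • u = 0) :
    HasNoncentralAut B := by
  have hzu : ∀ m : ℤ, (p : ℤ) ∣ m → m • u = 0 := by
    rintro - ⟨c, rfl⟩
    rw [mul_comm, mul_smul, natCast_zsmul, hpu, smul_zero]
  let g : L →+ ZMod p := f.toAddMonoidHom.comp q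
  have hg : ∀ k l, g k = 0 → g l = 0 → B k l = 0 := fun k l hk hl => by
    rw [← hm.map_bracket, hf _ _ hk hl, map_zero]
  by_cases hgu : g u = 0
  · obtain ⟨y, hy⟩ : ∃ y, B u y ≠ 0 := by
      by_contra! h
      exact hu (AddMonoidHom.ext h)
    have hgy : g y ≠ 0 := fun h => hy (hg u y hgu h)
    refine hasNoncentralAut_of_bracket_mem_zmultiples halt hnil rfl hy (fun x => ?_)
      fun m h => hzu m (dvd_of_zsmul_eq_zero (hm.nsmul_bracket u y) hy h)
    obtain ⟨t, ht⟩ := ZMod.intCast_surjective (g x / g y)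
    have h0 : g (x - t • y) = 0 := by
      rw [map_sub, map_zsmul, zsmul_eq_mul, ht, div_mul_cancel₀ _ hgy, sub_self]
    refine ⟨t, ?_⟩
    have h1 := hg u _ hgu h0
    rw [map_sub, map_zsmul, sub_eq_zero] at h1
    exact h1.symm
  · have hsplit : ∀ x, ∃ t : ℤ, g (x - t • u) = 0 := fun x => by
      obtain ⟨t, ht⟩ := ZMod.intCast_surjective (g x / g u)
      exact ⟨t, by rw [map_sub, map_zsmul, zsmul_eq_mul, ht, div_mul_cancel₀ _ hgu, sub_self]⟩
    refine hasNoncentralAut_of_isCompl_addSubgroup hodd halt g.ker (AddSubgroup.zmultiples u)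
      ⟨?_, ?_⟩ (fun k hk l hl => hg k l hk hl) ?_ (fun k _ l => ?_) ?_
    · rw [AddSubgroup.disjoint_def]
      rintro _ h ⟨t, rfl⟩
      refine hzu t ?_
      rw [AddMonoidHom.mem_ker, map_zsmul, zsmul_eq_mul, mul_eq_zero, or_iff_left hgu] at h
      exact (ZMod.intCast_zmod_eq_zero_iff_dvd t p).1 h
    · rw [codisjoint_iff, eq_top_iff]
      rintro x -
      obtain ⟨t, ht⟩ := hsplit x
      rw [← sub_add_cancel x (t • u)]
      exact AddSubgroup.add_mem_sup ht (AddSubgroup.zsmul_mem_zmultiples u t)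
    · rintro - ⟨i, rfl⟩ - ⟨j, rfl⟩
      simp [halt]
    · have hq : q (B k l) = 0 :=
        (hm.map_eq_zero_iff _).2 (AddMonoidHom.ext fun x => hnil k l x)
      change f (q (B k l)) = 0
      rw [hq, map_zero]
    · by_contra! h
      refine hu (AddMonoidHom.ext fun x => ?_)
      obtain ⟨t, ht⟩ := hsplit x
      have h1 := h _ ht u
      rw [map_sub, map_zsmul, AddMonoidHom.sub_apply, AddMonoidHom.zsmul_apply, halt, smul_zero,
        sub_zero] at h1
      rw [bracket_swap halt x u, h1, neg_zero, AddMonoidHom.zero_apply]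

theorem hasNoncentralAut_of_finrank_eq_three [Fact p.Prime] [Finite L]
    (hm : IsLinearModel B q ι ω) (hodd : Odd p) (halt : ∀ x, B x x = 0)
    (hnil : ∀ x y z, B (B x y) z = 0) (hcard : Nat.card L = p ^ n)
    (hz : Nat.card B.ker = p ^ z) (hz3 : z ≤ 3) (hV : Module.finrank (ZMod p) V = 3) :
    HasNoncentralAut B := by
  have := hm.finite_left
  have := hm.finite_right
  have alt := hm.form_self halt
  have two := ZMod.two_ne_zero_of_odd hodd
  have hfin : 3 ≤ Module.finrank (ZMod p) W → (∀ x, B x = 0 → p • x = 0) ∧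
      Module.finrank (ZMod p) W = 3 := fun h =>
    ⟨(hm.le_finrank_iff hz).1 (hz3.trans h), le_antisymm ((hm.finrank_le hz).trans hz3) h⟩
  have : Nontrivial V := Module.nontrivial_of_finrank_pos (R := ZMod p) (by omega)
  obtain ⟨v, hv⟩ := exists_ne (0 : V)
  obtain ⟨b, c, hvbc⟩ := exists_linearIndependent_triple_of_lt hV.ge hv
  by_cases hli : LinearIndependent (ZMod p) ![ω b c, ω c v, ω v b]
  · obtain ⟨hZ, hW⟩ := hfin (by simpa using hli.fintype_card_le_finrank)
    obtain ⟨π, hπ⟩ := hm.exists_powerMap hZ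
    exact hm.hasNoncentralAut hnil hZ hπ
      (hasLinearAut_of_bracket_linearIndependent two alt hV hW hvbc hli)
  obtain ⟨a', -, b', -, c', -, hk, hab⟩ := exists_commuting_of_not_linearIndependent alt ⊤
    Submodule.mem_top Submodule.mem_top Submodule.mem_top hvbc hli
  by_cases hex : ∃ u, B u ≠ 0 ∧ p • u = 0
  · obtain ⟨u, hu, hpu⟩ := hex
    let e := basisOfLinearIndependentOfCardEqFinrank hk (by simp [hV])
    have hcoord : ∀ x, e.coord 2 x = 0 → ∃ s t : ZMod p, x = s • a' + t • b' := fun x hx => by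
      have h := e.sum_repr x
      rw [Fin.sum_univ_three, ← e.coord_apply 2, hx] at h
      exact ⟨e.repr x 0, e.repr x 1, by simpa [e] using h.symm⟩
    refine hm.hasNoncentralAut_of_nsmul_eq_zero (hcard ▸ hodd.pow) halt hnil (f := e.coord 2)
      (fun x y hx hy => ?_) hu hpu
    obtain ⟨s, t, rfl⟩ := hcoord x hx
    obtain ⟨s', t', rfl⟩ := hcoord y hy
    simp [alt, hab, linear_bracket_swap alt a' b']
  · push Not at hex
    have hker : (nsmulAddMonoidHom p : L →+ L).ker ≤ ι.range := fun x hx => by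
      have hx : p • x = 0 := hx
      exact (hm.exists_eq_iff x).2 ⟨by_contra fun h => hex x h hx, hx⟩
    have hran : (nsmulAddMonoidHom p : L →+ L).range ≤ B.ker := by
      rintro - ⟨x, rfl⟩
      exact hm.bracket_nsmul_eq_zero x
    have h1 := (nsmulAddMonoidHom p : L →+ L).ker.card_mul_index
    rw [AddSubgroup.index_ker, hcard, ← hm.finrank_add hcard hz, hV] at h1
    have h2 := Nat.mul_le_mul (AddSubgroup.card_le_of_le hker) (AddSubgroup.card_le_of_le hran)
    rw [h1, hm.card_range, hz, ← pow_add, Nat.pow_le_pow_iff_right (Fact.out : p.Prime).one_lt]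
      at h2
    obtain ⟨hZ, hW⟩ := hfin (by omega)
    obtain ⟨π, hπ⟩ := hm.exists_powerMap hZ
    have hinj : Function.Injective π := by
      rw [injective_iff_map_eq_zero]
      intro v hv
      obtain ⟨x, rfl⟩ := hm.surjective v
      have hx := hπ x
      rw [hv, map_zero] at hx
      exact (hm.map_eq_zero_iff x).2 (by_contra fun h => hex x h hx.symm)
    exact hm.hasNoncentralAut hnil hZ hπ (hasLinearAut_of_bijective two alt
      ⟨hinj, (LinearMap.injective_iff_surjective_of_finrank_eq_finrank (hV.trans hW.symm)).1 hinj⟩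
      hV hk hab)

end IsLinearModel

theorem hasNoncentralAut_of_card_le {p n : ℕ} (hp : p.Prime) (hodd : Odd p) {L : Type*}
    [AddCommGroup L] {B : L →+ L →+ L} (hcard : Nat.card L = p ^ n) (hn : n ≤ 6)
    (halt : ∀ x, B x x = 0) (hnil : ∀ x y z, B (B x y) z = 0) (hB : B ≠ 0) :
    HasNoncentralAut B := by
  have : Fact p.Prime := ⟨hp⟩
  have : Finite L := Nat.finite_of_card_ne_zero (hcard ▸ (pow_pos hp.pos n).ne')
  by_cases hcyc : IsAddCyclic B.ker
  · exact hasNoncentralAut_of_isAddCyclic_ker hp hcard halt hnil hB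
  obtain ⟨V, W, _, _, _, _, q, ι, ω, h₁, h₂, h₃, h₄, h₅⟩ := exists_linear_model hnil halt
    (nsmul_bracket_eq_zero hp hcard hn halt hnil hcyc)
  have hm : IsLinearModel B q ι ω := ⟨h₁, h₂, h₃, h₄, h₅⟩
  have := hm.finite_left
  obtain ⟨z, hz⟩ := exists_card_addSubgroup_eq_pow hp hcard B.ker
  have hz2 : 2 ≤ z := by
    by_contra! h
    interval_cases z
    · have : Subsingleton B.ker := (Nat.card_eq_one_iff_unique.1 (by simpa using hz)).1
      exact hcyc inferInstance
    · exact hcyc (isAddCyclic_of_prime_card (p := p) (by simpa using hz))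
  have hrank := hm.finrank_add hcard hz
  have hr : 2 ≤ Module.finrank (ZMod p) V := by
    by_contra! h
    obtain ⟨v, hv⟩ := finrank_le_one_iff.1 (Nat.le_of_lt_succ h)
    refine hB (AddMonoidHom.ext fun x => AddMonoidHom.ext fun y => ?_)
    obtain ⟨s, hs⟩ := hv (q x)
    obtain ⟨t, ht⟩ := hv (q y)
    rw [← hm.map_bracket, ← hs, ← ht]
    simp [hm.form_self halt]
  obtain h | h | h : Module.finrank (ZMod p) V = 2 ∨ Module.finrank (ZMod p) V = 3 ∨
      Module.finrank (ZMod p) V = 4 := by omega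
  · exact hm.hasNoncentralAut_of_finrank_eq_two hodd halt hnil hcard hB h
  · exact hm.hasNoncentralAut_of_finrank_eq_three hodd halt hnil hcard hz (by omega) h
  · obtain rfl : z = 2 := by omega
    exact hm.hasNoncentralAut_of_finrank_eq_four hodd halt hnil hz hcyc h

/-- A Miller `p`-group, `p` odd, has order at least `p ^ 7`. -/
theorem miller_pGroup_card_ge_p_pow_seven
    (p : ℕ) (hp : p.Prime) (hodd : Odd p)
    (G : Type*) [Group G] (hG : IsMiller G) (hpG : IsPGroup p G) :
    p ^ 7 ≤ Nat.card G := by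
  by_contra! hlt
  have : Fact p.Prime := ⟨hp⟩
  have := hG.1
  obtain ⟨n, hn⟩ := IsPGroup.iff_card.1 hpG
  rw [hn, Nat.pow_lt_pow_iff_right hp.one_lt] at hlt
  obtain ⟨k, hk⟩ : Odd (Nat.card G) := hn ▸ hodd.pow
  have hh : ∀ g : G, (g ^ (k + 1)) ^ 2 = g := fun g => by
    rw [← pow_mul, show (k + 1) * 2 = Nat.card G + 1 by omega, pow_succ, pow_card_eq_one', one_mul]
  let := baerAddCommGroup hh hG.commute_commutatorElement
  obtain ⟨a, b, hab⟩ := hG.2.1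
  refine hG.not_hasNoncentralAut hh (hasNoncentralAut_of_card_le hp hodd hn (by omega)
    (fun x => commutatorElement_self x)
    (fun x y z => commutatorElement_eq_one_iff_commute.2 (hG.commute_commutatorElement x y z))
    fun h => hab ?_)
  exact commutatorElement_eq_one_iff_mul_comm.1 (DFunLike.congr_fun (DFunLike.congr_fun h a) b)
end
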